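/- Let G be a finitely generated virtually free group and H a finitely generated subgroup of G. Then H is a free factor of G if and only if for every finite group P, the number h(G,H,γ,P) of homomorphisms G → P extending γ is the same for all homomorphisms γ : H → P. -/

import Mathlib

/-- A subgroup `H` of `G` is a *free factor* of `G` if there is a subgroup `L` such that the
natural homomorphism from the free product `H ∗ L` to `G` is an isomorphism. -/
def Subgroup.IsFreeFactor {G : Type*} [Group G] (H : Subgroup G) : Prop :=
  ∃ L : Subgroup G, Function.Bijective (Monoid.Coprod.lift H.subtype L.subtype)

/-- A group is *virtually free* if it has a free subgroup of finite index. -/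
def IsVirtuallyFree (G : Type*) [Group G] : Prop :=
  ∃ F : Subgroup G, F.FiniteIndex ∧ IsFreeGroup F

open scoped Pointwise

/-! ### Equivariant sections -/

section EquivariantSection

variable {K Y Q : Type*} [Group K] [MulAction K Y] [MulAction K Q]

/-- A surjective equivariant map has a section that is equivariant at all points with trivial
stabilizer. -/
theorem exists_equivariant_section (π : Q → Y) (hπ : ∀ (k : K) q, π (k • q) = k • π q)
    (hs : Function.Surjective π) :
    ∃ s : Y → Q, (∀ y, π (s y) = y) ∧
      ∀ y (k : K), (∀ k' : K, k' • y = y → k' = 1) → s (k • y) = k • s y := by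
  classical
  let r : Y → Y := fun y => (Quotient.mk (MulAction.orbitRel K Y) y).out
  have hr : ∀ y, ∃ k : K, k • r y = y := fun y => by
    have : MulAction.orbitRel K Y (r y) y := Quotient.mk_out (s := MulAction.orbitRel K Y) y
    obtain ⟨k, hk⟩ := MulAction.orbitRel_apply.1 ((MulAction.orbitRel K Y).symm this)
    exact ⟨k, hk⟩
  have hr' : ∀ y (k : K), r (k • y) = r y := fun y k => by
    have : Quotient.mk (MulAction.orbitRel K Y) (k • y) = Quotient.mk _ y :=
      Quotient.sound (s := MulAction.orbitRel K Y) ⟨k, rfl⟩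
    simp only [r, this]
  choose κ hκ using hr
  choose t ht using hs
  refine ⟨fun y => κ y • t (r y), fun y => by rw [hπ, ht, hκ], fun y k hy => ?_⟩
  have h1 : κ (k • y) = k * κ y := by
    have h2 := hκ (k • y)
    rw [hr'] at h2
    have h3 := hy ((κ y) * (κ (k • y))⁻¹ * k) (by
      rw [mul_smul, mul_smul, inv_smul_eq_iff.2 h2.symm, hκ])
    have h5 : κ y * (κ (k • y))⁻¹ = k⁻¹ := eq_inv_of_mul_eq_one_left h3
    rw [mul_inv_eq_iff_eq_mul.1 h5, mul_inv_cancel_left]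
  simp only [h1, hr', mul_smul]

end EquivariantSection

/-! ### From a choice of directions to a free complement -/

section Directions

variable {G : Type*} [Group G] {H : Subgroup G}

/-- An equivariant, coherent choice of a representative `c p q` of the coset `p` for every
other coset `q`. -/
structure DirectionSystem (H : Subgroup G) (c : G ⧸ H → G ⧸ H → G) : Prop where
  coe : ∀ p q, ((c p q : G) : G ⧸ H) = p
  smul : ∀ (g : G) p q, p ≠ q → c (g • p) (g • q) = g * c p q
  coherent : ∀ p p' q, p ≠ p' → q ≠ p → q ≠ p' → c p q ≠ c p p' → c p' q = c p' p
  finite : ∀ q q', {p | p ≠ q ∧ p ≠ q' ∧ c p q ≠ c p q'}.Finite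

namespace DirectionSystem

variable {c : G ⧸ H → G ⧸ H → G} (hc : DirectionSystem H c)

/-- Two elements are linked if they are equal or represent neighbouring cosets and point at
each other. -/
def Linked (c : G ⧸ H → G ⧸ H → G) (a b : G) : Prop :=
  a = b ∨ ((a : G ⧸ H) ≠ b ∧ c a b = a ∧ c b a = b ∧
    ∀ p : G ⧸ H, p ≠ a → p ≠ b → c p a = c p b)

theorem linked_symm {a b : G} (h : Linked c a b) : Linked c b a := by
  rcases h with h | ⟨h1, h2, h3, h4⟩
  · exact Or.inl h.symm
  · exact Or.inr ⟨h1.symm, h3, h2, fun p hp hp' => (h4 p hp' hp).symm⟩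

theorem linked_trans {a b d : G} (h : Linked c a b) (h' : Linked c b d) : Linked c a d := by
  rcases h with rfl | ⟨h1, h2, h3, h4⟩
  · exact h'
  rcases h' with rfl | ⟨k1, k2, k3, k4⟩
  · exact Or.inr ⟨h1, h2, h3, h4⟩
  by_cases had : (a : G ⧸ H) = d
  · left; rw [← h2, ← k3, had]
  refine Or.inr ⟨had, ?_, ?_, fun p hp hp' => ?_⟩
  · rw [← k4 a h1 had, h2]
  · rw [h4 d (Ne.symm had) k1.symm, k3]
  · by_cases hpb : p = b
    · rw [hpb, h3, k2]
    · rw [h4 p hp hpb, k4 p hpb hp']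

theorem linked_mul (hc : DirectionSystem H c) (g : G) {a b : G} (h : Linked c a b) :
    Linked c (g * a) (g * b) := by
  rcases h with rfl | ⟨h1, h2, h3, h4⟩
  · exact Or.inl rfl
  have e : ∀ x : G, ((g * x : G) : G ⧸ H) = g • (x : G ⧸ H) := fun x => rfl
  refine Or.inr ⟨?_, ?_, ?_, fun p hp hp' => ?_⟩
  · rw [e, e]; exact fun h => h1 (smul_left_cancel _ h)
  · rw [e, e, hc.smul _ _ _ h1, h2]
  · rw [e, e, hc.smul _ _ _ h1.symm, h3]
  · rw [e] at hp hp' ⊢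
    rw [e]
    have k := h4 (g⁻¹ • p) (fun h => hp (by rw [← h, smul_inv_smul]))
      (fun h => hp' (by rw [← h, smul_inv_smul]))
    have k1 := hc.smul g (g⁻¹ • p) a (fun h => hp (by rw [← h, smul_inv_smul]))
    have k2 := hc.smul g (g⁻¹ • p) b (fun h => hp' (by rw [← h, smul_inv_smul]))
    rw [smul_inv_smul] at k1 k2
    rw [k1, k2, k]

/-- The subgroup of the elements linked to `1`. -/
def linkSubgroup (hc : DirectionSystem H c) : Subgroup G where
  carrier := {g | Linked c 1 g}
  one_mem' := Or.inl rfl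
  mul_mem' {a b} ha hb := by
    have := hc.linked_mul a hb
    rw [mul_one] at this
    exact linked_trans ha this
  inv_mem' {a} ha := by
    have := hc.linked_mul a⁻¹ ha
    rw [mul_one, inv_mul_cancel] at this
    exact linked_symm this

/-- Alternating words in a free product of two groups, indexed by the side of the first letter. -/
inductive AltWord {A B : Type*} [Group A] [Group B] : Bool → Monoid.Coprod A B → Prop
  | one (b : Bool) : AltWord b 1
  | inl (a : A) (w : Monoid.Coprod A B) : a ≠ 1 → AltWord false w →
      AltWord true (Monoid.Coprod.inl a * w)
  | inr (b : B) (w : Monoid.Coprod A B) : b ≠ 1 → AltWord true w →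
      AltWord false (Monoid.Coprod.inr b * w)

theorem AltWord.exists {A B : Type*} [Group A] [Group B] (w : Monoid.Coprod A B) :
    ∃ b, AltWord b w := by
  induction w using Monoid.Coprod.induction_on' with
  | one => exact ⟨true, .one _⟩
  | inl_mul a w ih =>
    by_cases ha : a = 1
    · simpa [ha] using ih
    obtain ⟨b, hb⟩ := ih
    cases hb with
    | one => exact ⟨true, .inl a 1 ha (.one _)⟩
    | inl a' w' ha' hw' =>
      rw [← mul_assoc, ← map_mul]
      by_cases h : a * a' = 1
      · exact ⟨false, by simpa [h] using hw'⟩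
      · exact ⟨true, .inl _ _ h hw'⟩
    | inr b' w' hb' hw' => exact ⟨true, .inl _ _ ha (.inr _ _ hb' hw')⟩
  | inr_mul a w ih =>
    by_cases ha : a = 1
    · simpa [ha] using ih
    obtain ⟨b, hb⟩ := ih
    cases hb with
    | one => exact ⟨false, .inr a 1 ha (.one _)⟩
    | inr a' w' ha' hw' =>
      rw [← mul_assoc, ← map_mul]
      by_cases h : a * a' = 1
      · exact ⟨true, by simpa [h] using hw'⟩
      · exact ⟨false, .inr _ _ h hw'⟩
    | inl b' w' hb' hword => exact ⟨false, .inr _ _ ha (.inl _ _ hb' hword)⟩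

/-- A ping-pong criterion for a free product of two subgroups. -/
theorem coprod_lift_injective_of_ping_pong (H L : Subgroup G) (U W : Set G)
    (hU : (1 : G) ∉ U) (hW : (1 : G) ∉ W)
    (hH : ∀ h ∈ H, h ≠ 1 → ∀ x, x = 1 ∨ x ∈ W → h * x ∈ U)
    (hL : ∀ l ∈ L, l ≠ 1 → ∀ x, x = 1 ∨ x ∈ U → l * x ∈ W) :
    Function.Injective (Monoid.Coprod.lift H.subtype L.subtype) := by
  set φ := Monoid.Coprod.lift H.subtype L.subtype with hφ
  have key : ∀ b (w : Monoid.Coprod H L), AltWord b w →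
      w = 1 ∨ φ w ∈ (if b then U else W) := by
    intro b w hw
    induction hw with
    | one => exact Or.inl rfl
    | inl a w ha hw ih =>
      right
      simp only [map_mul, if_true, hφ, Monoid.Coprod.lift_apply_inl]
      refine hH _ a.2 (by simpa using ha) _ ?_
      rcases ih with rfl | ih
      · left; simp
      · right; simpa using ih
    | inr a w ha hw ih =>
      right
      simp only [map_mul, hφ, Monoid.Coprod.lift_apply_inr]
      refine hL _ a.2 (by simpa using ha) _ ?_
      rcases ih with rfl | ih
      · left; simp
      · right; simpa using ih
  refine (injective_iff_map_eq_one φ).2 fun w hw => ?_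
  obtain ⟨b, hb⟩ := AltWord.exists w
  rcases key b w hb with h | h
  · exact h
  · rw [hw] at h
    cases b
    · exact absurd h hW
    · exact absurd h hU

theorem mk_eq_one_iff {x : G} : ((x : G) : G ⧸ H) = ((1 : G) : G ⧸ H) ↔ x ∈ H := by
  rw [eq_comm, QuotientGroup.eq]; simp

theorem lift_injective (hc : DirectionSystem H c) :
    Function.Injective (Monoid.Coprod.lift H.subtype hc.linkSubgroup.subtype) := by
  let o : G ⧸ H := ((1 : G) : G ⧸ H)
  have e : ∀ g x : G, ((g * x : G) : G ⧸ H) = g • (x : G ⧸ H) := fun g x => rfl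
  refine coprod_lift_injective_of_ping_pong H _
    {x | x ≠ 1 ∧ ((x : G ⧸ H) = o ∨ c o x ≠ 1)} {x | (x : G ⧸ H) ≠ o ∧ c o x = 1}
    (by simp) (by simp [o]) ?_ ?_
  · intro h hh h1 x hx
    have ho : h • o = o := by
      show ((h * 1 : G) : G ⧸ H) = o
      rw [mul_one]; exact mk_eq_one_iff.2 hh
    rcases hx with rfl | ⟨hx1, hx2⟩
    · rw [mul_one]; exact ⟨h1, Or.inl (mk_eq_one_iff.2 hh)⟩
    · refine ⟨fun hx => hx1 ?_, Or.inr ?_⟩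
      · have : x = h⁻¹ := (inv_eq_of_mul_eq_one_right hx).symm
        rw [this]; exact mk_eq_one_iff.2 (H.inv_mem hh)
      · have := hc.smul h o x (Ne.symm hx1)
        rw [ho] at this
        rw [e, this, hx2, mul_one]; exact h1
  · rintro l (rfl | ⟨l1, l2, l3, l4⟩) hl x hx
    · exact absurd rfl hl
    rcases hx with rfl | ⟨hx1, hx2⟩
    · rw [mul_one]; exact ⟨l1.symm, l2⟩
    by_cases hxo : (x : G ⧸ H) = o
    · have : ((l * x : G) : G ⧸ H) = l := by
        rw [e, hxo]; show ((l * 1 : G) : G ⧸ H) = l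
        rw [mul_one]
      exact ⟨by rw [this]; exact l1.symm, by rw [this]; exact l2⟩
    · have hx3 := hx2.resolve_left hxo
      have elo : l • o = (l : G ⧸ H) := by
        show ((l * 1 : G) : G ⧸ H) = l
        rw [mul_one]
      have k := hc.smul l o x (Ne.symm hxo)
      rw [elo, ← e] at k
      have hne : c l (l * x : G) ≠ c l o := by
        rw [k, l3]; simpa using hx3
      have h1 : ((l * x : G) : G ⧸ H) ≠ l := by
        rw [← elo, e]; exact fun h => hxo (smul_left_cancel _ h)
      have h2 : ((l * x : G) : G ⧸ H) ≠ o := fun h => hne (by rw [h])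
      refine ⟨h2, ?_⟩
      rw [hc.coherent l o _ l1.symm h1 h2 hne]; exact l2

theorem inv_mul_mem_sup (hc : DirectionSystem H c) (n : ℕ) : ∀ a b : G,
    {p : G ⧸ H | p ≠ a ∧ p ≠ b ∧ c p a ≠ c p b}.ncard = n →
      a⁻¹ * b ∈ H ⊔ hc.linkSubgroup := by
  induction n using Nat.strong_induction_on with
  | _ n ih =>
  intro a b hn
  have memH : ∀ x y : G, (x : G ⧸ H) = y → x⁻¹ * y ∈ H ⊔ hc.linkSubgroup := fun x y h =>
    (le_sup_left : H ≤ _) (QuotientGroup.eq.1 h)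
  by_cases hab : (a : G ⧸ H) = b
  · exact memH _ _ hab
  by_cases hS : {p : G ⧸ H | p ≠ a ∧ p ≠ b ∧ c p a ≠ c p b} = ∅
  · have ha := hc.coe a b
    have hb := hc.coe b a
    have hlink : Linked c (c a b) (c b a) := by
      refine Or.inr ⟨by rw [ha, hb]; exact hab, by rw [ha, hb], by rw [ha, hb], fun p hp hp' => ?_⟩
      rw [ha] at hp ⊢; rw [hb] at hp' ⊢
      by_contra h
      have : p ∈ {p : G ⧸ H | p ≠ a ∧ p ≠ b ∧ c p a ≠ c p b} := ⟨hp, hp', h⟩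
      rw [hS] at this; exact this
    have h2 : (c a b)⁻¹ * c b a ∈ hc.linkSubgroup := by
      have := hc.linked_mul (c a b)⁻¹ hlink
      rw [inv_mul_cancel] at this; exact this
    have := mul_mem (mul_mem (memH _ _ ha.symm) ((le_sup_right : hc.linkSubgroup ≤ _) h2))
      (memH _ _ hb)
    simpa [mul_assoc] using this
  · obtain ⟨p, hpa, hpb, hp⟩ := Set.nonempty_iff_ne_empty.2 hS
    obtain ⟨g, rfl⟩ := QuotientGroup.mk_surjective p
    have sub : ∀ a b : G, (g : G ⧸ H) ≠ a → (g : G ⧸ H) ≠ b → (a : G ⧸ H) ≠ b →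
        c g a ≠ c g b →
        {p : G ⧸ H | p ≠ a ∧ p ≠ g ∧ c p a ≠ c p g} ⊆
          {p : G ⧸ H | p ≠ a ∧ p ≠ b ∧ c p a ≠ c p b} \ {(g : G ⧸ H)} := by
      rintro a b hga hgb hab hg q ⟨hqa, hqg, hq⟩
      have hqb : q ≠ b := by
        rintro rfl
        exact hg (hc.coherent b g a hqg hab hga.symm hq)
      refine ⟨⟨hqa, hqb, fun h => ?_⟩, hqg⟩
      have h1 := hc.coherent q g a hqg hqa.symm hga.symm hq
      have h2 := hc.coherent g q b hqg.symm hgb.symm hqb.symm (by rw [← h1]; exact hg.symm)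
      exact hq (h.trans h2)
    have lt : ∀ T : Set (G ⧸ H),
        T ⊆ {p : G ⧸ H | p ≠ a ∧ p ≠ b ∧ c p a ≠ c p b} \ {(g : G ⧸ H)} → T.ncard < n := by
      intro T hT
      rw [← hn]
      refine Set.ncard_lt_ncard (lt_of_le_of_lt hT ?_) (hc.finite _ _)
      exact Set.sdiff_singleton_ssubset.2 ⟨hpa, hpb, hp⟩
    have h1 := ih _ (lt _ (sub a b hpa hpb hab hp)) a g rfl
    have sub2 := sub b a hpb hpa (Ne.symm hab) (Ne.symm hp)
    have h2 := ih _ (lt {p : G ⧸ H | p ≠ g ∧ p ≠ b ∧ c p g ≠ c p b} (by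
      rintro q ⟨q1, q2, q3⟩
      obtain ⟨⟨r1, r2, r3⟩, r4⟩ := sub2 ⟨q2, q1, q3.symm⟩
      exact ⟨⟨r2, r1, r3.symm⟩, r4⟩)) g b rfl
    simpa [mul_assoc] using mul_mem h1 h2

theorem isFreeFactor (hc : DirectionSystem H c) : H.IsFreeFactor := by
  refine ⟨hc.linkSubgroup, hc.lift_injective, fun g => ?_⟩
  have h := hc.inv_mul_mem_sup _ 1 g rfl
  have : (Monoid.Coprod.lift H.subtype hc.linkSubgroup.subtype).range =
      H ⊔ hc.linkSubgroup := by
    rw [Monoid.Coprod.range_lift]; simp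
  rw [inv_one, one_mul, ← this] at h
  exact h

end DirectionSystem

end Directions

/-! ### Nested families of cuts -/

section Nested

variable {G V : Type*} [Group G] [MulAction G V]

/-- A nested invariant family of subsets of `V`, closed under complements, such that two points
are separated by only finitely many members. -/
structure NestedFamily (G : Type*) {V : Type*} [Group G] [MulAction G V] (E : Set (Set V)) :
    Prop where
  compl : ∀ A ∈ E, Aᶜ ∈ E
  smul : ∀ (g : G), ∀ A ∈ E, g • A ∈ E
  nested : ∀ A ∈ E, ∀ B ∈ E, A ⊆ B ∨ B ⊆ A ∨ A ⊆ Bᶜ ∨ Bᶜ ⊆ A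
  finite : ∀ p q, {A ∈ E | q ∈ A ∧ p ∉ A}.Finite

/-- The union of the members of `E` that contain `q` but not `p`. -/
def branch (E : Set (Set V)) (p q : V) : Set V := ⋃₀ {A ∈ E | q ∈ A ∧ p ∉ A}

namespace NestedFamily

variable {E : Set (Set V)}

theorem total (hE : NestedFamily G E) {p q : V} {A B : Set V} (hA : A ∈ E) (hB : B ∈ E)
    (hqA : q ∈ A) (hpA : p ∉ A) (hqB : q ∈ B) (hpB : p ∉ B) : A ⊆ B ∨ B ⊆ A := by
  rcases hE.nested A hA B hB with h | h | h | h
  · exact Or.inl h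
  · exact Or.inr h
  · exact absurd hqB (h hqA)
  · exact absurd (h hpB) hpA

theorem branch_mem (hE : NestedFamily G E) {p q : V} (h : ∃ A ∈ E, q ∈ A ∧ p ∉ A) :
    branch E p q ∈ E ∧ q ∈ branch E p q ∧ p ∉ branch E p q := by
  obtain ⟨A, hA⟩ := h
  obtain ⟨M, hM⟩ := (hE.finite p q).exists_maximal ⟨A, hA⟩
  have : branch E p q = M := by
    refine Set.Subset.antisymm (Set.sUnion_subset fun B hB => ?_)
      (Set.subset_sUnion_of_mem hM.prop)
    rcases hE.total hB.1 hM.prop.1 hB.2.1 hB.2.2 hM.prop.2.1 hM.prop.2.2 with h | h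
    · exact h
    · exact hM.le_of_ge hB h
  rw [this]; exact ⟨hM.prop.1, hM.prop.2⟩

theorem subset_branch {p q : V} {A : Set V} (hA : A ∈ E) (hq : q ∈ A) (hp : p ∉ A) :
    A ⊆ branch E p q := Set.subset_sUnion_of_mem ⟨hA, hq, hp⟩

theorem smul_branch (hE : NestedFamily G E) (g : G) (p q : V) :
    branch E (g • p) (g • q) = g • branch E p q := by
  ext x
  simp only [branch, Set.mem_sUnion, Set.mem_smul_set_iff_inv_smul_mem, Set.mem_ofPred_eq]
  constructor
  · rintro ⟨A, ⟨hA, hq, hp⟩, hx⟩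
    exact ⟨g⁻¹ • A, ⟨hE.smul _ _ hA, by simpa [Set.mem_smul_set_iff_inv_smul_mem] using hq,
      by simpa [Set.mem_smul_set_iff_inv_smul_mem] using hp⟩,
      by simpa [Set.mem_smul_set_iff_inv_smul_mem] using hx⟩
  · rintro ⟨A, ⟨hA, hq, hp⟩, hx⟩
    exact ⟨g • A, ⟨hE.smul _ _ hA, by simpa [Set.mem_smul_set_iff_inv_smul_mem] using hq,
      by simpa [Set.mem_smul_set_iff_inv_smul_mem] using hp⟩,
      by simpa [Set.mem_smul_set_iff_inv_smul_mem] using hx⟩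

end NestedFamily

/-- A nested family of cuts of `G ⧸ H` that separates points and on which `G` acts freely makes
`H` a free factor. -/
theorem NestedFamily.isFreeFactor {G : Type*} [Group G] {H : Subgroup G} {E : Set (Set (G ⧸ H))}
    (hE : NestedFamily G E) (hsep : ∀ p q : G ⧸ H, p ≠ q → ∃ A ∈ E, q ∈ A ∧ p ∉ A)
    (hfree : ∀ A ∈ E, ∀ g : G, g • A = A → g = 1) : H.IsFreeFactor := by
  let π : G × Set (G ⧸ H) → (G ⧸ H) × Set (G ⧸ H) := fun x => ((x.1 : G ⧸ H), x.2)
  obtain ⟨s, hs1, hs2⟩ := exists_equivariant_section (K := G) π (fun k q => rfl) (by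
    rintro ⟨p, A⟩
    obtain ⟨g, rfl⟩ := QuotientGroup.mk_surjective p
    exact ⟨(g, A), rfl⟩)
  have hb := fun p q (h : p ≠ q) => hE.branch_mem (hsep p q h)
  have hdisj : ∀ p p' q : G ⧸ H, p ≠ p' → q ≠ p → branch E p q ≠ branch E p p' →
      q ∉ branch E p p' := by
    intro p p' q hpp' hqp hne hq
    obtain ⟨h1, h2, h3⟩ := hb p p' hpp'
    obtain ⟨k1, k2, k3⟩ := hb p q hqp.symm
    have e1 : branch E p p' ⊆ branch E p q := subset_branch h1 hq h3
    exact hne (Set.Subset.antisymm (subset_branch k1 (e1 h2) k3) e1)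
  refine DirectionSystem.isFreeFactor (c := fun p q => (s (p, branch E p q)).1)
    ⟨fun p q => ?_, fun g p q hpq => ?_, fun p p' q hpp' hqp hqp' hne => ?_, fun q q' => ?_⟩
  · exact congrArg Prod.fst (hs1 (p, branch E p q))
  · have := hs2 (p, branch E p q) g (fun k hk => hfree _ (hb p q hpq).1 k (congrArg Prod.snd hk))
    rw [hE.smul_branch]
    exact congrArg Prod.fst this
  · have hne' : branch E p q ≠ branch E p p' := fun h => hne (by simp only [h])
    have hq := hdisj p p' q hpp' hqp hne'
    obtain ⟨h1, h2, h3⟩ := hb p p' hpp'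
    have e : branch E p' q = branch E p' p := by
      obtain ⟨a1, a2, a3⟩ := hb p' p hpp'.symm
      obtain ⟨b1, b2, b3⟩ := hb p' q hqp'.symm
      have i1 : (branch E p p')ᶜ ⊆ branch E p' p :=
        subset_branch (hE.compl _ h1) h3 (fun h => h h2)
      have i2 : (branch E p p')ᶜ ⊆ branch E p' q :=
        subset_branch (hE.compl _ h1) hq (fun h => h h2)
      exact Set.Subset.antisymm (subset_branch b1 (i2 h3) b3) (subset_branch a1 (i1 hq) a3)
    simp only [e]
  · refine Set.Finite.of_finite_image (f := fun p => branch E p q) ((hE.finite q' q).subset ?_) ?_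
    · rintro _ ⟨p, ⟨h1, h2, h3⟩, rfl⟩
      obtain ⟨k1, k2, k3⟩ := hb p q h1
      exact ⟨k1, k2, hdisj p q q' h1 h2.symm (fun h => h3 (by simp only [h]))⟩
    · rintro p ⟨h1, -, -⟩ p' ⟨h1', -, -⟩ hpp'
      by_contra hne
      simp only at hpp'
      obtain ⟨A, hA, hpA, hpA'⟩ := hsep p' p (Ne.symm hne)
      obtain ⟨-, -, k3⟩ := hb p q h1
      obtain ⟨-, -, k3'⟩ := hb p' q h1'
      by_cases hq : q ∈ A
      · exact k3 (hpp' ▸ subset_branch hA hq hpA' hpA)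
      · exact k3' (hpp' ▸ subset_branch (hE.compl _ hA) hq (fun h => h hpA) hpA')

end Nested

/-! ### Finite cuts of a multigraph -/

section Cuts

variable {V ε : Type*} (a b : ε → V)

/-- The edges with exactly one end in `A`. -/
def bdry (A : Set V) : Set ε := {e | ¬(a e ∈ A ↔ b e ∈ A)}

/-- The multigraph with edge set `D` is connected. -/
def ConnectedBy (D : Set ε) : Prop := ∀ A : Set V, bdry a b A ∩ D = ∅ → A = ∅ ∨ A = Set.univ

/-- The boundary of `A` in `D` is minimal among nonempty boundaries. -/
def IsBond (D : Set ε) (A : Set V) : Prop :=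
  ∀ B, bdry a b B ∩ D ⊆ bdry a b A ∩ D → bdry a b B ∩ D = ∅ ∨ bdry a b B ∩ D = bdry a b A ∩ D

variable {a b} {D : Set ε}

theorem bdry_compl (A : Set V) : bdry a b Aᶜ = bdry a b A := by
  ext e; simp only [bdry, Set.mem_compl_iff, Set.mem_ofPred_eq]; tauto

theorem ConnectedBy.eq_or_eq_compl (hD : ConnectedBy a b D) {A B : Set V}
    (h : bdry a b A ∩ D = bdry a b B ∩ D) : A = B ∨ A = Bᶜ := by
  have : bdry a b {v | v ∈ A ↔ v ∈ B} ∩ D = ∅ := by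
    ext e
    have := Set.ext_iff.1 h e
    simp only [bdry, Set.mem_inter_iff, Set.mem_ofPred_eq, Set.mem_empty_iff_false] at this ⊢
    tauto
  rcases hD _ this with h | h
  · right; ext v
    have := Set.ext_iff.1 h v
    simp only [Set.mem_ofPred_eq, Set.mem_empty_iff_false, Set.mem_compl_iff] at this ⊢
    tauto
  · left; ext v
    exact Set.ext_iff.1 h v |>.2 trivial

theorem ConnectedBy.exists_finite_path (hD : ConnectedBy a b D) (x y : V) :
    ∃ Q : Set ε, Q.Finite ∧ Q ⊆ D ∧ ∀ A : Set V, ¬(x ∈ A ↔ y ∈ A) → ∃ e ∈ Q, e ∈ bdry a b A := by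
  let S : Set V := {z | ∃ Q : Set ε, Q.Finite ∧ Q ⊆ D ∧
    ∀ A : Set V, ¬(x ∈ A ↔ z ∈ A) → ∃ e ∈ Q, e ∈ bdry a b A}
  have key : ∀ z z' : V, ∀ e ∈ D, z ∈ S → (∀ A : Set V, ¬(z ∈ A ↔ z' ∈ A) → e ∈ bdry a b A) →
      z' ∈ S := by
    rintro z z' e he ⟨Q, hQ, hQD, h⟩ hz
    refine ⟨insert e Q, hQ.insert _, Set.insert_subset he hQD, fun A hA => ?_⟩
    by_cases hzA : z ∈ A ↔ z' ∈ A
    · obtain ⟨f, hf, hf'⟩ := h A (by rwa [hzA])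
      exact ⟨f, Set.mem_insert_of_mem _ hf, hf'⟩
    · exact ⟨e, Set.mem_insert _ _, hz A hzA⟩
  have hS : bdry a b S ∩ D = ∅ := by
    ext e
    simp only [Set.mem_inter_iff, Set.mem_empty_iff_false, iff_false, not_and]
    intro he heD
    exact he ⟨fun h => key _ _ e heD h fun A hA => hA,
      fun h => key _ _ e heD h fun A hA => fun h => hA h.symm⟩
  have hx : x ∈ S := ⟨∅, Set.finite_empty, Set.empty_subset _, fun A hA => absurd Iff.rfl hA⟩
  rcases hD S hS with h | h
  · rw [h] at hx; exact hx.elim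
  · exact (h ▸ Set.mem_univ y : y ∈ S)

theorem finite_bonds_through (n : ℕ) : ∀ D : Set ε, ConnectedBy a b D → ∀ e : ε,
    {A : Set V | (bdry a b A ∩ D).Finite ∧ (bdry a b A ∩ D).ncard ≤ n ∧ e ∈ bdry a b A ∩ D ∧
      IsBond a b D A}.Finite := by
  induction n with
  | zero =>
    intro D _ e
    convert Set.finite_empty
    ext A
    simp only [Set.mem_ofPred_eq, Set.mem_empty_iff_false, iff_false]
    rintro ⟨h1, h2, h3, -⟩
    have := (Set.ncard_pos h1).2 ⟨e, h3⟩
    omega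
  | succ n ih =>
    intro D hD e
    by_cases heD : e ∈ D
    swap
    · convert Set.finite_empty
      ext A
      simp only [Set.mem_ofPred_eq, Set.mem_empty_iff_false, iff_false]
      rintro ⟨-, -, h, -⟩
      exact heD h.2
    by_cases hD' : ConnectedBy a b (D \ {e})
    · obtain ⟨Q, hQ, hQD, hQc⟩ := hD'.exists_finite_path (a e) (b e)
      refine (hQ.biUnion fun e' _ => ih _ hD' e').subset ?_
      rintro A ⟨h1, h2, h3, h4⟩
      obtain ⟨e', he', he'A⟩ := hQc A h3.1
      have hss : bdry a b A ∩ (D \ {e}) = (bdry a b A ∩ D) \ {e} := by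
        rw [Set.inter_sdiff_assoc]
      refine Set.mem_biUnion he' ⟨?_, ?_, ⟨he'A, hQD he'⟩, fun B hB => ?_⟩
      · rw [hss]; exact h1.subset Set.sdiff_subset
      · rw [hss, Set.ncard_sdiff_singleton_of_mem h3]; omega
      · have := h4 B (by
          rintro f ⟨hf, hfD⟩
          by_cases hfe : f = e
          · rw [hfe]; exact h3
          · exact ⟨(hB ⟨hf, hfD, hfe⟩).1, hfD⟩)
        rw [← Set.inter_sdiff_assoc, ← Set.inter_sdiff_assoc]
        rcases this with h | h
        · left; rw [h]; simp
        · right; rw [h]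
    · simp only [ConnectedBy, not_forall, not_or] at hD'
      obtain ⟨B, hB, hB1, hB2⟩ := hD'
      have hBe : bdry a b B ∩ D ⊆ {e} := by
        rintro f ⟨hf, hfD⟩
        by_contra hfe
        have : f ∈ bdry a b B ∩ (D \ {e}) := ⟨hf, hfD, hfe⟩
        rw [hB] at this; exact this
      refine (Set.toFinite {B, Bᶜ}).subset ?_
      rintro A ⟨h1, h2, h3, h4⟩
      rcases h4 B (fun f hf => by rw [hBe hf]; exact h3) with h | h
      · rcases hD B h with h | h
        · exact absurd h hB1
        · exact absurd h hB2
      · exact hD.eq_or_eq_compl h.symm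

/-- All four corners of the pair `A`, `B` are nonempty. -/
def Crosses (A B : Set V) : Prop :=
  (A ∩ B).Nonempty ∧ (A ∩ Bᶜ).Nonempty ∧ (Aᶜ ∩ B).Nonempty ∧ (Aᶜ ∩ Bᶜ).Nonempty

theorem Crosses.symm {A B : Set V} (h : Crosses A B) : Crosses B A := by
  obtain ⟨h1, h2, h3, h4⟩ := h
  refine ⟨?_, ?_, ?_, ?_⟩ <;> rw [Set.inter_comm] <;> assumption

theorem crosses_compl_left {A B : Set V} : Crosses Aᶜ B ↔ Crosses A B := by
  simp only [Crosses, compl_compl]; tauto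

theorem crosses_compl_right {A B : Set V} : Crosses A Bᶜ ↔ Crosses A B := by
  simp only [Crosses, compl_compl]; tauto

/-- The bonds of size at most `n`. -/
def smallBonds (a b : ε → V) (n : ℕ) : Set (Set V) :=
  {A | (bdry a b A).Finite ∧ (bdry a b A).ncard ≤ n ∧ IsBond a b Set.univ A}

theorem finite_smallBonds (hc : ConnectedBy a b Set.univ) (n : ℕ) (e : ε) :
    {A ∈ smallBonds a b n | e ∈ bdry a b A}.Finite := by
  refine (finite_bonds_through n _ hc e).subset ?_
  rintro A ⟨⟨h1, h2, h3⟩, h4⟩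
  simp only [Set.inter_univ, Set.mem_ofPred_eq]
  exact ⟨h1, h2, h4, h3⟩

theorem finite_separating (hc : ConnectedBy a b Set.univ) (n : ℕ) (x y : V) :
    {A ∈ smallBonds a b n | ¬(x ∈ A ↔ y ∈ A)}.Finite := by
  obtain ⟨Q, hQ, -, hQc⟩ := hc.exists_finite_path x y
  refine (hQ.biUnion fun e _ => finite_smallBonds hc n e).subset ?_
  rintro A ⟨h1, h2⟩
  obtain ⟨e, he, heA⟩ := hQc A h2
  exact Set.mem_biUnion he ⟨h1, heA⟩

theorem finite_crossing (hc : ConnectedBy a b Set.univ) (n : ℕ) {A : Set V}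
    (hA : (bdry a b A).Finite) : {B ∈ smallBonds a b n | Crosses A B}.Finite := by
  by_cases hne : (bdry a b A).Nonempty
  swap
  · convert Set.finite_empty
    ext B
    simp only [Set.mem_ofPred_eq, Set.mem_empty_iff_false, iff_false]
    rintro ⟨-, ⟨x, hx⟩, -, ⟨y, hy⟩, -⟩
    rcases hc A (by rw [Set.inter_univ]; exact Set.not_nonempty_iff_eq_empty.1 hne) with h | h
    · rw [h] at hx; exact hx.1
    · rw [h] at hy; exact hy.1 trivial
  obtain ⟨e₀, -⟩ := hne
  choose Q hQ _ hQc using hc.exists_finite_path (a e₀)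
  have hfin := hA.biUnion fun e _ => (finite_separating hc n (a e₀) (a e)).union
    (finite_separating hc n (a e₀) (b e))
  refine hfin.subset ?_
  rintro B ⟨hB, hcr⟩
  by_contra hB'
  simp only [Set.mem_iUnion, Set.mem_union, Set.mem_ofPred_eq, not_exists, not_or, not_and,
    not_not] at hB'
  have hends : ∀ e ∈ bdry a b A, (a e₀ ∈ B ↔ a e ∈ B) ∧ (a e₀ ∈ B ↔ b e ∈ B) := fun e he =>
    ⟨(hB' e he).1 hB, (hB' e he).2 hB⟩
  obtain ⟨C, hC, hCcr, hCn⟩ : ∃ C, IsBond a b Set.univ C ∧ Crosses A C ∧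
      ∀ e ∈ bdry a b A, a e ∉ C ∧ b e ∉ C := by
    by_cases h : a e₀ ∈ B
    · refine ⟨Bᶜ, ?_, crosses_compl_right.2 hcr, fun e he => ?_⟩
      · intro X; rw [bdry_compl]; exact hB.2.2 X
      · have := hends e he
        simp only [Set.mem_compl_iff]; tauto
    · refine ⟨B, hB.2.2, hcr, fun e he => ?_⟩
      have := hends e he; tauto
  have hsub : bdry a b (C ∩ A) ⊆ bdry a b C := by
    intro e he heC
    by_cases heA : e ∈ bdry a b A
    · have := hCn e heA
      simp only [bdry, Set.mem_inter_iff, Set.mem_ofPred_eq] at he; tauto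
    · simp only [bdry, Set.mem_inter_iff, Set.mem_ofPred_eq] at he heA; tauto
  obtain ⟨⟨x, hx⟩, ⟨y, hy⟩, ⟨z, hz⟩, -⟩ := hCcr
  simp only [Set.mem_inter_iff, Set.mem_compl_iff] at hx hy hz
  rcases hC (C ∩ A) (by simpa only [Set.inter_univ] using hsub) with h | h
  · rcases hc _ h with h | h
    · have := Set.ext_iff.1 h x; simp [hx] at this
    · have := Set.ext_iff.1 h y; simp [hy] at this
  · rcases hc.eq_or_eq_compl h with h | h
    · have := Set.ext_iff.1 h z; simp [hz] at this
    · have := Set.ext_iff.1 h x; simp [hx] at this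

/-- The number of small bonds crossing `A`. -/
noncomputable def crossNumber (a b : ε → V) (n : ℕ) (A : Set V) : ℕ :=
  {B ∈ smallBonds a b n | Crosses A B}.ncard

theorem crossNumber_compl (n : ℕ) (A : Set V) :
    crossNumber a b n Aᶜ = crossNumber a b n A := by
  simp only [crossNumber, crosses_compl_left]

theorem bdry_inter_subset (A B : Set V) : bdry a b (A ∩ B) ⊆ bdry a b A ∪ bdry a b B := by
  intro e he
  simp only [bdry, Set.mem_inter_iff, Set.mem_ofPred_eq, Set.mem_union] at he ⊢; tauto

theorem ncard_add_le_of_subset {α : Type*} {S T X Y : Set α} (hX : X.Finite) (hY : Y.Finite)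
    (hu : S ∪ T ⊆ X ∪ Y) (hi : S ∩ T ⊆ X ∩ Y) : S.ncard + T.ncard ≤ X.ncard + Y.ncard := by
  have hS : S.Finite := (hX.union hY).subset (Set.subset_union_left.trans hu)
  have hT : T.Finite := (hX.union hY).subset (Set.subset_union_right.trans hu)
  rw [← Set.ncard_union_add_ncard_inter S T hS hT, ← Set.ncard_union_add_ncard_inter X Y hX hY]
  exact add_le_add (Set.ncard_le_ncard hu (hX.union hY))
    (Set.ncard_le_ncard hi (hX.subset Set.inter_subset_left))

theorem ncard_add_lt_of_ssubset {α : Type*} {S T X Y : Set α} (hX : X.Finite) (hY : Y.Finite)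
    (hu : S ∪ T ⊂ X ∪ Y) (hi : S ∩ T ⊆ X ∩ Y) : S.ncard + T.ncard < X.ncard + Y.ncard := by
  have hS : S.Finite := (hX.union hY).subset (Set.subset_union_left.trans hu.1)
  have hT : T.Finite := (hX.union hY).subset (Set.subset_union_right.trans hu.1)
  rw [← Set.ncard_union_add_ncard_inter S T hS hT, ← Set.ncard_union_add_ncard_inter X Y hX hY]
  exact add_lt_add_of_lt_of_le (Set.ncard_lt_ncard hu (hX.union hY))
    (Set.ncard_le_ncard hi (hX.subset Set.inter_subset_left))

theorem ncard_bdry_corners {A B : Set V} (hA : (bdry a b A).Finite) (hB : (bdry a b B).Finite) :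
    (bdry a b (A ∩ B)).ncard + (bdry a b (Aᶜ ∩ Bᶜ)).ncard ≤
      (bdry a b A).ncard + (bdry a b B).ncard := by
  refine ncard_add_le_of_subset hA hB (Set.union_subset (bdry_inter_subset A B) ?_) ?_
  · have := bdry_inter_subset (a := a) (b := b) Aᶜ Bᶜ
    rwa [bdry_compl, bdry_compl] at this
  · rintro e ⟨he, he'⟩
    simp only [bdry, Set.mem_inter_iff, Set.mem_ofPred_eq, Set.mem_compl_iff] at he he' ⊢
    tauto

theorem crossNumber_corners (hc : ConnectedBy a b Set.univ) (n : ℕ) {A B : Set V}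
    (hA : A ∈ smallBonds a b n) (hB : (bdry a b B).Finite) (hAB : Crosses A B) :
    crossNumber a b n (A ∩ B) + crossNumber a b n (Aᶜ ∩ Bᶜ) <
      crossNumber a b n A + crossNumber a b n B := by
  obtain ⟨⟨x, hx⟩, ⟨y, hy⟩, ⟨z, hz⟩, ⟨w, hw⟩⟩ := id hAB
  have cr : ∀ S T : Set V, Crosses S T ↔ (∃ v, v ∈ S ∧ v ∈ T) ∧ (∃ v, v ∈ S ∧ v ∉ T) ∧
      (∃ v, v ∉ S ∧ v ∈ T) ∧ (∃ v, v ∉ S ∧ v ∉ T) := fun S T => Iff.rfl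
  refine ncard_add_lt_of_ssubset (finite_crossing hc n hA.1) (finite_crossing hc n hB)
    ⟨?_, fun h => ?_⟩ ?_
  · rintro C (⟨h1, h2⟩ | ⟨h1, h2⟩)
    · by_contra h
      have h3 : ¬Crosses A C ∧ ¬Crosses B C := by
        simp only [Set.mem_union, Set.mem_ofPred_eq, not_or, not_and] at h
        exact ⟨h.1 h1, h.2 h1⟩
      rw [cr, cr] at h3; rw [cr] at h2
      simp only [Set.mem_inter_iff, Set.mem_compl_iff] at h2 hw
      grind
    · by_contra h
      have h3 : ¬Crosses A C ∧ ¬Crosses B C := by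
        simp only [Set.mem_union, Set.mem_ofPred_eq, not_or, not_and] at h
        exact ⟨h.1 h1, h.2 h1⟩
      rw [cr, cr] at h3; rw [cr] at h2
      simp only [Set.mem_inter_iff, Set.mem_compl_iff] at h2 hx
      grind
  · have : A ∈ {C ∈ smallBonds a b n | Crosses A C} ∪ {C ∈ smallBonds a b n | Crosses B C} :=
      Or.inr ⟨hA, hAB.symm⟩
    rcases h this with h | h
    · obtain ⟨v, hv⟩ := h.2.2.1
      exact hv.2 hv.1.1
    · obtain ⟨v, hv⟩ := h.2.1
      exact hv.1.1 hv.2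
  · rintro C ⟨⟨h1, h2⟩, ⟨-, h3⟩⟩
    have : Crosses A C ∧ Crosses B C := by
      rw [cr] at h2 h3
      rw [cr, cr]
      simp only [Set.mem_inter_iff, Set.mem_compl_iff] at h2 h3
      grind
    exact ⟨⟨h1, this.1⟩, ⟨h1, this.2⟩⟩

/-- Cuts are compared first by size, then by the number of small bonds they cross. -/
noncomputable def cutCost (a b : ε → V) (n : ℕ) (A : Set V) : ℕ ×ₗ ℕ :=
  toLex ((bdry a b A).ncard, crossNumber a b n A)

theorem cutCost_compl (n : ℕ) (A : Set V) : cutCost a b n Aᶜ = cutCost a b n A := by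
  rw [cutCost, bdry_compl, crossNumber_compl, cutCost]

/-- `A` is a cheapest finite cut separating `s` and `t`. -/
structure IsOptimalCut (a b : ε → V) (n : ℕ) (s t : Ultrafilter V) (A : Set V) : Prop where
  finite : (bdry a b A).Finite
  card_le : (bdry a b A).ncard ≤ n
  sep : ¬(A ∈ s ↔ A ∈ t)
  min : ∀ B : Set V, (bdry a b B).Finite → ¬(B ∈ s ↔ B ∈ t) → cutCost a b n A ≤ cutCost a b n B

variable {n : ℕ} {s t : Ultrafilter V}

theorem IsOptimalCut.mem_smallBonds {A : Set V} (hA : IsOptimalCut a b n s t A) :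
    A ∈ smallBonds a b n := by
  refine ⟨hA.finite, hA.card_le, fun B hB => ?_⟩
  simp only [Set.inter_univ] at hB ⊢
  have hsize : ∀ C : Set V, bdry a b C ⊆ bdry a b A → ¬(C ∈ s ↔ C ∈ t) →
      bdry a b C = bdry a b A := by
    intro C hC hCst
    have h := hA.min C (hA.finite.subset hC) hCst
    simp only [cutCost, Prod.Lex.toLex_le_toLex] at h
    exact Set.eq_of_subset_of_ncard_le hC (by omega) hA.finite
  by_cases hBst : B ∈ s ↔ B ∈ t
  · left
    let X : Set V := {v | v ∈ A ↔ v ∈ B}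
    have hX : ∀ u : Ultrafilter V, X ∈ u ↔ (A ∈ u ↔ B ∈ u) := by
      intro u
      have : X = (A ∩ B) ∪ (Aᶜ ∩ Bᶜ) := by
        ext v; simp only [X, Set.mem_ofPred_eq, Set.mem_union, Set.mem_inter_iff,
          Set.mem_compl_iff]; tauto
      rw [this, Ultrafilter.union_mem_iff, ← Ultrafilter.mem_coe, ← Ultrafilter.mem_coe,
        Filter.inter_mem_iff, Filter.inter_mem_iff]
      simp only [Ultrafilter.mem_coe, Ultrafilter.compl_mem_iff_notMem]
      tauto
    have hXe : ∀ e, e ∈ bdry a b X ↔ (e ∈ bdry a b A ∧ e ∉ bdry a b B) := by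
      intro e
      have := @hB e
      simp only [bdry, X, Set.mem_ofPred_eq] at this ⊢; tauto
    have hAst := hA.sep
    have := hsize X (fun e he => ((hXe e).1 he).1) (by rw [hX, hX]; tauto)
    ext e
    simp only [Set.mem_empty_iff_false, iff_false]
    intro he
    exact ((hXe e).1 (this ▸ hB he)).2 he
  · right; exact hsize B hB hBst

theorem IsOptimalCut.compl {A : Set V} (hA : IsOptimalCut a b n s t A) :
    IsOptimalCut a b n s t Aᶜ where
  finite := by rw [bdry_compl]; exact hA.finite
  card_le := by rw [bdry_compl]; exact hA.card_le
  sep := by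
    have := hA.sep
    rw [Ultrafilter.compl_mem_iff_notMem, Ultrafilter.compl_mem_iff_notMem]; tauto
  min B hB hs := by rw [cutCost_compl]; exact hA.min B hB hs

theorem IsOptimalCut.not_crosses (hc : ConnectedBy a b Set.univ) {s' t' : Ultrafilter V}
    {A B : Set V} (hA : IsOptimalCut a b n s t A) (hB : IsOptimalCut a b n s' t' B) :
    ¬Crosses A B := by
  intro hAB
  have fin : ∀ X Y : Set V, (bdry a b X).Finite → (bdry a b Y).Finite →
      (bdry a b (X ∩ Y)).Finite := fun X Y hX hY => (hX.union hY).subset (bdry_inter_subset X Y)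
  have hAc := hA.compl.finite
  have hBc := hB.compl.finite
  have k1 := ncard_bdry_corners hA.finite hB.finite
  have k2 := ncard_bdry_corners hA.finite hBc
  have m1 := crossNumber_corners hc n hA.mem_smallBonds hB.finite hAB
  have m2 := crossNumber_corners hc n hA.mem_smallBonds hBc (crosses_compl_right.2 hAB)
  rw [bdry_compl B, compl_compl] at k2
  rw [crossNumber_compl n B, compl_compl] at m2
  have a1 := hA.min _ (fin A B hA.finite hB.finite)
  have a2 := hA.min _ (fin A Bᶜ hA.finite hBc)
  have a3 := hA.min _ (fin Aᶜ B hAc hB.finite)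
  have a4 := hA.min _ (fin Aᶜ Bᶜ hAc hBc)
  have b1 := hB.min _ (fin A B hA.finite hB.finite)
  have b2 := hB.min _ (fin A Bᶜ hA.finite hBc)
  have b3 := hB.min _ (fin Aᶜ B hAc hB.finite)
  have b4 := hB.min _ (fin Aᶜ Bᶜ hAc hBc)
  have sA := hA.sep
  have sB := hB.sep
  have mi : ∀ (u : Ultrafilter V) (X Y : Set V), X ∩ Y ∈ u ↔ X ∈ u ∧ Y ∈ u := fun u X Y => by
    rw [← Ultrafilter.mem_coe, Filter.inter_mem_iff]; rfl
  simp only [mi, Ultrafilter.compl_mem_iff_notMem, cutCost, Prod.Lex.toLex_le_toLex]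
    at a1 a2 a3 a4 b1 b2 b3 b4
  by_cases p1 : A ∈ s <;> by_cases p2 : A ∈ t <;> by_cases p3 : B ∈ s' <;>
    by_cases p4 : B ∈ t' <;> simp only [p1, p2, p3, p4, not_true, iff_self, iff_true, iff_false,
      not_false_eq_true] at sA sB <;>
    by_cases p5 : B ∈ s <;> by_cases p6 : B ∈ t <;> by_cases p7 : A ∈ s' <;>
    by_cases p8 : A ∈ t' <;>
    simp only [p1, p2, p3, p4, p5, p6, p7, p8, not_true, not_false_eq_true, and_true, and_false,
      iff_true, iff_false, forall_true_left, false_imp_iff]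
      at a1 a2 a3 a4 b1 b2 b3 b4 <;> omega

theorem exists_isOptimalCut {A : Set V} (hA : (bdry a b A).Finite) (hn : (bdry a b A).ncard ≤ n)
    (hst : ¬(A ∈ s ↔ A ∈ t)) : ∃ B, IsOptimalCut a b n s t B := by
  let S : Set (Set V) := {B | (bdry a b B).Finite ∧ ¬(B ∈ s ↔ B ∈ t)}
  obtain ⟨B, hB, hmin⟩ := WellFounded.has_min (InvImage.wf (cutCost a b n)
    (wellFounded_lt (α := ℕ ×ₗ ℕ))) S ⟨A, hA, hst⟩
  have hmin' : ∀ C ∈ S, cutCost a b n B ≤ cutCost a b n C := fun C hC => not_lt.1 (hmin C hC)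
  refine ⟨B, hB.1, ?_, hB.2, fun C h1 h2 => hmin' C ⟨h1, h2⟩⟩
  have := hmin' A ⟨hA, hst⟩
  simp only [cutCost, Prod.Lex.toLex_le_toLex] at this
  omega

section Action

variable {G : Type*} [Group G] [MulAction G V] [MulAction G ε]

theorem bdry_smul (ha : ∀ (g : G) e, a (g • e) = g • a e) (hb : ∀ (g : G) e, b (g • e) = g • b e)
    (g : G) (A : Set V) : bdry a b (g • A) = g • bdry a b A := by
  ext e
  simp only [bdry, Set.mem_ofPred_eq, Set.mem_smul_set_iff_inv_smul_mem, ha, hb]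

theorem crosses_smul (g : G) (A B : Set V) : Crosses (g • A) (g • B) ↔ Crosses A B := by
  simp only [Crosses, ← Set.smul_set_compl, ← Set.smul_set_inter, Set.smul_set_nonempty]

theorem smallBonds_smul (ha : ∀ (g : G) e, a (g • e) = g • a e)
    (hb : ∀ (g : G) e, b (g • e) = g • b e) (g : G) {A : Set V} (hA : A ∈ smallBonds a b n) :
    g • A ∈ smallBonds a b n := by
  obtain ⟨h1, h2, h3⟩ := hA
  refine ⟨?_, ?_, fun B hB => ?_⟩
  · rw [bdry_smul ha hb]; exact h1.smul_set
  · rw [bdry_smul ha hb, Set.ncard_smul_set]; exact h2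
  · have := h3 (g⁻¹ • B)
    simp only [Set.inter_univ, bdry_smul ha hb] at this hB ⊢
    rcases this (by rwa [Set.smul_set_subset_iff_subset_inv_smul_set, inv_inv]) with h | h
    · left; rwa [Set.smul_set_eq_empty] at h
    · right; rw [← h, smul_inv_smul]

theorem crossNumber_smul (ha : ∀ (g : G) e, a (g • e) = g • a e)
    (hb : ∀ (g : G) e, b (g • e) = g • b e) (g : G) (A : Set V) :
    crossNumber a b n (g • A) = crossNumber a b n A := by
  have : {B ∈ smallBonds a b n | Crosses (g • A) B} =
      g • {B ∈ smallBonds a b n | Crosses A B} := by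
    ext B
    rw [Set.mem_smul_set_iff_inv_smul_mem]
    simp only [Set.mem_ofPred_eq]
    have e : g • g⁻¹ • B = B := smul_inv_smul g B
    constructor
    · rintro ⟨h1, h2⟩
      exact ⟨smallBonds_smul ha hb _ h1, by rwa [← crosses_smul g, e]⟩
    · rintro ⟨h1, h2⟩
      have := smallBonds_smul ha hb g h1
      rw [e] at this
      rw [← crosses_smul g, e] at h2
      exact ⟨this, h2⟩
  rw [crossNumber, this, Set.ncard_smul_set, crossNumber]

theorem cutCost_smul (ha : ∀ (g : G) e, a (g • e) = g • a e)
    (hb : ∀ (g : G) e, b (g • e) = g • b e) (g : G) (A : Set V) :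
    cutCost a b n (g • A) = cutCost a b n A := by
  rw [cutCost, bdry_smul ha hb, crossNumber_smul ha hb, Set.ncard_smul_set, cutCost]

theorem IsOptimalCut.smul (ha : ∀ (g : G) e, a (g • e) = g • a e)
    (hb : ∀ (g : G) e, b (g • e) = g • b e) (g : G) {A : Set V}
    (hA : IsOptimalCut a b n s t A) :
    IsOptimalCut a b n (s.map (g • ·)) (t.map (g • ·)) (g • A) := by
  have hm : ∀ (u : Ultrafilter V) (B : Set V), B ∈ u.map (g • ·) ↔ g⁻¹ • B ∈ u := by
    intro u B
    rw [Ultrafilter.mem_map, ← Set.preimage_smul]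
  refine ⟨?_, ?_, ?_, fun B hB hs => ?_⟩
  · rw [bdry_smul ha hb]; exact hA.finite.smul_set
  · rw [bdry_smul ha hb, Set.ncard_smul_set]; exact hA.card_le
  · rw [hm, hm, inv_smul_smul]; exact hA.sep
  · rw [hm, hm] at hs
    have := hA.min (g⁻¹ • B) (by rw [bdry_smul ha hb]; exact hB.smul_set) hs
    rwa [cutCost_smul ha hb, ← cutCost_smul ha hb g A] at this

/-- A connected multigraph with a group action has, for each `n`, an invariant nested family of
finite cuts that separates all pairs of points and ends separated by a cut of size at most `n`. -/
theorem exists_nestedFamily (hc : ConnectedBy a b Set.univ)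
    (ha : ∀ (g : G) e, a (g • e) = g • a e) (hb : ∀ (g : G) e, b (g • e) = g • b e) (n : ℕ) :
    ∃ E : Set (Set V), NestedFamily G E ∧ (∀ A ∈ E, (bdry a b A).Finite) ∧
      (∀ A ∈ E, (bdry a b A).Nonempty) ∧
      ∀ (s t : Ultrafilter V) (A : Set V), (bdry a b A).Finite → (bdry a b A).ncard ≤ n →
        A ∈ s → A ∉ t → ∃ B ∈ E, B ∈ s ∧ B ∉ t := by
  refine ⟨{A | ∃ s t, IsOptimalCut a b n s t A}, ⟨?_, ?_, ?_, ?_⟩, ?_, ?_, ?_⟩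
  · rintro A ⟨s, t, hA⟩
    exact ⟨s, t, hA.compl⟩
  · rintro g A ⟨s, t, hA⟩
    exact ⟨_, _, hA.smul ha hb g⟩
  · rintro A ⟨s, t, hA⟩ B ⟨s', t', hB⟩
    by_contra h
    simp only [not_or, Set.not_subset] at h
    obtain ⟨⟨x, hx⟩, ⟨y, hy⟩, ⟨z, hz⟩, ⟨w, hw⟩⟩ := h
    refine hA.not_crosses hc hB
        ⟨⟨z, hz.1, not_not.1 hz.2⟩, ⟨x, hx⟩, ⟨y, hy.2, hy.1⟩, ⟨w, hw.2, hw.1⟩⟩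
  · intro p q
    refine (finite_separating hc n p q).subset ?_
    rintro A ⟨⟨s, t, hA⟩, h1, h2⟩
    exact ⟨hA.mem_smallBonds, by tauto⟩
  · rintro A ⟨s, t, hA⟩
    exact hA.finite
  · rintro A ⟨s, t, hA⟩
    by_contra h
    rcases hc A (by rw [Set.inter_univ]; exact Set.not_nonempty_iff_eq_empty.1 h) with h | h
    · refine hA.sep ?_
      simp [h, Ultrafilter.empty_notMem]
    · refine hA.sep ?_
      rw [h]; exact iff_of_true Filter.univ_mem Filter.univ_mem
  · intro s t A h1 h2 h3 h4
    obtain ⟨B, hB⟩ := exists_isOptimalCut (s := s) (t := t) h1 h2 (by tauto)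
    by_cases hs : B ∈ s
    · exact ⟨B, ⟨s, t, hB⟩, hs, fun h => hB.sep (by tauto)⟩
    · refine ⟨Bᶜ, ⟨s, t, hB.compl⟩, Ultrafilter.compl_mem_iff_notMem.2 hs, ?_⟩
      have := hB.sep
      rw [Ultrafilter.compl_mem_iff_notMem]; tauto

end Action

end Cuts

/-! ### Members with trivial stabilizer -/

section TrivialStabilizer

variable {G V : Type*} [Group G] [MulAction G V] {E : Set (Set V)}

/-- The orientation of `E` at the terminal vertex of `e`. -/
def orientation (E : Set (Set V)) (e : Set V) : Set (Set V) :=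
  {f ∈ E | e ⊆ f ∨ (eᶜ ⊆ f ∧ f ≠ eᶜ)}

theorem smul_orientation (hE : NestedFamily G E) {e : Set V} {g : G} (hg : g • e = e) :
    g • orientation E e = orientation E e := by
  have key : ∀ k : G, k • e = e → ∀ f ∈ orientation E e, k • f ∈ orientation E e := by
    rintro k hk f ⟨hf, h⟩
    refine ⟨hE.smul _ _ hf, ?_⟩
    have hk' : k • eᶜ = eᶜ := by rw [Set.smul_set_compl, hk]
    rcases h with h | ⟨h, h'⟩
    · left; rw [← hk]; exact Set.smul_set_mono h
    · right; rw [← hk']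
      exact ⟨Set.smul_set_mono h, fun h => h' (smul_left_cancel _ h)⟩
  ext f
  rw [Set.mem_smul_set_iff_inv_smul_mem]
  refine ⟨fun h => ?_, fun h => key _ (by rw [inv_smul_eq_iff, hg]) f h⟩
  have := key g hg _ h
  rwa [smul_inv_smul] at this

theorem orientation_subset (hE : NestedFamily G E) {p : V} {e e' : Set V}
    (hp : p ∉ e) (hlt : e' ⊂ e)
    (hcons : ∀ f ∈ E, e' ⊆ f → f ⊆ e → f = e' ∨ f = e) (he' : e' ∈ E) :
    orientation E e ⊆ orientation E e'ᶜ := by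
  rintro f ⟨hf, h⟩
  refine ⟨hf, ?_⟩
  rw [compl_compl]
  rcases h with h | ⟨h, h'⟩
  · exact Or.inr ⟨hlt.1.trans h, fun h1 => hlt.2 (h1 ▸ h)⟩
  · rcases hE.nested f hf e' he' with k | k | k | k
    · exact absurd (hlt.1 (k (h hp))) hp
    · exact Or.inr ⟨k, fun h1 => hp (hlt.1 (h1 ▸ h hp))⟩
    · left
      have h1 : e' ⊆ fᶜ := Set.subset_compl_comm.1 k
      have h2 : fᶜ ⊆ e := Set.compl_subset_comm.1 h
      rcases hcons _ (hE.compl _ hf) h1 h2 with h3 | h3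
      · rw [← h3, compl_compl]
      · exact absurd (by rw [← h3, compl_compl]) h'
    · exact Or.inl (by rw [Set.compl_subset_comm]; exact Set.compl_subset_comm.1 k)

theorem orientation_eq (hE : NestedFamily G E) {p q : V} {e e' : Set V}
    (hq : q ∈ e') (hp : p ∉ e) (hlt : e' ⊂ e)
    (hcons : ∀ f ∈ E, e' ⊆ f → f ⊆ e → f = e' ∨ f = e) (he : e ∈ E) (he' : e' ∈ E) :
    orientation E e = orientation E e'ᶜ := by
  refine Set.Subset.antisymm (orientation_subset hE hp hlt hcons he') ?_
  have := orientation_subset (E := E) hE (p := q) (e := e'ᶜ) (e' := eᶜ)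
    (fun h => h hq) (compl_lt_compl_iff_lt.2 hlt) (fun f hf h1 h2 => by
      rcases hcons _ (hE.compl _ hf) (Set.subset_compl_comm.1 h2) (Set.compl_subset_comm.1 h1)
        with h | h
      · right; rw [← h, compl_compl]
      · left; rw [← h, compl_compl]) (hE.compl _ he)
  rwa [compl_compl] at this

theorem mem_or_compl_mem_orientation (hE : NestedFamily G E) {e f : Set V} (he : e ∈ E)
    (hf : f ∈ E) : f ∈ orientation E e ∨ fᶜ ∈ orientation E e := by
  have hfc := hE.compl _ hf
  rcases hE.nested f hf e he with k | k | k | k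
  · by_cases h : f = e
    · left; exact ⟨hf, Or.inl h.ge⟩
    · right
      exact ⟨hfc, Or.inr ⟨Set.compl_subset_compl.2 k, fun h' => h (compl_injective h')⟩⟩
  · exact Or.inl ⟨hf, Or.inl k⟩
  · exact Or.inr ⟨hfc, Or.inl (Set.subset_compl_comm.1 k)⟩
  · by_cases h : f = eᶜ
    · right; exact ⟨hfc, Or.inl (by rw [h, compl_compl])⟩
    · exact Or.inl ⟨hf, Or.inr ⟨k, h⟩⟩

theorem finite_orientation_notMem (hE : NestedFamily G E) {p q : V} {e : Set V}
    (hq : q ∈ e) (hp : p ∉ e) (x : V) : {f ∈ orientation E e | x ∉ f}.Finite := by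
  refine ((hE.finite x q).union (hE.finite x p)).subset ?_
  rintro f ⟨⟨hf, h⟩, hx⟩
  rcases h with h | h
  · exact Or.inl ⟨hf, h hq, hx⟩
  · exact Or.inr ⟨hf, h.1 hp, hx⟩

theorem isOfFinOrder_of_pow_smul_mem {A : Set V} (hA : Finite (MulAction.stabilizer G A))
    {T : Set (Set V)} (hT : T.Finite) {w : G} {N : ℕ} (h : ∀ n ≥ N, w ^ n • A ∈ T) :
    IsOfFinOrder w := by
  obtain ⟨m, hm, n, hn, hmn, heq⟩ := Set.Infinite.exists_ne_map_eq_of_mapsTo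
    (Set.Ici_infinite N) (f := fun n => w ^ n • A) (t := T) (fun n hn => h n hn) hT
  wlog hlt : m < n generalizing m n
  · exact this n hn m hm hmn.symm heq.symm (by omega)
  have hst : w ^ (n - m) ∈ MulAction.stabilizer G A := by
    rw [MulAction.mem_stabilizer_iff]
    have h1 : w ^ n = w ^ m * w ^ (n - m) := by rw [← pow_add]; congr 1; omega
    simp only [h1, mul_smul] at heq
    exact (smul_left_cancel _ heq).symm
  have h2 : IsOfFinOrder (⟨_, hst⟩ : MulAction.stabilizer G A) := isOfFinOrder_of_finite _
  have h3 : IsOfFinOrder (w ^ (n - m)) :=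
    (MulAction.stabilizer G A).subtype.isOfFinOrder h2
  rcases isOfFinOrder_pow.1 h3 with h4 | h4
  · exact h4
  · omega

/-- The hypotheses on a group acting on a set with a nested family of cuts that allow to find
cuts with trivial stabilizer. -/
structure SeparatingSystem (G : Type*) {V : Type*} [Group G] [MulAction G V]
    (E : Set (Set V)) : Prop extends NestedFamily G E where
  sep : ∀ p q, p ≠ q → ∃ A ∈ E, q ∈ A ∧ p ∉ A
  stab : ∀ A ∈ E, Finite (MulAction.stabilizer G A)
  fixed : ∀ K : Subgroup G, Finite K → ∀ k ∈ K, k ≠ 1 → ∀ p : V, k • p = p → ∀ k' ∈ K, k' • p = p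
  unique : ∀ z : G, z ≠ 1 → IsOfFinOrder z → ∀ p q : V, z • p = p → z • q = q → p = q
  ends : ∀ K : Subgroup G, Infinite K → ∃ z ∈ K, ¬IsOfFinOrder z ∧
    ((∃ n : ℕ, 0 < n ∧ ∃ p : V, z ^ n • p = p) ∨
      ∃ A ∈ E, ∃ p : V, (∃ N : ℕ, ∀ n ≥ N, z ^ n • p ∈ A) ∧ ∃ N : ℕ, ∀ n ≥ N, z⁻¹ ^ n • p ∉ A)

namespace SeparatingSystem

theorem isOfFinOrder (hE : SeparatingSystem G E) {A : Set V} (hA : A ∈ E) {k : G}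
    (hk : k • A = A) : IsOfFinOrder k := by
  have := hE.stab A hA
  have h2 : IsOfFinOrder (⟨k, hk⟩ : MulAction.stabilizer G A) := isOfFinOrder_of_finite _
  exact (MulAction.stabilizer G A).subtype.isOfFinOrder h2

theorem finite_stabilizer_orientation (hE : SeparatingSystem G E) {p q : V} {e : Set V}
    (he : e ∈ E) (hq : q ∈ e) (hp : p ∉ e) (hfix : ∀ g : G, g • e = e → g • p = p) {k : G}
    (hk1 : k ≠ 1) (hk : k • e = e) : Finite (MulAction.stabilizer G (orientation E e)) := by
  by_contra hinf
  rw [not_finite_iff_infinite] at hinf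
  obtain ⟨z, hz, hzord, h⟩ := hE.ends _ hinf
  have hsm : ∀ w ∈ MulAction.stabilizer G (orientation E e), ∀ f ∈ orientation E e,
      w • f ∈ orientation E e := by
    intro w hw f hf
    rw [← MulAction.mem_stabilizer_iff.1 hw]
    exact Set.smul_mem_smul_set hf
  rcases h with ⟨n, hn, y, hy⟩ | ⟨A, hA, x, ⟨N₁, h₁⟩, ⟨N₂, h₂⟩⟩
  · by_cases hT : ∀ f ∈ orientation E e, y ∈ f
    · have hky : k • y = y := by
        by_contra hne
        obtain ⟨f, hf, hf1, hf2⟩ := hE.sep y (k • y) (Ne.symm hne)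
        have h1 : fᶜ ∈ orientation E e := by
          rcases mem_or_compl_mem_orientation hE.toNestedFamily he hf with h | h
          · exact absurd (hT f h) hf2
          · exact h
        have h2 : k⁻¹ • fᶜ ∈ orientation E e := by
          refine hsm _ (inv_mem ?_) _ h1
          exact smul_orientation hE.toNestedFamily hk
        have h3 := hT _ h2
        rw [Set.mem_smul_set_iff_inv_smul_mem, inv_inv] at h3
        exact h3 hf1
      have : y = p := hE.unique k hk1 (hE.isOfFinOrder he hk) y p hky (hfix k hk)
      exact hp (this ▸ hT e ⟨he, Or.inl subset_rfl⟩)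
    · simp only [not_forall] at hT
      obtain ⟨f, hf, hyf⟩ := hT
      refine hzord ((isOfFinOrder_pow (n := n)).1 ?_ |>.resolve_right hn.ne')
      refine isOfFinOrder_of_pow_smul_mem (hE.stab f hf.1)
        (finite_orientation_notMem hE.toNestedFamily hq hp y) (N := 0) fun m _ => ⟨?_, ?_⟩
      · exact hsm _ (pow_mem (pow_mem hz n) m) _ hf
      · have hfix : (z ^ n) ^ m ∈ MulAction.stabilizer G y := pow_mem hy m
        rw [Set.mem_smul_set_iff_inv_smul_mem]
        have : ((z ^ n) ^ m)⁻¹ • y = y := inv_mem hfix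
        rwa [this]
  · have key : ∀ w ∈ MulAction.stabilizer G (orientation E e), ∀ B ∈ orientation E e, ∀ N : ℕ,
        (∀ n ≥ N, w⁻¹ ^ n • x ∉ B) → IsOfFinOrder w := by
      intro w hw B hB N h
      refine isOfFinOrder_of_pow_smul_mem (hE.stab B hB.1)
        (finite_orientation_notMem hE.toNestedFamily hq hp x) (N := N) fun m hm => ⟨?_, ?_⟩
      · exact hsm _ (pow_mem hw m) _ hB
      · rw [Set.mem_smul_set_iff_inv_smul_mem, ← inv_pow]
        exact h m hm
    rcases mem_or_compl_mem_orientation hE.toNestedFamily he hA with h | h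
    · exact hzord (key z hz A h N₂ h₂)
    · refine hzord (isOfFinOrder_inv_iff.1 (key z⁻¹ (inv_mem hz) _ h N₁ fun n hn hx => hx ?_))
      rw [inv_inv]; exact h₁ n hn

theorem stabilizer_fixes (hE : SeparatingSystem G E) {p q : V}
    (hnt : ∀ e ∈ E, q ∈ e → p ∉ e → ∃ k : G, k ≠ 1 ∧ k • e = e) :
    ∀ e ∈ E, q ∈ e → p ∉ e → ∀ g : G, g • e = e → g • p = p := by
  by_contra hcon
  let bad : Set (Set V) :=
    {e ∈ {A ∈ E | q ∈ A ∧ p ∉ A} | ¬∀ g : G, g • e = e → g • p = p}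
  have hbne : bad.Nonempty := by
    simp only [not_forall] at hcon
    obtain ⟨e, h1, h2, h3, g, h4, h5⟩ := hcon
    exact ⟨e, ⟨h1, h2, h3⟩, fun h => h5 (h g h4)⟩
  have hfin := hE.finite p q
  obtain ⟨e', he'⟩ := (hfin.subset (Set.sep_subset _ _)).exists_maximal hbne
  obtain ⟨⟨⟨he'E, hqe', hpe'⟩, hbad⟩, hmax⟩ := he'
  let ab : Set (Set V) := {f ∈ {A ∈ E | q ∈ A ∧ p ∉ A} | e' ⊂ f}
  by_cases habne : ab.Nonempty
  · obtain ⟨e, he⟩ := (hfin.subset (Set.sep_subset _ _)).exists_minimal habne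
    obtain ⟨⟨⟨heE, hqe, hpe⟩, hlt⟩, hmin⟩ := he
    have hgood : ∀ g : G, g • e = e → g • p = p := by
      by_contra hb
      exact hlt.2 (hmax ⟨⟨heE, hqe, hpe⟩, hb⟩ hlt.1)
    obtain ⟨k, hk1, hk⟩ := hnt e heE hqe hpe
    have hfinK := hE.finite_stabilizer_orientation heE hqe hpe hgood hk1 hk
    have heq := orientation_eq hE.toNestedFamily hqe' hpe hlt (fun f hf h1 h2 => by
      by_cases hf' : f = e'
      · exact Or.inl hf'
      · right
        refine Set.Subset.antisymm h2 (hmin ⟨⟨hf, h1 hqe', fun h => hpe (h2 h)⟩, ?_⟩ h2)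
        exact lt_of_le_of_ne h1 (Ne.symm hf')) heE he'E
    refine hbad fun g hg => ?_
    refine hE.fixed _ hfinK k (smul_orientation hE.toNestedFamily hk) hk1 p (hgood k hk) g ?_
    rw [MulAction.mem_stabilizer_iff, heq]
    exact smul_orientation hE.toNestedFamily (by rw [Set.smul_set_compl, hg])
  · have htop : ∀ f ∈ E, q ∈ f → p ∉ f → f ⊆ e' := by
      intro f hf hqf hpf
      rcases hE.total hf he'E hqf hpf hqe' hpe' with h | h
      · exact h
      · by_contra hne
        exact habne ⟨f, ⟨hf, hqf, hpf⟩, h, hne⟩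
    refine hbad fun g hg => ?_
    by_contra hgp
    have hg' : g⁻¹ • e' = e' := by rw [inv_smul_eq_iff, hg]
    have hgpe : g • p ∉ e' := by
      rw [← hg]; rwa [Set.smul_mem_smul_set_iff]
    obtain ⟨f, hf, h1, h2⟩ := hE.sep p (g • p) (Ne.symm hgp)
    rcases hE.nested f hf e' he'E with k | k | k | k
    · exact hgpe (k h1)
    · exact hgpe (htop f hf (k hqe') h2 h1)
    · have k' : e' ⊆ fᶜ := Set.subset_compl_comm.1 k
      have h3 : g⁻¹ • fᶜ ⊆ e' := by
        refine htop _ (hE.smul _ _ (hE.compl _ hf)) ?_ ?_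
        · have : g⁻¹ • e' ⊆ g⁻¹ • fᶜ := Set.smul_set_mono k'
          rw [hg'] at this
          exact this hqe'
        · rw [Set.mem_smul_set_iff_inv_smul_mem, inv_inv]
          exact fun h => h h1
      have h4 : g⁻¹ • p ∈ g⁻¹ • fᶜ := Set.smul_mem_smul_set h2
      have h5 : g⁻¹ • p ∈ g⁻¹ • e' := by rw [hg']; exact h3 h4
      rw [Set.smul_mem_smul_set_iff] at h5
      exact hpe' h5
    · exact h2 (k hpe')

theorem exists_trivial_stabilizer (hE : SeparatingSystem G E) {p q : V} (hpq : p ≠ q) :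
    ∃ A ∈ E, (q ∈ A ∧ p ∉ A) ∧ ∀ g : G, g • A = A → g = 1 := by
  by_contra hcon
  have hnt : ∀ e ∈ E, q ∈ e → p ∉ e → ∃ k : G, k ≠ 1 ∧ k • e = e := by
    intro e he h1 h2
    by_contra h
    refine hcon ⟨e, he, ⟨h1, h2⟩, fun g hg => ?_⟩
    by_contra hg1
    exact h ⟨g, hg1, hg⟩
  obtain ⟨e, he, hq, hp⟩ := hE.sep p q hpq
  obtain ⟨k, hk1, hk⟩ := hnt e he hq hp
  have h1 := hE.stabilizer_fixes hnt e he hq hp k hk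
  have h2 := hE.stabilizer_fixes (fun f hf hpf hqf => by
    obtain ⟨k, hk1, hk⟩ := hnt fᶜ (hE.compl _ hf) hqf (fun h => h hpf)
    refine ⟨k, hk1, ?_⟩
    rw [Set.smul_set_compl] at hk
    exact compl_injective hk) eᶜ (hE.compl _ he) hp (fun h => h hq) k
      (by rw [Set.smul_set_compl, hk])
  exact hpq (hE.unique k hk1 (hE.isOfFinOrder he hk) p q h1 h2)

end SeparatingSystem

theorem SeparatingSystem.isFreeFactor {G : Type*} [Group G] {H : Subgroup G}
    {E : Set (Set (G ⧸ H))} (hE : SeparatingSystem G E) : H.IsFreeFactor := by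
  refine NestedFamily.isFreeFactor (E := {A ∈ E | ∀ g : G, g • A = A → g = 1})
    ⟨?_, ?_, ?_, ?_⟩ ?_ ?_
  · rintro A ⟨h1, h2⟩
    refine ⟨hE.compl _ h1, fun g hg => h2 g ?_⟩
    rw [Set.smul_set_compl] at hg
    exact compl_injective hg
  · rintro g A ⟨h1, h2⟩
    refine ⟨hE.smul _ _ h1, fun k hk => ?_⟩
    have := h2 (g⁻¹ * k * g) (by rw [mul_smul, mul_smul, hk, inv_smul_smul])
    rwa [mul_assoc, inv_mul_eq_one, eq_comm, mul_eq_right] at this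
  · rintro A ⟨h1, -⟩ B ⟨h2, -⟩
    exact hE.nested A h1 B h2
  · intro p q
    exact (hE.finite p q).subset fun A hA => ⟨hA.1.1, hA.2⟩
  · intro p q hpq
    obtain ⟨A, h1, h2, h3⟩ := hE.exists_trivial_stabilizer hpq
    exact ⟨A, ⟨h1, h3⟩, h2⟩
  · exact fun A hA => hA.2

end TrivialStabilizer

/-! ### The splitting operator -/

section Splitting

/-- The number of extensions to `G` of a homomorphism from `H` to a finite group does not depend
on the homomorphism. -/
def ExtensionCountsAgree {G : Type*} [Group G] (H : Subgroup G) : Prop :=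
  ∀ (P : Type) [Group P] [Finite P] (γ₁ γ₂ : H →* P),
    Nat.card {f : G →* P // f.comp H.subtype = γ₁} =
      Nat.card {f : G →* P // f.comp H.subtype = γ₂}

theorem finite_monoidHom {G P : Type*} [Group G] [Group P] [Finite P] (hG : Group.FG G) :
    Finite (G →* P) := by
  obtain ⟨S, hS⟩ := Group.fg_def.1 hG
  refine Finite.of_injective (fun (f : G →* P) (s : S) => f s) fun f g h => ?_
  exact MonoidHom.eq_of_eqOn_dense hS fun s hs => congrFun h ⟨s, hs⟩

theorem card_le_eq_card_fiber_add_sum {γ L : Type*} [Finite γ] [PartialOrder L] [Fintype L]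
    [DecidableLT L] (r : γ → L) (S : L) : Nat.card {x // r x ≤ S} =
      Nat.card {x // r x = S} + ∑ T ∈ Finset.univ.filter (· < S), Nat.card {x // r x = T} := by
  classical
  have := Fintype.ofFinite γ
  simp only [Nat.card_eq_fintype_card, Fintype.card_subtype]
  have e : (Finset.univ.filter fun x => r x ≤ S) =
      (Finset.univ.filter fun x => r x = S) ∪ (Finset.univ.filter fun x => r x < S) := by
    ext x; simp [le_iff_eq_or_lt]
  rw [e, Finset.card_union_of_disjoint]
  · congr 1
    rw [Finset.card_eq_sum_card_fiberwise (f := r) (t := Finset.univ.filter (· < S))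
      (fun x hx => by simpa using hx)]
    refine Finset.sum_congr rfl fun T hT => ?_
    congr 1
    ext x
    simp only [Finset.mem_filter, Finset.mem_univ, true_and] at hT ⊢
    exact ⟨fun h => h.2, fun h => ⟨h ▸ hT, h⟩⟩
  · rw [Finset.disjoint_filter]
    intro x _ h1 h2
    exact h2.ne h1

/-- Functions into a finite poset with equally many points below each element have fibres of equal
size. -/
theorem card_fiber_eq_of_card_le_eq {α β L : Type*} [Finite α] [Finite β] [PartialOrder L]
    [Finite L] (r₁ : α → L) (r₂ : β → L)
    (h : ∀ S, Nat.card {x // r₁ x ≤ S} = Nat.card {y // r₂ y ≤ S}) (S : L) :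
    Nat.card {x // r₁ x = S} = Nat.card {y // r₂ y = S} := by
  classical
  have := Fintype.ofFinite L
  induction S using WellFoundedLT.induction with
  | ind S ih =>
    have h1 := h S
    rw [card_le_eq_card_fiber_add_sum r₁, card_le_eq_card_fiber_add_sum r₂,
      Finset.sum_congr rfl fun T hT => ih T (by simpa using hT)] at h1
    exact Nat.add_right_cancel h1

variable {G : Type} [Group G] {H : Subgroup G}

theorem ExtensionCountsAgree.exists_complement (hH : ExtensionCountsAgree H) (hG : Group.FG G)
    {Q : Type} [Group Q] [Finite Q] (π : G →* Q) :
    ∃ β : G →* Q, (∀ h ∈ H, β h = 1) ∧ H.map π ⊔ β.range = π.range := by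
  have := finite_monoidHom (P := Q) hG
  let A₁ := {f : G →* Q // f.comp H.subtype = π.comp H.subtype}
  let A₂ := {f : G →* Q // f.comp H.subtype = 1}
  let r₁ : A₁ → Subgroup Q := fun f => f.1.range
  let r₂ : A₂ → Subgroup Q := fun f => H.map π ⊔ f.1.range
  have hr₁ : ∀ f : A₁, H.map π ≤ r₁ f := by
    rintro f _ ⟨h, hh, rfl⟩
    exact ⟨h, DFunLike.congr_fun f.2 ⟨h, hh⟩⟩
  have h : ∀ S, Nat.card {x // r₁ x ≤ S} = Nat.card {y // r₂ y ≤ S} := by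
    intro S
    by_cases hS : H.map π ≤ S
    · have hm : ∀ h : H, π.comp H.subtype h ∈ S := fun h => hS ⟨h, h.2, rfl⟩
      let γ : H →* S := (π.comp H.subtype).codRestrict S hm
      have c := hH S γ 1
      have e₁ : {f : G →* S // f.comp H.subtype = γ} ≃ {x // r₁ x ≤ S} :=
        { toFun := fun f => ⟨⟨S.subtype.comp f.1, by
            rw [MonoidHom.comp_assoc, f.2]; rfl⟩, by
            rintro _ ⟨g, rfl⟩; exact (f.1 g).2⟩
          invFun := fun f => ⟨f.1.1.codRestrict S fun g => f.2 ⟨g, rfl⟩, by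
            ext h; exact DFunLike.congr_fun f.1.2 h⟩
          left_inv := fun f => by ext; rfl
          right_inv := fun f => by ext; rfl }
      have e₂ : {f : G →* S // f.comp H.subtype = 1} ≃ {x // r₂ x ≤ S} :=
        { toFun := fun f => ⟨⟨S.subtype.comp f.1, by
            rw [MonoidHom.comp_assoc, f.2]; ext; rfl⟩, sup_le hS (by
            rintro _ ⟨g, rfl⟩; exact (f.1 g).2)⟩
          invFun := fun f => ⟨f.1.1.codRestrict S fun g =>
            (le_sup_right.trans f.2 : f.1.1.range ≤ S) ⟨g, rfl⟩, by
            ext h; exact DFunLike.congr_fun f.1.2 h⟩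
          left_inv := fun f => by ext; rfl
          right_inv := fun f => by ext; rfl }
      rw [← Nat.card_congr e₁, ← Nat.card_congr e₂, c]
    · have i₁ : IsEmpty {x // r₁ x ≤ S} := ⟨fun x => hS ((hr₁ x.1).trans x.2)⟩
      have i₂ : IsEmpty {x // r₂ x ≤ S} := ⟨fun x => hS (le_sup_left.trans x.2)⟩
      rw [Nat.card_of_isEmpty, Nat.card_of_isEmpty]
  have hfib := card_fiber_eq_of_card_le_eq r₁ r₂ h π.range
  have : Nonempty {x // r₁ x = π.range} := ⟨⟨⟨π, rfl⟩, rfl⟩⟩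
  have hpos : 0 < Nat.card {y // r₂ y = π.range} := hfib ▸ Nat.card_pos
  obtain ⟨⟨⟨β, hβ⟩, hcomp⟩⟩ := (Nat.card_pos_iff.1 hpos).1
  exact ⟨β, fun h hh => DFunLike.congr_fun hβ ⟨h, hh⟩, hcomp⟩

/-- A natural operator on homomorphisms to finite groups that behaves like the composition with
the projection of a free product `H ∗ L` onto `L`. -/
structure SplittingOperator (H : Subgroup G) where
  ρ : ∀ {P : Type} [Group P] [Finite P], (G →* P) → (G →* P)
  comp : ∀ {P Q : Type} [Group P] [Finite P] [Group Q] [Finite Q] (q : P →* Q) (f : G →* P),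
    ρ (q.comp f) = q.comp (ρ f)
  kills : ∀ {P : Type} [Group P] [Finite P] (f : G →* P), ∀ h ∈ H, ρ f h = 1
  sup : ∀ {P : Type} [Group P] [Finite P] (f : G →* P), H.map f ⊔ (ρ f).range = f.range

theorem ExtensionCountsAgree.exists_splittingOperator (hH : ExtensionCountsAgree H)
    (hG : Group.FG G) : Nonempty (SplittingOperator H) := by
  classical
  choose β hβ₁ hβ₂ using fun U : FiniteIndexNormalSubgroup G =>
    hH.exists_complement hG (QuotientGroup.mk' U.toSubgroup)
  have : Nonempty (FiniteIndexNormalSubgroup G) := ⟨{ toSubgroup := ⊤ }⟩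
  let u : Ultrafilter (FiniteIndexNormalSubgroup G) := Ultrafilter.of Filter.atBot
  have hu : ∀ U : FiniteIndexNormalSubgroup G, ∀ᶠ U' in u, U' ≤ U := fun U =>
    Ultrafilter.of_le _ (Filter.Iic_mem_atBot U)
  let app : ∀ {P : Type} [Group P] [Finite P], (G →* P) → (G →* P) →
      FiniteIndexNormalSubgroup G → Prop := fun f φ U =>
    ∃ h : U.toSubgroup ≤ f.ker, (QuotientGroup.lift U.toSubgroup f h).comp (β U) = φ
  have ex : ∀ {P : Type} [Group P] [Finite P] (f : G →* P), ∃ φ, ∀ᶠ U in u, app f φ U := by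
    intro P _ _ f
    have := finite_monoidHom (P := P) hG
    rw [← Ultrafilter.eventually_exists_iff]
    let K : FiniteIndexNormalSubgroup G := { toSubgroup := f.ker }
    filter_upwards [hu K] with U hU
    exact ⟨_, hU, rfl⟩
  choose ρ hρ using @ex
  refine ⟨⟨fun f => ρ f, ?_, ?_, ?_⟩⟩
  · intro P Q _ _ _ _ q f
    obtain ⟨U, ⟨h1, h2⟩, h3, h4⟩ := ((hρ f).and (hρ (q.comp f))).exists
    rw [← h2, ← h4, ← MonoidHom.comp_assoc]
    congr 1
    ext g
    rfl
  · intro P _ _ f h hh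
    obtain ⟨U, h1, h2⟩ := (hρ f).exists
    rw [← h2, MonoidHom.comp_apply, hβ₁ U h hh, map_one]
  · intro P _ _ f
    obtain ⟨U, h1, h2⟩ := (hρ f).exists
    have h3 := congrArg (Subgroup.map (QuotientGroup.lift U.toSubgroup f h1)) (hβ₂ U)
    have h4 : (QuotientGroup.lift U.toSubgroup f h1).comp (QuotientGroup.mk' U.toSubgroup) = f := by
      ext g; rfl
    rw [Subgroup.map_sup, Subgroup.map_map, h4, MonoidHom.map_range, h2, MonoidHom.map_range,
      h4] at h3
    exact h3

namespace SplittingOperator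

variable (R : SplittingOperator H) {P Q : Type} [Group P] [Finite P] [Group Q] [Finite Q]

theorem hom_ext {f₁ f₂ : G →* P} (h : ∀ h ∈ H, f₁ h = f₂ h) (hρ : R.ρ f₁ = R.ρ f₂) :
    f₁ = f₂ := by
  have h1 := R.sup (f₁.prod f₂)
  have h2 : R.ρ (f₁.prod f₂) = (R.ρ f₁).prod (R.ρ f₂) := by
    ext g
    · exact (DFunLike.congr_fun (R.comp (MonoidHom.fst P P) (f₁.prod f₂)) g).symm
    · exact (DFunLike.congr_fun (R.comp (MonoidHom.snd P P) (f₁.prod f₂)) g).symm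
  have h3 : (f₁.prod f₂).range ≤ ((MonoidHom.fst P P).eqLocus (MonoidHom.snd P P)) := by
    rw [← h1, h2, sup_le_iff]
    refine ⟨?_, ?_⟩
    · rintro _ ⟨g, hg, rfl⟩; exact h g hg
    · rintro _ ⟨g, rfl⟩; exact DFunLike.congr_fun hρ g
  ext g
  exact h3 ⟨g, rfl⟩

theorem exists_hom (hH : ExtensionCountsAgree H) (hG : Group.FG G) (γ : H →* P) (β : G →* P)
    (hβ : ∀ h ∈ H, β h = 1) : ∃ f : G →* P, f.comp H.subtype = γ ∧ R.ρ f = β := by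
  have := finite_monoidHom (P := P) hG
  let Ψ : {f : G →* P // f.comp H.subtype = γ} → {f : G →* P // f.comp H.subtype = 1} :=
    fun f => ⟨R.ρ f.1, by ext h; exact R.kills f.1 h h.2⟩
  have inj : Function.Injective Ψ := fun f₁ f₂ h => by
    refine Subtype.ext (R.hom_ext (fun h hh => ?_) (congrArg Subtype.val h))
    exact (DFunLike.congr_fun f₁.2 ⟨h, hh⟩).trans (DFunLike.congr_fun f₂.2 ⟨h, hh⟩).symm
  have bij := (Nat.bijective_iff_injective_and_card Ψ).2 ⟨inj, hH P γ 1⟩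
  obtain ⟨f, hf⟩ := bij.2 ⟨β, by ext h; exact hβ h h.2⟩
  exact ⟨f.1, f.2, congrArg Subtype.val hf⟩

theorem exists_lift (hH : ExtensionCountsAgree H) (hG : Group.FG G) (q : P →* Q) (π : G →* Q)
    (γ : H →* P) (β : G →* P) (hγ : q.comp γ = π.comp H.subtype) (hβ : ∀ h ∈ H, β h = 1)
    (hβ' : q.comp β = R.ρ π) :
    ∃ f : G →* P, q.comp f = π ∧ f.comp H.subtype = γ ∧ R.ρ f = β := by
  obtain ⟨f, h1, h2⟩ := R.exists_hom hH hG γ β hβ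
  refine ⟨f, R.hom_ext (fun h hh => ?_) (by rw [R.comp, h2, hβ']), h1, h2⟩
  have e1 := DFunLike.congr_fun h1 ⟨h, hh⟩
  have e2 := DFunLike.congr_fun hγ ⟨h, hh⟩
  simp only [MonoidHom.comp_apply, Subgroup.coe_subtype] at e1 e2 ⊢
  rw [e1, e2]

/-- The two parts of the image of a homomorphism: the image of `H` and the range of the operator. -/
def part (b : Bool) (f : G →* P) : Subgroup P := if b then (R.ρ f).range else H.map f

theorem part_comp (b : Bool) (q : P →* Q) (f : G →* P) :
    R.part b (q.comp f) = (R.part b f).map q := by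
  cases b
  · simp [part, Subgroup.map_map]
  · simp [part, R.comp, MonoidHom.map_range]

theorem exists_lift_part (hH : ExtensionCountsAgree H) (hG : Group.FG G) (q : P →* Q)
    (π : G →* Q) (s : ∀ b, R.part b π →* P) (hs : ∀ b x, q (s b x) = x) :
    ∃ f : G →* P, q.comp f = π ∧ ∀ b, R.part b f = (s b).range := by
  have m₀ : ∀ h : H, π h ∈ R.part false π := fun h => ⟨h, h.2, rfl⟩
  have m₁ : ∀ g : G, R.ρ π g ∈ R.part true π := fun g => ⟨g, rfl⟩
  obtain ⟨f, h1, h2, h3⟩ := R.exists_lift hH hG q π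
    ((s false).comp ((π.comp H.subtype).codRestrict _ m₀))
    ((s true).comp ((R.ρ π).codRestrict _ m₁)) (by ext h; exact hs _ _)
    (fun h hh => by
      rw [MonoidHom.comp_apply]
      convert map_one (s true)
      exact Subtype.ext (R.kills π h hh)) (by ext h; exact hs _ _)
  refine ⟨f, h1, fun b => ?_⟩
  cases b
  · ext x
    constructor
    · rintro ⟨h, hh, rfl⟩
      exact ⟨⟨π h, m₀ ⟨h, hh⟩⟩, (DFunLike.congr_fun h2 ⟨h, hh⟩).symm⟩
    · rintro ⟨⟨_, h, hh, rfl⟩, rfl⟩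
      exact ⟨h, hh, DFunLike.congr_fun h2 ⟨h, hh⟩⟩
  · ext x
    change x ∈ (R.ρ f).range ↔ _
    rw [h3]
    constructor
    · rintro ⟨g, rfl⟩
      exact ⟨⟨R.ρ π g, m₁ g⟩, rfl⟩
    · rintro ⟨⟨_, g, rfl⟩, rfl⟩
      exact ⟨g, rfl⟩

end SplittingOperator

end Splitting

/-- The number of extensions of a homomorphism from a free factor is the number of homomorphisms
from a complement. -/
theorem Subgroup.IsFreeFactor.extensionCountsAgree {G : Type*} [Group G] {H : Subgroup G}
    (hH : H.IsFreeFactor) : ExtensionCountsAgree H := by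
  obtain ⟨L, hL⟩ := hH
  let e : Monoid.Coprod H L ≃* G := MulEquiv.ofBijective _ hL
  have he : ∀ w, e w = Monoid.Coprod.lift H.subtype L.subtype w := fun w => rfl
  intro P _ _ γ₁ γ₂
  have key : ∀ γ : H →* P, Nat.card {f : G →* P // f.comp H.subtype = γ} = Nat.card (L →* P) := by
    intro γ
    have hs : ∀ h : H, e.symm h = Monoid.Coprod.inl h := fun h => by
      rw [MulEquiv.symm_apply_eq, he]; simp
    have hs' : ∀ l : L, e.symm l = Monoid.Coprod.inr l := fun h => by
      rw [MulEquiv.symm_apply_eq, he]; simp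
    refine Nat.card_congr
      { toFun := fun f => f.1.comp L.subtype
        invFun := fun φ => ⟨(Monoid.Coprod.lift γ φ).comp e.symm.toMonoidHom, by
          ext h; simp [hs]⟩
        left_inv := fun f => ?_
        right_inv := fun φ => by ext l; simp [hs'] }
    refine Subtype.ext ?_
    ext g
    obtain ⟨w, rfl⟩ := e.surjective g
    have : Monoid.Coprod.lift γ (f.1.comp L.subtype) = f.1.comp e.toMonoidHom := by
      refine Monoid.Coprod.hom_ext ?_ ?_
      · ext h; simp [he, ← f.2]
      · ext l; simp [he]
    simp [this]
  rw [key, key]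

/-! ### Derivations -/

section Derivations

universe u

/-- The split extension of a group `Q` by a `Q`-module `M`. -/
@[ext]
structure SplitExtension {Q M : Type*} [Group Q] [AddCommGroup M]
    (act : Q →* AddMonoid.End M) where
  vec : M
  elt : Q

namespace SplitExtension

variable {Q M : Type*} [Group Q] [AddCommGroup M] {act : Q →* AddMonoid.End M}

instance : Mul (SplitExtension act) := ⟨fun x y => ⟨x.vec + act x.elt y.vec, x.elt * y.elt⟩⟩
instance : One (SplitExtension act) := ⟨⟨0, 1⟩⟩
instance : Inv (SplitExtension act) := ⟨fun x => ⟨-act x.elt⁻¹ x.vec, x.elt⁻¹⟩⟩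

@[simp] theorem vec_mul (x y : SplitExtension act) : (x * y).vec = x.vec + act x.elt y.vec := rfl
@[simp] theorem elt_mul (x y : SplitExtension act) : (x * y).elt = x.elt * y.elt := rfl
@[simp] theorem vec_one : (1 : SplitExtension act).vec = 0 := rfl
@[simp] theorem elt_one : (1 : SplitExtension act).elt = 1 := rfl
@[simp] theorem vec_inv (x : SplitExtension act) : x⁻¹.vec = -act x.elt⁻¹ x.vec := rfl
@[simp] theorem elt_inv (x : SplitExtension act) : x⁻¹.elt = x.elt⁻¹ := rfl

instance : Group (SplitExtension act) :=
  Group.ofLeftAxioms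
    (fun x y z => by
      ext
      · simp [add_assoc]
      · simp [mul_assoc])
    (fun x => by ext <;> simp)
    (fun x => by ext <;> simp)

instance [Finite Q] [Finite M] : Finite (SplitExtension act) :=
  Finite.of_injective (fun x => (x.vec, x.elt)) fun x y h => by
    ext
    · exact congrArg Prod.fst h
    · exact congrArg Prod.snd h

/-- The projection of a split extension to the group. -/
def proj (act : Q →* AddMonoid.End M) : SplitExtension act →* Q where
  toFun := elt
  map_one' := rfl
  map_mul' _ _ := rfl

@[simp] theorem proj_apply (x : SplitExtension act) : proj act x = x.elt := rfl

/-- The homomorphism to a split extension given by a derivation. -/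
def ofDerivation {G : Type*} [Group G] (π : G →* Q) (D : G → M)
    (hD : ∀ x y, D (x * y) = D x + act (π x) (D y)) : G →* SplitExtension act where
  toFun x := ⟨D x, π x⟩
  map_one' := by
    have := hD 1 1
    simp only [mul_one, map_one, AddMonoid.End.coe_one, id_eq, left_eq_add] at this
    ext <;> simp [this]
  map_mul' x y := by ext <;> simp [hD]

end SplitExtension

/-- The module of functions on a set with an action. -/
def functionAction (Q Y A : Type*) [Group Q] [MulAction Q Y] [AddCommGroup A] :
    Q →* AddMonoid.End (Y → A) where
  toFun q := { toFun := fun m y => m (q⁻¹ • y), map_zero' := rfl, map_add' := fun _ _ => rfl }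
  map_one' := by
    ext m y
    change m ((1 : Q)⁻¹ • y) = m y
    simp
  map_mul' q q' := by
    ext m y
    change m ((q * q')⁻¹ • y) = m (q'⁻¹ • q⁻¹ • y)
    simp [mul_smul]

@[simp] theorem functionAction_apply {Q Y A : Type*} [Group Q] [MulAction Q Y] [AddCommGroup A]
    (q : Q) (m : Y → A) (y : Y) : functionAction Q Y A q m y = m (q⁻¹ • y) := rfl

/-- A derivation of `Q` with values in functions on a transitive `Q`-set that counts the powers of
`z` on the point stabilizer `⟨z⟩`. -/
theorem exists_windingDerivation {Q : Type u} [Group Q] [Finite Q] {z : Q} {n : ℕ}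
    (hn : orderOf z = n) :
    ∃ (Y : Type u) (_ : MulAction Q Y) (_ : Finite Y) (y₀ : Y) (D : Q → Y → ZMod n),
      (∀ q q' y, D (q * q') y = D q y + D q' (q⁻¹ • y)) ∧
      (∀ g : Q, D (g⁻¹ * z * g) (g⁻¹ • y₀) = 1) ∧ (∀ y, ∃ q : Q, y = q • y₀) ∧ z • y₀ = y₀ ∧
      ∀ q q' : Q, q • y₀ = q' • y₀ → ∃ i : ℤ, q⁻¹ * q' = z ^ i := by
  subst hn
  have hex : ∀ q : Q, ∃ i : ℤ, (q : Q ⧸ Subgroup.zpowers z).out * z ^ i = q := by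
    intro q
    obtain ⟨i, hi⟩ := QuotientGroup.eq.1 (QuotientGroup.out_eq' (q : Q ⧸ Subgroup.zpowers z))
    exact ⟨i, eq_inv_mul_iff_mul_eq.1 hi⟩
  choose i hi using hex
  let τ : Q → ZMod (orderOf z) := fun q => (i q : ZMod (orderOf z))
  have hτ : ∀ q, ∀ n : ℤ, τ (q * z ^ n) = τ q + n := by
    intro q n
    have e : ((q * z ^ n : Q) : Q ⧸ Subgroup.zpowers z) = q :=
      QuotientGroup.eq.2 ⟨-n, by simp⟩
    have h1 : (q : Q ⧸ Subgroup.zpowers z).out * z ^ i (q * z ^ n) =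
        (q : Q ⧸ Subgroup.zpowers z).out * z ^ i q * z ^ n := by
      have h := hi (q * z ^ n)
      rw [e] at h
      rw [h, hi q]
    rw [mul_assoc, mul_right_inj, ← zpow_add] at h1
    have h2 : z ^ ((i q + n) - i (q * z ^ n)) = 1 := by rw [zpow_sub, h1, mul_inv_cancel]
    have h3 := (ZMod.intCast_eq_intCast_iff_dvd_sub _ _ _).2 (orderOf_dvd_iff_zpow_eq_one.2 h2)
    simp only [τ, h3]
    push_cast
    rfl
  let D : Q → (Q ⧸ Subgroup.zpowers z) → ZMod (orderOf z) := fun q y =>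
    τ y.out - τ (q⁻¹ * y.out)
  have hD : ∀ q x : Q, D q (x : Q ⧸ Subgroup.zpowers z) = τ x - τ (q⁻¹ * x) := by
    intro q x
    have h1 := hi x
    simp only [D]
    rw [← h1, ← mul_assoc, hτ, hτ, h1]
    ring
  refine ⟨Q ⧸ Subgroup.zpowers z, inferInstance, inferInstance, ((1 : Q) : _), D,
    fun q q' y => ?_, fun g => ?_, fun y => ?_, QuotientGroup.eq.2 ⟨-1, by simp⟩,
    fun q q' h => ?_⟩
  · induction y using QuotientGroup.induction_on with
    | H x =>
      rw [MulAction.Quotient.smul_coe, hD, hD, hD, smul_eq_mul, mul_inv_rev, mul_assoc]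
      ring
  · rw [MulAction.Quotient.smul_coe, hD]
    have : (g⁻¹ * z * g)⁻¹ * (g⁻¹ • 1) = (g⁻¹ • 1) * z ^ (-1 : ℤ) := by
      rw [smul_eq_mul]; group
    rw [this, hτ]
    push_cast
    ring
  · obtain ⟨q, rfl⟩ := QuotientGroup.mk_surjective y
    exact ⟨q, by rw [MulAction.Quotient.smul_coe, smul_eq_mul, mul_one]⟩
  · obtain ⟨i, hi⟩ := QuotientGroup.eq.1 h
    exact ⟨i, by simpa using hi.symm⟩

/-- A derivation with values in functions on a free `K`-set is inner. -/
theorem exists_eq_sub_of_free {K Y A : Type*} [Group K] [MulAction K Y] [AddCommGroup A]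
    (hK : ∀ (k : K) (y : Y), k • y = y → k = 1) (D : K → Y → A)
    (hD : ∀ k k' y, D (k * k') y = D k y + D k' (k⁻¹ • y)) :
    ∃ c : Y → A, ∀ k y, D k y = c y - c (k⁻¹ • y) := by
  have hex : ∀ y : Y, ∃ k : K,
      k • (Quotient.mk (MulAction.orbitRel K Y) y).out = y := by
    intro y
    obtain ⟨k, hk⟩ := Quotient.exact (Quotient.out_eq (Quotient.mk (MulAction.orbitRel K Y) y))
    exact ⟨k⁻¹, by rw [← hk]; simp⟩
  choose κ hκ using hex
  have hκ' : ∀ k y, κ (k⁻¹ • y) = k⁻¹ * κ y := by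
    intro k y
    have e : Quotient.mk (MulAction.orbitRel K Y) (k⁻¹ • y) = Quotient.mk _ y :=
      Quotient.sound ⟨k⁻¹, rfl⟩
    have h1 : κ (k⁻¹ • y) • (Quotient.mk (MulAction.orbitRel K Y) y).out =
        (k⁻¹ * κ y) • (Quotient.mk (MulAction.orbitRel K Y) y).out := by
      rw [mul_smul, hκ y, ← e, hκ]
    rw [← inv_smul_eq_iff, ← mul_smul] at h1
    exact (inv_mul_eq_one.1 (hK _ _ h1)).symm
  refine ⟨fun y => D (κ y) y, fun k y => ?_⟩
  have h0 := hD 1 1 y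
  have h1 := hD k k⁻¹ y
  simp only [mul_one, inv_one, one_smul, left_eq_add] at h0
  rw [mul_inv_cancel, h0] at h1
  simp only
  rw [hκ', hD, inv_inv, smul_inv_smul, sub_add_eq_sub_sub, sub_right_comm, sub_self, zero_sub,
    eq_neg_iff_add_eq_zero, ← h1]

end Derivations

/-! ### Fixed points of torsion elements -/

theorem SplitExtension.vec_conj {Q Y A : Type*} [Group Q] [MulAction Q Y] [AddCommGroup A]
    (v w : SplitExtension (functionAction Q Y A)) (y : Y)
    (h : (v.elt * w.elt * v.elt⁻¹) • y = y) : (v * w * v⁻¹).vec y = w.vec (v.elt⁻¹ • y) := by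
  have hfix : v.elt • w.elt⁻¹ • v.elt⁻¹ • y = y := by
    have := inv_smul_eq_iff.2 h.symm
    simpa [mul_smul] using this
  simp [hfix]

/-- The map of split extensions induced by a homomorphism of coefficients. -/
def SplitExtension.mapCoeff {Q Y A B : Type*} [Group Q] [MulAction Q Y] [AddCommGroup A]
    [AddCommGroup B] (φ : A →+ B) :
    SplitExtension (functionAction Q Y A) →* SplitExtension (functionAction Q Y B) where
  toFun v := ⟨fun y => φ (v.vec y), v.elt⟩
  map_one' := by ext <;> simp
  map_mul' v w := by ext <;> simp

namespace SplittingOperator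

variable {G : Type} [Group G] {H : Subgroup G} (R : SplittingOperator H) {P Q : Type} [Group P]
  [Finite P] [Group Q] [Finite Q]

theorem exists_lift_forcing_coset (hH : ExtensionCountsAgree H) (hG : Group.FG G) (π : G →* Q)
    {z : G} (hz : π z ≠ 1) (b : Bool) (g₀ : Q) :
    ∃ (P : Type) (_ : Group P) (_ : Finite P) (f : G →* P),
      ∀ (g : G) (b' : Bool) (g' : G), f (g⁻¹ * z * g) ∈ R.part b f →
        g₀⁻¹ * π g ∈ R.part b π → f (g'⁻¹ * z * g') ∈ R.part b' f →
        b' = b ∧ π (g⁻¹ * g') ∈ R.part b π := by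
  classical
  obtain ⟨Y, _, _, y₀, D, hD, hD₁, -, hy₀, hst⟩ :=
    exists_windingDerivation (rfl : orderOf (π z) = _)
  have : NeZero (orderOf (π z)) := ⟨(orderOf_pos _).ne'⟩
  have : Fact (1 < orderOf (π z)) := ⟨by
    have := (orderOf_pos (π z)).ne'
    have := mt orderOf_eq_one_iff.1 hz
    omega⟩
  let d : ∀ b' : Bool, R.part b' π → Y → ZMod (orderOf (π z)) := fun b' x y =>
    if b' = b ∧ ∃ k ∈ R.part b π, k • g₀⁻¹ • y₀ = y then D x y else 0
  have hd : ∀ b' (x x' : R.part b' π), d b' (x * x') =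
      d b' x + functionAction Q Y _ ((R.part b' π).subtype x) (d b' x') := by
    intro b' x x'
    ext y
    by_cases hb : b' = b
    · subst hb
      have : (∃ k ∈ R.part b' π, k • g₀⁻¹ • y₀ = (x : Q)⁻¹ • y) ↔
          (∃ k ∈ R.part b' π, k • g₀⁻¹ • y₀ = y) :=
        ⟨fun ⟨k, hk, h⟩ => ⟨x * k, mul_mem x.2 hk, by rw [mul_smul, h, smul_inv_smul]⟩,
          fun ⟨k, hk, h⟩ => ⟨(x : Q)⁻¹ * k, mul_mem (inv_mem x.2) hk, by rw [mul_smul, h]⟩⟩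
      simp only [d, this, true_and, Pi.add_apply, functionAction_apply, Subgroup.coe_subtype,
        Subgroup.coe_mul, hD]
      split_ifs
      · rfl
      · simp
    · simp [d, hb]
  obtain ⟨f, hf₁, hf₂⟩ := R.exists_lift_part hH hG
    (SplitExtension.proj (functionAction Q Y (ZMod (orderOf (π z))))) π
    (fun b' => SplitExtension.ofDerivation (R.part b' π).subtype (d b') (hd b')) (fun _ _ => rfl)
  have helt : ∀ g, (f g).elt = π g := fun g => DFunLike.congr_fun hf₁ g
  have transfer : ∀ (b' : Bool) (g : G), f (g⁻¹ * z * g) ∈ R.part b' f →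
      ∃ h : (π g)⁻¹ * π z * π g ∈ R.part b' π,
        (f z).vec y₀ = d b' ⟨_, h⟩ ((π g)⁻¹ • y₀) := by
    intro b' g hg
    rw [hf₂] at hg
    obtain ⟨x, hx⟩ := hg
    have hx' : (x : Q) = (π g)⁻¹ * π z * π g := by
      have := congrArg SplitExtension.elt hx
      rw [helt, map_mul, map_mul, map_inv] at this
      exact this
    have hmem : (π g)⁻¹ * π z * π g ∈ R.part b' π := hx' ▸ x.2
    refine ⟨hmem, ?_⟩
    have e : f z = f g * f (g⁻¹ * z * g) * (f g)⁻¹ := by simp [mul_assoc]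
    have hxm : x = ⟨_, hmem⟩ := Subtype.ext hx'
    rw [e, SplitExtension.vec_conj, ← hx, ← hxm, helt]
    · rfl
    · have : (f g).elt * (f (g⁻¹ * z * g)).elt * (f g).elt⁻¹ = π z := by
        rw [helt, helt, ← map_inv, ← map_mul, ← map_mul]
        congr 1
        group
      rw [this, hy₀]
  refine ⟨_, inferInstance, inferInstance, f, fun g b' g' h₁ h₂ h₃ => ?_⟩
  obtain ⟨m₁, e₁⟩ := transfer b g h₁
  obtain ⟨m₂, e₂⟩ := transfer b' g' h₃
  have e₃ : d b ⟨_, m₁⟩ ((π g)⁻¹ • y₀) = 1 := by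
    have hex : ∃ k ∈ R.part b π, k • g₀⁻¹ • y₀ = (π g)⁻¹ • y₀ :=
      ⟨_, inv_mem h₂, by rw [← mul_smul]; congr 1; group⟩
    simp only [d, true_and, if_pos hex]
    exact hD₁ (π g)
  rw [e₁, e₃] at e₂
  simp only [d] at e₂
  split_ifs at e₂ with hif
  swap
  · exact absurd e₂ one_ne_zero
  obtain ⟨rfl, k, hk, hky⟩ := hif
  refine ⟨rfl, ?_⟩
  rw [← mul_smul] at hky
  obtain ⟨i, hi⟩ := hst _ _ hky
  have e₄ : π (g⁻¹ * g') = ((π g)⁻¹ * π z * π g) ^ (-i) * (g₀⁻¹ * π g)⁻¹ * k⁻¹ := by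
    have e₅ : ((π g)⁻¹ * π z * π g) ^ (-i) = (π g)⁻¹ * π z ^ (-i) * π g := by
      have := conj_zpow (i := -i) (a := (π g)⁻¹) (b := π z)
      simpa using this
    have e₆ : π z ^ (-i) = π g' * k * g₀⁻¹ := by
      rw [zpow_neg, ← hi]
      group
    rw [e₅, e₆, map_mul, map_inv]
    group
  rw [e₄]
  exact mul_mem (mul_mem (zpow_mem m₁ _) (inv_mem h₂)) (inv_mem hk)

theorem exists_conj_mem_part (hH : ExtensionCountsAgree H) (hG : Group.FG G) (π : G →* Q)
    (hπ : Function.Surjective π) {z : G} (hz : π z ≠ 1) {p : ℕ}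
    (hp : p.Prime) (hzp : orderOf z = p) :
    ∃ (b : Bool) (g : G), π (g⁻¹ * z * g) ∈ R.part b π := by
  classical
  by_contra! hno
  have hord : orderOf (π z) = p := by
    have h1 : orderOf (π z) ∣ p := hzp ▸ orderOf_map_dvd π z
    exact (hp.eq_one_or_self_of_dvd _ h1).resolve_left fun h => hz (orderOf_eq_one_iff.1 h)
  obtain ⟨Y, _, _, y₀, D, hD, hD₁, htr, hy₀, hst⟩ := exists_windingDerivation hord
  have : Fact p.Prime := ⟨hp⟩
  have free : ∀ (b : Bool) (k : R.part b π) (y : Y), k • y = y → k = 1 := by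
    intro b k y hy
    obtain ⟨x, rfl⟩ := htr y
    obtain ⟨g, rfl⟩ := hπ x
    obtain ⟨i, hi⟩ := hst (π g) (k * π g) (by rw [mul_smul]; exact hy.symm)
    by_contra hk
    have hi' : (k : Q) = π g * π z ^ i * (π g)⁻¹ := by rw [← hi]; group
    have hdvd : ¬ ((p : ℤ) ∣ i) := by
      intro h
      rw [orderOf_dvd_iff_zpow_eq_one.1 (hord ▸ h)] at hi'
      exact hk (Subtype.ext (by simpa using hi'))
    obtain ⟨u, v, huv⟩ := ((Nat.prime_iff_prime_int.1 hp).coprime_iff_not_dvd.2 hdvd)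
    have hz' : π z = (π z ^ i) ^ v := by
      rw [← zpow_mul]
      conv_lhs => rw [← zpow_one (π z), ← huv, zpow_add, mul_comm u, zpow_mul, zpow_natCast,
        ← hord, pow_orderOf_eq_one, one_zpow, one_mul, mul_comm v]
    refine hno b g⁻¹ ?_
    have : π (g⁻¹⁻¹ * z * g⁻¹) = (k : Q) ^ v := by
      rw [hi', conj_zpow, ← hz']
      simp
    rw [this]
    exact zpow_mem k.2 v
  have hc : ∀ b, ∃ c : Y → ZMod p, ∀ (k : R.part b π) y, D k y = c y - c (k⁻¹ • y) := fun b =>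
    exists_eq_sub_of_free (free b) (fun k => D k) fun k k' y => hD k k' y
  choose c hc using hc
  let φ : ZMod (p ^ 2) →+ ZMod p :=
    (ZMod.castHom (dvd_pow_self p two_ne_zero) (ZMod p)).toAddMonoidHom
  have hφ : ∀ x : ZMod p, φ (x.val : ZMod (p ^ 2)) = x := fun x => by simp [φ]
  let c' : Bool → Y → ZMod (p ^ 2) := fun b y => (c b y).val
  let π' : G →* SplitExtension (functionAction Q Y (ZMod p)) :=
    SplitExtension.ofDerivation π (fun g => D (π g)) fun x y => by
      ext; simp [hD]
  have hπ' : (SplitExtension.proj _).comp π' = π := rfl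
  have hpart : ∀ b (w : R.part b π'), w.1.elt ∈ R.part b π := fun b w => by
    have := R.part_comp b (SplitExtension.proj _) π'
    rw [hπ'] at this
    rw [this]
    exact ⟨w, w.2, rfl⟩
  have hvec : ∀ b (w : R.part b π'), w.1.vec = D w.1.elt := fun b w => by
    have : R.part b π' ≤ π'.range := by
      rw [← R.sup]
      cases b
      · exact le_sup_left
      · exact le_sup_right
    obtain ⟨g, hg⟩ := this w.2
    rw [← hg]
    rfl
  let s : ∀ b, R.part b π' →* SplitExtension (functionAction Q Y (ZMod (p ^ 2))) := fun b =>
    SplitExtension.ofDerivation ((SplitExtension.proj _).comp (R.part b π').subtype)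
      (fun w y => c' b y - c' b (w.1.elt⁻¹ • y)) fun w w' => by
        ext y
        simp [mul_smul]
  obtain ⟨f, hf, -⟩ := R.exists_lift_part hH hG (SplitExtension.mapCoeff φ) π' s (fun b w => by
    ext y
    · rw [hvec]
      change φ (c' b y - c' b (w.1.elt⁻¹ • y)) = D (⟨_, hpart b w⟩ : R.part b π).1 y
      rw [map_sub, hφ, hφ, hc]
      rfl
    · rfl)
  have helt : (f z).elt = π z := congrArg SplitExtension.elt (DFunLike.congr_fun hf z)
  have hm : φ ((f z).vec y₀) = 1 := by
    have h1 := congrFun (congrArg SplitExtension.vec (DFunLike.congr_fun hf z)) y₀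
    have h2 := hD₁ 1
    simp only [inv_one, one_mul, mul_one, one_smul] at h2
    exact h1.trans h2
  have hpow : ∀ n : ℕ, ((f z) ^ n).vec y₀ = n • (f z).vec y₀ := by
    intro n
    induction n with
    | zero => simp
    | succ n ih =>
      have h1 := SplitExtension.vec_mul (f z) (f z ^ n)
      rw [← pow_succ'] at h1
      rw [h1, succ_nsmul', Pi.add_apply, functionAction_apply, helt, inv_smul_eq_iff.2 hy₀.symm, ih]
  have h0 := hpow p
  have hzp' : z ^ p = 1 := by rw [← hzp, pow_orderOf_eq_one]
  rw [← map_pow, hzp', map_one, SplitExtension.vec_one, Pi.zero_apply,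
    nsmul_eq_mul] at h0
  have : NeZero (p ^ 2) := ⟨pow_ne_zero _ hp.ne_zero⟩
  obtain ⟨m, hm'⟩ : ∃ m : ℕ, (m : ZMod (p ^ 2)) = (f z).vec y₀ := ⟨_, ZMod.natCast_zmod_val _⟩
  rw [← hm', ← Nat.cast_mul, eq_comm, ZMod.natCast_eq_zero_iff, pow_two,
    Nat.mul_dvd_mul_iff_left hp.pos] at h0
  rw [← hm'] at hm
  have h1 : φ (m : ZMod (p ^ 2)) = (m : ZMod p) := by simp [φ]
  rw [h1, (ZMod.natCast_eq_zero_iff _ _).2 h0] at hm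
  exact zero_ne_one hm

end SplittingOperator

/-- If each nontrivial element of a finite group fixes exactly one point of an invariant set, then
all elements have a common fixed point. -/
theorem exists_fixed_of_existsUnique {K Ω : Type*} [Group K] [Finite K] [MulAction K Ω]
    (T : Set Ω) (hT : ∀ (k : K), ∀ t ∈ T, k • t ∈ T) (hK : ∃ k : K, k ≠ 1)
    (hex : ∀ k : K, k ≠ 1 → ∃ t ∈ T, k • t = t)
    (huniq : ∀ k : K, k ≠ 1 → ∀ t ∈ T, ∀ t' ∈ T, k • t = t → k • t' = t' → t = t') :
    ∃ t ∈ T, ∀ k : K, k • t = t := by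
  classical
  have := Fintype.ofFinite K
  have : Nonempty Ω := let ⟨k, hk⟩ := hK; let ⟨t, _⟩ := hex k hk; ⟨t⟩
  choose! c hcT hc using hex
  let X : SubMulAction K Ω :=
    { carrier := {t | t ∈ T ∧ ∃ k : K, k ≠ 1 ∧ k • t = t}
      smul_mem' := fun g t ⟨ht, k, hk, hkt⟩ => ⟨hT g t ht, g * k * g⁻¹, by
        simpa using hk, by rw [mul_smul, inv_smul_smul, mul_smul, hkt]⟩ }
  have hXT : ∀ x : X, (x : Ω) ∈ T := fun x => x.2.1
  have hXfin : Finite X := by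
    refine Finite.of_surjective (fun k : {k : K // k ≠ 1} =>
      (⟨c k, hcT k k.2, k, k.2, hc k k.2⟩ : X)) ?_
    rintro ⟨t, ht, k, hk, hkt⟩
    exact ⟨⟨k, hk⟩, Subtype.ext (huniq k hk _ (hcT k hk) _ ht (hc k hk) hkt)⟩
  have := Fintype.ofFinite X
  have := Fintype.ofFinite (Quotient (MulAction.orbitRel K X))
  have burnside := MulAction.sum_card_fixedBy_eq_card_orbits_mul_card_group K X
  have hone : ∀ k : K, k ≠ 1 → Fintype.card (MulAction.fixedBy X k) = 1 := by
    intro k hk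
    rw [Fintype.card_eq_one_iff]
    refine ⟨⟨⟨c k, hcT k hk, k, hk, hc k hk⟩, Subtype.ext (hc k hk)⟩, ?_⟩
    rintro ⟨x, hx⟩
    exact Subtype.ext (Subtype.ext (huniq k hk _ (hXT x) _ (hcT k hk) (congrArg Subtype.val hx)
      (hc k hk)))
  have hcard1 : Fintype.card (MulAction.fixedBy X (1 : K)) = Fintype.card X := by
    refine Fintype.card_congr (Equiv.subtypeUnivEquiv fun x => ?_)
    simp
  rw [← Finset.add_sum_erase _ _ (Finset.mem_univ (1 : K)), hcard1,
    Finset.sum_congr rfl fun k hk => hone k (Finset.ne_of_mem_erase hk), Finset.sum_const,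
    Finset.card_erase_of_mem (Finset.mem_univ _), Finset.card_univ, smul_eq_mul,
    mul_one] at burnside
  -- each orbit has at most half as many points as the group has elements
  have horb : ∀ x : X, 2 * Nat.card (MulAction.orbit K x) ≤ Fintype.card K := by
    intro x
    have h1 := MulAction.card_orbit_mul_card_stabilizer_eq_card_group K x
    have h2 : 1 < Fintype.card (MulAction.stabilizer K x) := by
      obtain ⟨k, hk, hkx⟩ := x.2.2
      exact Fintype.one_lt_card_iff.2
        ⟨⟨k, Subtype.ext hkx⟩, 1, fun h => hk (congrArg Subtype.val h)⟩
    rw [← h1, Nat.card_eq_fintype_card]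
    nlinarith
  have hsum : 2 * Fintype.card X ≤
      Fintype.card (Quotient (MulAction.orbitRel K X)) * Fintype.card K := by
    have e := Fintype.card_congr (MulAction.selfEquivSigmaOrbits K X)
    rw [Fintype.card_sigma] at e
    rw [e, Finset.mul_sum, ← smul_eq_mul, ← Finset.card_univ, ← Finset.sum_const]
    refine Finset.sum_le_sum fun ω _ => ?_
    have := horb ω.out
    rwa [Nat.card_eq_fintype_card] at this
  have hk2 : 1 < Fintype.card K := by
    obtain ⟨k, hk⟩ := hK
    exact Fintype.one_lt_card_iff.2 ⟨k, 1, hk⟩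
  set r := Fintype.card (Quotient (MulAction.orbitRel K X))
  set n := Fintype.card K
  have hr : r = 1 := by
    have hX : 0 < Fintype.card X := by
      obtain ⟨k, hk⟩ := hK
      exact Fintype.card_pos_iff.2 ⟨⟨c k, hcT k hk, k, hk, hc k hk⟩⟩
    have h1 : 0 < r := by
      by_contra h
      have : r = 0 := by omega
      rw [this] at hsum
      omega
    by_contra h
    have h2 : 2 ≤ r := by omega
    have : 2 * n ≤ r * n := Nat.mul_le_mul_right n h2
    omega
  rw [hr, one_mul] at burnside
  have hX1 : Fintype.card X = 1 := by omega
  obtain ⟨x, hx⟩ := Fintype.card_eq_one_iff.1 hX1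
  exact ⟨x, hXT x, fun k => congrArg Subtype.val (hx (k • x))⟩

namespace SplittingOperator

variable {G : Type} [Group G] {H : Subgroup G} (R : SplittingOperator H) {P : Type} [Group P]
  [Finite P]

/-- The compatible family of cosets of a part of the finite quotients of `G` that is described by
an ultrafilter. -/
def thread (b : Bool) (γ : Ultrafilter G) : Bool → FiniteIndexNormalSubgroup G → Set G :=
  fun b' U => {x | b' = b ∧
    ∀ᶠ g in γ, QuotientGroup.mk' U.toSubgroup (g⁻¹ * x) ∈ R.part b (QuotientGroup.mk' U.toSubgroup)}

theorem smul_thread (k : G) (b : Bool) (γ : Ultrafilter G) :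
    k • R.thread b γ = R.thread b (γ.map (k * ·)) := by
  ext b' U x
  change x ∈ k • R.thread b γ b' U ↔ _
  rw [Set.mem_smul_set_iff_inv_smul_mem]
  simp only [thread, Set.mem_ofPred_eq, Ultrafilter.coe_map, Filter.eventually_map, smul_eq_mul,
    mul_inv_rev, mul_assoc]

theorem part_mk_of_le {U U' : FiniteIndexNormalSubgroup G} (h : U' ≤ U) {b : Bool} {x : G}
    (hx : QuotientGroup.mk' U'.toSubgroup x ∈ R.part b (QuotientGroup.mk' U'.toSubgroup)) :
    QuotientGroup.mk' U.toSubgroup x ∈ R.part b (QuotientGroup.mk' U.toSubgroup) := by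
  have h' : U'.toSubgroup ≤ (QuotientGroup.mk' U.toSubgroup).ker := by
    rw [QuotientGroup.ker_mk']; exact h
  have := R.part_comp b (QuotientGroup.lift _ _ h') (QuotientGroup.mk' U'.toSubgroup)
  rw [QuotientGroup.lift_comp_mk'] at this
  rw [this]
  exact ⟨_, hx, rfl⟩

theorem part_of_mk_ker (f : G →* P) {b : Bool} {x : G}
    (hx : QuotientGroup.mk' f.ker x ∈ R.part b (QuotientGroup.mk' f.ker)) :
    f x ∈ R.part b f := by
  have := R.part_comp b (QuotientGroup.lift _ _ le_rfl) (QuotientGroup.mk' f.ker)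
  rw [QuotientGroup.lift_comp_mk'] at this
  rw [this]
  exact ⟨_, hx, rfl⟩

theorem smul_thread_of_eventually {k : G} {b : Bool} {γ : Ultrafilter G}
    (h : ∀ U : FiniteIndexNormalSubgroup G, ∀ᶠ g in γ,
      QuotientGroup.mk' U.toSubgroup (g⁻¹ * k * g) ∈ R.part b (QuotientGroup.mk' U.toSubgroup)) :
    k • R.thread b γ = R.thread b γ := by
  rw [smul_thread]
  ext b' U x
  simp only [thread, Set.mem_ofPred_eq, Ultrafilter.coe_map, Filter.eventually_map]
  refine and_congr_right fun _ => Filter.eventually_congr ?_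
  filter_upwards [h U] with g hg
  have e : (g⁻¹ * k * g) * ((k * g)⁻¹ * x) = g⁻¹ * x := by group
  rw [← e, map_mul _ (g⁻¹ * k * g)]
  exact (Subgroup.mul_mem_cancel_left _ hg).symm

theorem eventually_of_smul_thread {k : G} {b : Bool} {γ : Ultrafilter G}
    (h : k • R.thread b γ = R.thread b γ) (U : FiniteIndexNormalSubgroup G) : ∀ᶠ g in γ,
      QuotientGroup.mk' U.toSubgroup (g⁻¹ * k * g) ∈ R.part b (QuotientGroup.mk' U.toSubgroup) := by
  obtain ⟨q, hq⟩ : ∃ q, ∀ᶠ g in γ, QuotientGroup.mk' U.toSubgroup g = q := by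
    rw [← Ultrafilter.eventually_exists_iff]
    exact Filter.Eventually.of_forall fun g => ⟨_, rfl⟩
  filter_upwards [hq] with g hg
  have h1 : g ∈ R.thread b γ b U := by
    refine ⟨rfl, ?_⟩
    filter_upwards [hq] with g' hg'
    rw [map_mul, map_inv, hg, hg', inv_mul_cancel]
    exact one_mem _
  have h2 : k • g ∈ R.thread b γ b U := by
    rw [← congrFun (congrFun h b) U]
    exact Set.smul_mem_smul_set h1
  obtain ⟨g', h3, h4⟩ := (h2.2.and hq).exists
  rw [map_mul, map_inv, h4] at h3
  rw [mul_assoc, map_mul, map_inv, hg]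
  exact h3

theorem thread_eq (hH : ExtensionCountsAgree H) (hG : Group.FG G) {z : G}
    {U₀ : FiniteIndexNormalSubgroup G} (hz : z ∉ U₀) {b b' : Bool} {γ γ' : Ultrafilter G}
    (h : z • R.thread b γ = R.thread b γ) (h' : z • R.thread b' γ' = R.thread b' γ') :
    b' = b ∧ R.thread b γ = R.thread b' γ' := by
  have key : ∀ U : FiniteIndexNormalSubgroup G, U ≤ U₀ → b' = b ∧ ∀ᶠ g in γ, ∀ᶠ g' in γ',
      QuotientGroup.mk' U.toSubgroup (g⁻¹ * g') ∈ R.part b (QuotientGroup.mk' U.toSubgroup) := by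
    intro U hU
    obtain ⟨q, hq⟩ : ∃ q, ∀ᶠ g in γ, QuotientGroup.mk' U.toSubgroup g = q := by
      rw [← Ultrafilter.eventually_exists_iff]
      exact Filter.Eventually.of_forall fun g => ⟨_, rfl⟩
    obtain ⟨P, _, _, f, hf⟩ := R.exists_lift_forcing_coset hH hG (QuotientGroup.mk' U.toSubgroup)
      (z := z) (fun h0 => hz (hU ((QuotientGroup.eq_one_iff z).1 h0))) b q
    let V : FiniteIndexNormalSubgroup G := { toSubgroup := f.ker }
    have e1 : ∀ᶠ g in γ, ∀ᶠ g' in γ', b' = b ∧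
        QuotientGroup.mk' U.toSubgroup (g⁻¹ * g') ∈ R.part b (QuotientGroup.mk' U.toSubgroup) := by
      filter_upwards [R.eventually_of_smul_thread h V, hq] with g hg hgq
      filter_upwards [R.eventually_of_smul_thread h' V] with g' hg'
      exact hf g b' g' (R.part_of_mk_ker f hg) (by rw [hgq, inv_mul_cancel]; exact one_mem _)
        (R.part_of_mk_ker f hg')
    obtain ⟨g, hg⟩ := e1.exists
    obtain ⟨g', hg'⟩ := hg.exists
    refine ⟨hg'.1, ?_⟩
    filter_upwards [e1] with g hg
    filter_upwards [hg] with g' hg' using hg'.2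
  obtain ⟨rfl, -⟩ := key U₀ le_rfl
  refine ⟨rfl, ?_⟩
  ext b U x
  refine and_congr_right fun _ => ?_
  have k1 := (key (U ⊓ U₀) inf_le_right).2
  constructor
  · intro h1
    obtain ⟨g, hg, hg'⟩ := (h1.and k1).exists
    filter_upwards [hg'] with g' hg''
    have e : g'⁻¹ * x = (g⁻¹ * g')⁻¹ * (g⁻¹ * x) := by group
    rw [e, map_mul, map_inv]
    exact mul_mem (inv_mem (R.part_mk_of_le inf_le_left hg'')) hg
  · intro h1
    filter_upwards [k1] with g hg
    obtain ⟨g', h2, h3⟩ := (hg.and h1).exists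
    have e : g⁻¹ * x = (g⁻¹ * g') * (g'⁻¹ * x) := by group
    rw [e, map_mul]
    exact mul_mem (R.part_mk_of_le inf_le_left h2) h3

theorem exists_fixed_thread_of_prime (hH : ExtensionCountsAgree H) (hG : Group.FG G) {z : G}
    {U₀ : FiniteIndexNormalSubgroup G} (hz : z ∉ U₀) {p : ℕ} (hp : p.Prime)
    (hzp : orderOf z = p) : ∃ b γ, z • R.thread b γ = R.thread b γ := by
  have : Nonempty (FiniteIndexNormalSubgroup G) := ⟨U₀⟩
  have hex : ∀ U : FiniteIndexNormalSubgroup G, ∃ (b : Bool) (g : G),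
      QuotientGroup.mk' U.toSubgroup (g⁻¹ * z * g) ∈ R.part b (QuotientGroup.mk' U.toSubgroup) := by
    intro U
    obtain ⟨b, g, h⟩ := R.exists_conj_mem_part hH hG (QuotientGroup.mk' (U ⊓ U₀).toSubgroup)
      (QuotientGroup.mk'_surjective _) (z := z)
      (fun h0 => hz ((inf_le_right : U ⊓ U₀ ≤ U₀) ((QuotientGroup.eq_one_iff z).1 h0))) hp hzp
    exact ⟨b, g, R.part_mk_of_le inf_le_left h⟩
  choose b g h using hex
  let u : Ultrafilter (FiniteIndexNormalSubgroup G) := Ultrafilter.of Filter.atBot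
  have hu : ∀ U : FiniteIndexNormalSubgroup G, ∀ᶠ U' in u, U' ≤ U := fun U =>
    Ultrafilter.of_le _ (Filter.Iic_mem_atBot U)
  obtain ⟨b₀, hb₀⟩ : ∃ b₀, ∀ᶠ U in u, b U = b₀ := by
    rw [← Ultrafilter.eventually_exists_iff]
    exact Filter.Eventually.of_forall fun g => ⟨_, rfl⟩
  refine ⟨b₀, u.map g, R.smul_thread_of_eventually fun U => ?_⟩
  rw [Ultrafilter.coe_map, Filter.eventually_map]
  filter_upwards [hb₀, hu U] with U' h1 h2
  exact R.part_mk_of_le h2 (h1 ▸ h U')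

theorem exists_fixed_thread (hH : ExtensionCountsAgree H) (hG : Group.FG G)
    (hres : ∀ z : G, z ≠ 1 → IsOfFinOrder z → ∃ U : FiniteIndexNormalSubgroup G, z ∉ U)
    {z : G} (hz : z ≠ 1) (hfin : IsOfFinOrder z) : ∃ b γ, z • R.thread b γ = R.thread b γ := by
  set n := orderOf z with hn
  have hn1 : n ≠ 1 := mt orderOf_eq_one_iff.1 hz
  have hn0 : 0 < n := hfin.orderOf_pos
  obtain ⟨p, hp, m, hm⟩ := Nat.exists_prime_and_dvd hn1
  have hm0 : m ≠ 0 := by rintro rfl; omega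
  have hord : orderOf (z ^ m) = p := by
    rw [orderOf_pow_of_dvd hm0 ⟨p, by rw [← hn, hm, mul_comm]⟩, ← hn, hm,
      Nat.mul_div_cancel _ (Nat.pos_of_ne_zero hm0)]
  have hne : z ^ m ≠ 1 := fun h => hp.one_lt.ne' (hord ▸ orderOf_eq_one_iff.2 h)
  obtain ⟨U₀, hU₀⟩ := hres _ hne hfin.pow
  obtain ⟨b, γ, h⟩ := R.exists_fixed_thread_of_prime hH hG hU₀ hp hord
  refine ⟨b, γ, ?_⟩
  rw [smul_thread]
  refine (R.thread_eq hH hG hU₀ h ?_).2.symm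
  rw [← smul_thread, ← mul_smul, ← pow_succ, pow_succ', mul_smul, h]

theorem fixed_of_finite (R : SplittingOperator H) (hH : ExtensionCountsAgree H) (hG : Group.FG G)
    (hres : ∀ z : G, z ≠ 1 → IsOfFinOrder z → ∃ U : FiniteIndexNormalSubgroup G, z ∉ U)
    (hclosed : ∀ g ∉ H, ∃ U : FiniteIndexNormalSubgroup G, ∀ h ∈ H, g⁻¹ * h ∉ U)
    (K : Subgroup G) [Finite K] {k : G} (hk : k ∈ K) (hk1 : k ≠ 1) (p : G ⧸ H) (hp : k • p = p)
    {k' : G} (hk' : k' ∈ K) : k' • p = p := by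
  have hfo : ∀ k : K, k ≠ 1 → (k : G) ≠ 1 ∧ IsOfFinOrder (k : G) := fun k hk =>
    ⟨fun h => hk (Subtype.ext h), K.subtype.isOfFinOrder (isOfFinOrder_of_finite k)⟩
  obtain ⟨_, ⟨⟨b, γ⟩, rfl⟩, ht⟩ := exists_fixed_of_existsUnique (K := K)
    (Set.range fun x : Bool × Ultrafilter G => R.thread x.1 x.2)
    (by
      rintro k _ ⟨⟨b, γ⟩, rfl⟩
      exact ⟨⟨b, _⟩, (R.smul_thread k b γ).symm⟩)
    ⟨⟨k, hk⟩, fun h => hk1 (congrArg Subtype.val h)⟩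
    (fun k hk => by
      obtain ⟨b, γ, h⟩ := R.exists_fixed_thread hH hG hres (hfo k hk).1 (hfo k hk).2
      exact ⟨_, ⟨⟨b, γ⟩, rfl⟩, h⟩)
    (by
      rintro k hk _ ⟨⟨b, γ⟩, rfl⟩ _ ⟨⟨b', γ'⟩, rfl⟩ h h'
      obtain ⟨U₀, hU₀⟩ := hres k (hfo k hk).1 (hfo k hk).2
      exact (R.thread_eq hH hG hU₀ h h').2)
  obtain ⟨g, rfl⟩ := QuotientGroup.mk_surjective p
  have hmem : g⁻¹ * k * g ∈ H := by
    have := QuotientGroup.eq.1 hp.symm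
    simpa [mul_assoc] using this
  have h1 : k • R.thread false (pure g) = R.thread false (pure g) :=
    R.smul_thread_of_eventually fun U => by
      rw [Ultrafilter.coe_pure, Filter.eventually_pure]
      exact ⟨_, hmem, rfl⟩
  obtain ⟨U₀, hU₀⟩ := hres k hk1 (hfo ⟨k, hk⟩ fun h => hk1 (congrArg Subtype.val h)).2
  have h2 := (R.thread_eq hH hG hU₀ h1 (ht ⟨k, hk⟩)).2
  have h3 : k' • R.thread false (pure g) = R.thread false (pure g) := by
    rw [h2]; exact ht ⟨k', hk'⟩
  refine QuotientGroup.eq.2 ?_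
  by_contra hno
  have hno' : g⁻¹ * k' * g ∉ H := fun h => hno (by
    have := inv_mem h
    simpa [mul_assoc] using this)
  obtain ⟨U, hU⟩ := hclosed _ hno'
  have h4 := R.eventually_of_smul_thread h3 U
  rw [Ultrafilter.coe_pure, Filter.eventually_pure] at h4
  obtain ⟨h, hh, e⟩ := h4
  exact hU h hh (QuotientGroup.eq.1 e.symm)

theorem unique_of_isOfFinOrder (R : SplittingOperator H) (hH : ExtensionCountsAgree H)
    (hG : Group.FG G)
    (hres : ∀ z : G, z ≠ 1 → IsOfFinOrder z → ∃ U : FiniteIndexNormalSubgroup G, z ∉ U)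
    (hclosed : ∀ g ∉ H, ∃ U : FiniteIndexNormalSubgroup G, ∀ h ∈ H, g⁻¹ * h ∉ U)
    {z : G} (hz : z ≠ 1) (hfin : IsOfFinOrder z) (p q : G ⧸ H) (hp : z • p = p)
    (hq : z • q = q) : p = q := by
  obtain ⟨U₀, hU₀⟩ := hres z hz hfin
  have fix : ∀ g : G, z • (g : G ⧸ H) = g →
      z • R.thread false (pure g) = R.thread false (pure g) := by
    intro g hg
    have hmem : g⁻¹ * z * g ∈ H := by
      have := QuotientGroup.eq.1 hg.symm
      simpa [mul_assoc] using this
    refine R.smul_thread_of_eventually fun U => ?_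
    rw [Ultrafilter.coe_pure, Filter.eventually_pure]
    exact ⟨_, hmem, rfl⟩
  obtain ⟨g, rfl⟩ := QuotientGroup.mk_surjective p
  obtain ⟨g', rfl⟩ := QuotientGroup.mk_surjective q
  have h2 := (R.thread_eq hH hG hU₀ (fix g hp) (fix g' hq)).2
  refine QuotientGroup.eq.2 ?_
  by_contra hno
  obtain ⟨U, hU⟩ := hclosed _ hno
  have h4 : g' ∈ R.thread false (pure g) false U := by
    rw [h2]
    refine ⟨rfl, ?_⟩
    rw [Ultrafilter.coe_pure, Filter.eventually_pure, inv_mul_cancel, map_one]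
    exact one_mem _
  have h5 := h4.2
  rw [Ultrafilter.coe_pure, Filter.eventually_pure] at h5
  obtain ⟨h, hh, e⟩ := h5
  exact hU h hh (QuotientGroup.eq.1 e.symm)

end SplittingOperator

/-! ### Extending derivations -/

section ExtendDerivations

variable {G : Type} [Group G] {H : Subgroup G}

theorem SplittingOperator.exists_extend_derivation (R : SplittingOperator H)
    (hH : ExtensionCountsAgree H) (hG : Group.FG G) {M : Type} [AddCommGroup M] [Finite M]
    (act : G →* AddMonoid.End M) (d : H → M)
    (hd : ∀ x y : H, d (x * y) = d x + act x (d y)) :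
    ∃ D : G → M, (∀ x y, D (x * y) = D x + act x (D y)) ∧ ∀ h : H, D h = d h := by
  have : Finite (AddMonoid.End M) := DFunLike.finite (AddMonoid.End M)
  let π : G →* (AddMonoid.End M)ˣ := act.toHomUnits
  let a : (AddMonoid.End M)ˣ →* AddMonoid.End M := Units.coeHom _
  obtain ⟨f, h1, h2, -⟩ := R.exists_lift hH hG (SplitExtension.proj a) π
    (SplitExtension.ofDerivation (act := a) (π.comp H.subtype) d hd)
    (SplitExtension.ofDerivation (act := a) (R.ρ π) (fun _ => 0) (fun _ _ => by simp)) rfl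
    (fun h hh => by
      ext
      · rfl
      · exact DFunLike.congr_fun (congrArg Units.val (R.kills π h hh)) _) rfl
  have hf : ∀ x, (f x).elt = π x := fun x => DFunLike.congr_fun h1 x
  refine ⟨fun x => (f x).vec, fun x y => ?_, fun h => ?_⟩
  · simp only [map_mul, SplitExtension.vec_mul, hf]
    rfl
  · exact congrArg SplitExtension.vec (DFunLike.congr_fun h2 h)

/-- Derivations on the stabilizers of orbit representatives for a subgroup of finite index extend,
up to inner derivations, to one derivation of that subgroup. -/
theorem SplittingOperator.exists_derivation_of_stabilizer (R : SplittingOperator H)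
    (hH : ExtensionCountsAgree H) (hG : Group.FG G) {F : Type} [Group F] (i : F →* G)
    (hi : Function.Injective i) [i.range.FiniteIndex] (r : G ⧸ H → G ⧸ H)
    (hr : ∀ u p, r (i u • p) = r p) (hr' : ∀ p, ∃ u, i u • r p = p)
    {M : Type} [AddCommGroup M] [Finite M] (ρ : F →* AddMonoid.End M) (δ : G ⧸ H → F → M)
    (hδ : ∀ p y y', i y • p = p → i y' • p = p → δ p (y * y') = δ p y + ρ y (δ p y')) :
    ∃ (D : F → M) (μ : G ⧸ H → M), (∀ u u', D (u * u') = D u + ρ u (D u')) ∧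
      ∀ p, r p = p → ∀ y, i y • p = p → δ p y = D y + ρ y (μ p) - μ p := by
  have ρmul : ∀ u u' m, ρ (u * u') m = ρ u (ρ u' m) := fun u u' m => by rw [map_mul]; rfl
  have ρone : ∀ m, ρ 1 m = m := fun m => by rw [map_one]; rfl
  let c : G → G := fun x => (Quotient.mk (QuotientGroup.rightRel i.range) x).out
  have hv : ∀ x, ∃ u, i u * c x = x := fun x => by
    have := Quotient.exact (Quotient.out_eq (Quotient.mk (QuotientGroup.rightRel i.range) x))
    obtain ⟨u, hu⟩ := QuotientGroup.rightRel_apply.1 this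
    exact ⟨u, by rw [hu]; exact inv_mul_cancel_right _ _⟩
  choose v hv using hv
  have hc : ∀ u x, c (i u * x) = c x := fun u x => by
    refine congrArg Quotient.out (Quotient.sound ?_)
    refine QuotientGroup.rightRel_apply.2 ⟨u⁻¹, ?_⟩
    simp
  have hv' : ∀ u x, v (i u * x) = u * v x := fun u x => by
    apply hi
    rw [map_mul, ← mul_right_cancel_iff (a := c x), mul_assoc, hv, ← hc u x, hv]
  choose b hb using hr'
  let w : G → F := fun x => v x * b (c x : G)
  have hw : ∀ u x, w (i u * x) = u * w x := fun u x => by simp only [w, hv', hc, mul_assoc]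
  have hwr : ∀ x : G, i (w x) • r (x : G ⧸ H) = (x : G ⧸ H) := fun x => by
    have e : r (x : G ⧸ H) = r (c x : G ⧸ H) := by
      conv_lhs => rw [← hv x]
      exact hr (v x) (c x : G ⧸ H)
    rw [e, map_mul, mul_smul, hb]
    conv_rhs => rw [← hv x]
    rfl
  let M' : AddSubgroup (G → M) :=
    { carrier := {f | ∀ u x, f (i u * x) = ρ u (f x)}
      zero_mem' := fun u x => by simp
      add_mem' := fun {f f'} h h' u x => by simp [h u x, h' u x]
      neg_mem' := fun {f} h u x => by simp [h u x] }
  have : Finite (Quotient (QuotientGroup.rightRel i.range)) :=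
    Finite.of_equiv _ (QuotientGroup.quotientRightRelEquivQuotientLeftRel i.range).symm
  have : Finite M' := by
    refine Finite.of_injective
      (fun (f : M') (q : Quotient (QuotientGroup.rightRel i.range)) => f.1 q.out) fun f f' h => ?_
    ext x
    rw [← hv x, f.2, f'.2]
    exact congrArg _ (congrFun h _)
  let act : G →* AddMonoid.End M' :=
    { toFun := fun g =>
        { toFun := fun f => ⟨fun x => f.1 (x * g), fun u x => by simp only [mul_assoc, f.2 u]⟩
          map_zero' := rfl
          map_add' := fun _ _ => rfl }
      map_one' := by
        ext f x
        exact congrArg f.1 (mul_one x)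
      map_mul' := fun g g' => by
        ext f x
        exact congrArg f.1 (mul_assoc x g g').symm }
  have hst : ∀ (x : G) (h : H), i ((w x)⁻¹ * w (x * h)) • r (x : G ⧸ H) = r (x : G ⧸ H) := by
    intro x h
    have e : ((x * h : G) : G ⧸ H) = x := by simp
    rw [map_mul, mul_smul, map_inv, inv_smul_eq_iff, hwr]
    conv_rhs => rw [← e, ← hwr (x * h), e]
  let d : H → M' := fun h =>
    ⟨fun x => ρ (w x) (δ (r x) ((w x)⁻¹ * w (x * h))), fun u x => by
      have e : r ((i u * x : G) : G ⧸ H) = r (x : G ⧸ H) := hr u (x : G ⧸ H)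
      beta_reduce
      rw [e, hw, mul_assoc, hw, ρmul]
      congr 3
      group⟩
  obtain ⟨D, hD, hDd⟩ := R.exists_extend_derivation hH hG act d (fun h h' => by
    ext x
    have e : ((x * h : G) : G ⧸ H) = x := by simp
    change ρ (w x) (δ (r x) ((w x)⁻¹ * w (x * (h * h' : G)))) =
      ρ (w x) (δ (r x) ((w x)⁻¹ * w (x * h))) +
        ρ (w (x * h)) (δ (r (x * h : G)) ((w (x * h))⁻¹ * w (x * h * h')))
    have e2 : (w x)⁻¹ * w (x * (h * h' : G)) =
        ((w x)⁻¹ * w (x * h)) * ((w (x * h))⁻¹ * w (x * h * h')) := by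
      rw [← mul_assoc x]
      group
    have hs := hst (x * h) h'
    rw [e] at hs
    rw [e2, hδ _ _ _ (hst x h) hs, map_add, e, ← ρmul (w x)]
    simp)
  have hDm : ∀ g g' x, (D (g * g')).1 x = (D g).1 x + (D g').1 (x * g) := fun g g' x => by
    rw [hD]
    rfl
  have hDe : ∀ g u, (D g).1 (i u) = ρ u ((D g).1 1) := fun g u => by
    rw [← (D g).2 u 1, mul_one]
  refine ⟨fun u => (D (i u)).1 1, fun p => (D ((i (w p.out))⁻¹ * p.out)).1 1, fun u u' => ?_,
    fun p hp y hy => ?_⟩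
  · simp only [map_mul, hDm, one_mul, hDe]
  · set t : G := (i (w p.out))⁻¹ * p.out with ht
    have hwt : w t = 1 := by rw [ht, ← map_inv, hw, inv_mul_cancel]
    have htp : (t : G ⧸ H) = p := by
      have h1 := hwr p.out
      rw [QuotientGroup.out_eq', hp] at h1
      have : (t : G ⧸ H) = (i (w p.out))⁻¹ • ((p.out : G) : G ⧸ H) := rfl
      rw [this, inv_smul_eq_iff, h1, QuotientGroup.out_eq']
    have hh : t⁻¹ * (i y * t) ∈ H := by
      rw [← QuotientGroup.eq]
      change (t : G ⧸ H) = i y • (t : G ⧸ H)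
      rw [htp, hy]
    have e1 := hDm (i y) t 1
    have e2 := hDm t (t⁻¹ * (i y * t)) 1
    have e3 : (D (t⁻¹ * (i y * t))).1 t = δ p y := by
      have e := congrArg (fun f => f.1 t) (hDd ⟨_, hh⟩)
      refine e.trans ?_
      change ρ (w t) (δ (r t) ((w t)⁻¹ * w (t * (t⁻¹ * (i y * t))))) = δ p y
      rw [mul_inv_cancel_left, hw, hwt, htp, hp, ρone]
      simp
    rw [mul_inv_cancel_left, one_mul, e3] at e2
    rw [one_mul, hDe] at e1
    rw [e1] at e2
    exact eq_sub_of_add_eq' e2.symm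

end ExtendDerivations

/-! ### Finite approximation of representations of free groups -/

section Approximation

/-- On finitely many vectors and for finitely many group elements, a representation of a free group
agrees with a finite-dimensional one. -/
theorem exists_finiteDimensional_representation {k X W : Type*} [Field k]
    [AddCommGroup W] [Module k W] (ρ : FreeGroup X →* Module.End k W) {E : Set W} (hE : E.Finite)
    {S : Set (FreeGroup X)} (hS : S.Finite) :
    ∃ (V : Submodule k W) (_ : FiniteDimensional k V) (α : FreeGroup X →* (V ≃ₗ[k] V))
      (hV : ∀ e ∈ E, e ∈ V), ∀ e (he : e ∈ E), ∀ u ∈ S, (α u ⟨e, hV e he⟩ : W) = ρ u e := by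
  have hword : ∀ u : FreeGroup X, ∃ L, FreeGroup.mk L = u := fun u => Quot.exists_rep u
  choose word hword using hword
  let T : Set (List (X × Bool)) := insert [] (⋃ u ∈ S, {L | L <:+ word u})
  have hT : T.Finite := by
    refine (hS.biUnion fun u _ => ?_).insert _
    have : {L | L <:+ word u} = {L | L ∈ (word u).tails} := by
      ext L
      simp
    rw [this]
    exact List.finite_toSet _
  let V : Submodule k W := Submodule.span k ((fun x => ρ (FreeGroup.mk x.1) x.2) '' (T ×ˢ E))
  have hVm : ∀ L ∈ T, ∀ e ∈ E, ρ (FreeGroup.mk L) e ∈ V := fun L hL e he =>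
    Submodule.subset_span ⟨(L, e), ⟨hL, he⟩, rfl⟩
  have : FiniteDimensional k V :=
    FiniteDimensional.span_of_finite k ((hT.prod hE).image _)
  have ρi : ∀ u w, ρ u⁻¹ (ρ u w) = w := fun u w => by
    rw [← Module.End.mul_apply, ← map_mul, inv_mul_cancel, map_one, Module.End.one_apply]
  have ρi' : ∀ u w, ρ u (ρ u⁻¹ w) = w := fun u w => by
    rw [← Module.End.mul_apply, ← map_mul, mul_inv_cancel, map_one, Module.End.one_apply]
  have hg : ∀ x : X, ∃ g : V ≃ₗ[k] V, ∀ v : V, ∀ h : ρ (FreeGroup.of x) v ∈ V,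
      g v = ⟨ρ (FreeGroup.of x) v, h⟩ := by
    intro x
    let P : Submodule k V := (V.comap (ρ (FreeGroup.of x))).comap V.subtype
    let f : P →ₗ[k] V := ((ρ (FreeGroup.of x)).comp (V.subtype.comp P.subtype)).codRestrict V
      fun p => p.2
    have hf : Function.Injective f := fun p p' h => by
      have h' : ρ (FreeGroup.of x) (p : V) = ρ (FreeGroup.of x) (p' : V) :=
        congrArg Subtype.val h
      have := congrArg (ρ (FreeGroup.of x)⁻¹) h'
      rw [ρi, ρi] at this
      exact Subtype.ext (Subtype.ext this)
    obtain ⟨g, hg⟩ := Submodule.exists_linearEquiv_restrict_eq (LinearEquiv.ofInjective f hf)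
    refine ⟨g, fun v h => ?_⟩
    rw [← hg ⟨v, h⟩]
    rfl
  choose g hg using hg
  let α : FreeGroup X →* (V ≃ₗ[k] V) := FreeGroup.lift g
  have hVE : ∀ e ∈ E, e ∈ V := fun e he => by
    have := hVm [] (Set.mem_insert _ _) e he
    rwa [← FreeGroup.one_eq_mk, map_one] at this
  have key : ∀ e (he : e ∈ E) (L : List (X × Bool)), (∀ L', L' <:+ L → L' ∈ T) →
      (α (FreeGroup.mk L) ⟨e, hVE e he⟩ : W) = ρ (FreeGroup.mk L) e := by
    intro e he L
    induction L with
    | nil =>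
      intro _
      rw [← FreeGroup.one_eq_mk, map_one, map_one]
      rfl
    | cons a L ih =>
      intro hL
      have ih := ih fun L' h => hL L' (h.trans (List.suffix_cons a L))
      have m : ρ (FreeGroup.mk (a :: L)) e ∈ V := hVm _ (hL _ List.suffix_rfl) e he
      obtain ⟨x, b⟩ := a
      cases b with
      | true =>
        have e1 : FreeGroup.mk ((x, true) :: L) = FreeGroup.of x * FreeGroup.mk L := rfl
        rw [e1, map_mul, Module.End.mul_apply, ← ih] at m
        rw [e1, map_mul, map_mul, Module.End.mul_apply, ← ih, LinearEquiv.mul_apply]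
        have : α (FreeGroup.of x) = g x := FreeGroup.lift_apply_of
        rw [this, hg x _ m]
      | false =>
        have e1 : FreeGroup.mk ((x, false) :: L) = (FreeGroup.of x)⁻¹ * FreeGroup.mk L := rfl
        rw [e1, map_mul, Module.End.mul_apply, ← ih] at m
        rw [e1, map_mul, map_mul, Module.End.mul_apply, ← ih, LinearEquiv.mul_apply]
        have h1 : α (FreeGroup.of x) = g x := FreeGroup.lift_apply_of
        have h2 := hg x ⟨_, m⟩ (by rw [ρi']; exact Subtype.property _)
        have h3 : g x ⟨_, m⟩ = α (FreeGroup.mk L) ⟨e, hVE e he⟩ := by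
          rw [h2]
          ext
          exact ρi' _ _
        have h4 : α (FreeGroup.of x)⁻¹ (α (FreeGroup.mk L) ⟨e, hVE e he⟩) = ⟨_, m⟩ := by
          rw [map_inv, h1]
          exact (g x).symm_apply_eq.2 h3.symm
        rw [h4]
  refine ⟨V, this, α, hVE, fun e he u hu => ?_⟩
  rw [← hword u]
  exact key e he _ fun L' h => Set.mem_insert_of_mem _ (Set.mem_biUnion hu h)

variable {k F I : Type*} [Field k] [Group F]

/-- The homomorphism from the free module on `I` over the group algebra of `F` to an `F`-module that
is given by the images of the basis elements. -/
noncomputable def freeMap {M : Type*} [AddCommGroup M] [Module k M] (ρ : F →* Module.End k M)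
    (n : I → M) : (F × I →₀ k) →ₗ[k] M :=
  Finsupp.linearCombination k fun x => ρ x.1 (n x.2)

section freeMap

variable {M M' : Type*} [AddCommGroup M] [Module k M] [AddCommGroup M'] [Module k M']

@[simp] theorem freeMap_single (ρ : F →* Module.End k M) (n : I → M) (x : F × I) (c : k) :
    freeMap ρ n (Finsupp.single x c) = c • ρ x.1 (n x.2) := by
  simp [freeMap]

theorem freeMap_comp (ρ : F →* Module.End k M) (ρ' : F →* Module.End k M') (T : M →ₗ[k] M')
    (hT : ∀ u m, T (ρ u m) = ρ' u (T m)) (n : I → M) (b : F × I →₀ k) :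
    freeMap ρ' (fun i => T (n i)) b = T (freeMap ρ n b) := by
  induction b using Finsupp.induction_linear with
  | zero => simp
  | add b b' h h' => simp [h, h']
  | single x c => simp [hT]

theorem freeMap_sum (ρ : F →* Module.End k M) {J : Type*} (s : Finset J) (n : J → I → M)
    (b : F × I →₀ k) : freeMap ρ (fun i => ∑ j ∈ s, n j i) b = ∑ j ∈ s, freeMap ρ (n j) b := by
  induction b using Finsupp.induction_linear with
  | zero => simp
  | add b b' h h' => simp [h, h', Finset.sum_add_distrib]
  | single x c => simp [Finset.smul_sum]

end freeMap

/-- The permutation representation of a group on the free module on a set. -/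
noncomputable def permRep (k : Type*) [Field k] {Y : Type*} (σ : F →* Function.End Y) :
    F →* Module.End k (Y →₀ k) where
  toFun u := Finsupp.lmapDomain k k (σ u)
  map_one' := by
    rw [map_one]
    exact Finsupp.lmapDomain_id k k
  map_mul' u v := by
    rw [map_mul]
    exact Finsupp.lmapDomain_comp k k (σ v) (σ u)

@[simp] theorem permRep_single {Y : Type*} (σ : F →* Function.End Y) (u : F) (y : Y) (c : k) :
    permRep k σ u (Finsupp.single y c) = Finsupp.single (σ u y) c :=
  Finsupp.mapDomain_single

end Approximation

section Solve

variable {k : Type} [Field k]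

/-- A finite system of linear equations over the group algebra of a free group, with arbitrary
right-hand sides, is solvable in all modules if it is solvable in all finite modules. -/
theorem exists_freeMap_eq [Finite k] {X I Y : Type} [Finite I] [Finite Y]
    (a : Y → (FreeGroup X × I →₀ k))
    (h : ∀ (M : Type) [AddCommGroup M] [Module k M] [Finite M]
      (ρ : FreeGroup X →* Module.End k M) (m : Y → M), ∃ n : I → M, ∀ y, freeMap ρ n (a y) = m y)
    {M : Type*} [AddCommGroup M] [Module k M] (ρ : FreeGroup X →* Module.End k M) (m : Y → M) :
    ∃ n : I → M, ∀ y, freeMap ρ n (a y) = m y := by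
  classical
  have := Fintype.ofFinite I
  have := Fintype.ofFinite Y
  let F := FreeGroup X
  let left : F →* Module.End k (F →₀ k) := permRep k (MulAction.toEndHom (α := F))
  let right : F →* Module.End k (F →₀ k) := permRep k
    { toFun := fun u y => y * u⁻¹
      map_one' := by
        funext y
        exact (by simp : y * 1⁻¹ = y)
      map_mul' := fun u v => by
        funext y
        exact (by simp [mul_assoc] : y * (u * v)⁻¹ = y * v⁻¹ * u⁻¹) }
  have hleft : ∀ (u v : F) c, left u (Finsupp.single v c) = Finsupp.single (u * v) c :=
    fun u v c => permRep_single _ _ _ _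
  have hright : ∀ (u v : F) c, right u (Finsupp.single v c) = Finsupp.single (v * u⁻¹) c :=
    fun u v c => permRep_single _ _ _ _
  have hcomm : ∀ u v f, right u (left v f) = left v (right u f) := fun u v f => by
    induction f using Finsupp.induction_linear with
    | zero => simp
    | add f f' hf hf' => simp [hf, hf']
    | single w c => simp only [hleft, hright, mul_assoc]
  let Λ : (I → F →₀ k) → Y → F →₀ k := fun n y => freeMap left n (a y)
  have hΛadd : ∀ n n', Λ (n + n') = Λ n + Λ n' := fun n n' => by
    funext y
    have := freeMap_sum left Finset.univ ![n, n'] (a y)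
    simp only [Fin.sum_univ_two] at this
    exact this
  have hΛcomp : ∀ (T : (F →₀ k) →ₗ[k] (F →₀ k)), (∀ u f, T (left u f) = left u (T f)) →
      ∀ n, Λ (fun i => T (n i)) = fun y => T (Λ n y) := fun T hT n => by
    funext y
    exact freeMap_comp left left T hT n (a y)
  have hΛsmul : ∀ (c : k) n, Λ (fun i => c • n i) = fun y => c • Λ n y := fun c n => by
    have h := hΛcomp (c • LinearMap.id) (by simp) n
    simpa only [LinearMap.smul_apply, LinearMap.id_apply] using h
  let Λl : (I → F →₀ k) →ₗ[k] (Y → F →₀ k) :=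
    { toFun := Λ
      map_add' := hΛadd
      map_smul' := hΛsmul }
  let Im : Submodule k (Y → F →₀ k) := LinearMap.range Λl
  have hIm : ∀ u, Im ≤ Im.comap (LinearMap.compLeft (right u) Y) := by
    rintro u _ ⟨n, rfl⟩
    exact ⟨fun i => right u (n i), hΛcomp (right u) (hcomm u) n⟩
  let ρW : F →* Module.End k ((Y → F →₀ k) ⧸ Im) :=
    { toFun := fun u => Im.mapQ Im (LinearMap.compLeft (right u) Y) (hIm u)
      map_one' := by
        refine LinearMap.ext fun w => ?_
        obtain ⟨f, rfl⟩ := Submodule.mkQ_surjective Im w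
        have : LinearMap.compLeft (right 1) Y f = f := by
          rw [map_one]
          rfl
        exact congrArg Im.mkQ this
      map_mul' := fun u v => by
        refine LinearMap.ext fun w => ?_
        obtain ⟨f, rfl⟩ := Submodule.mkQ_surjective Im w
        have : LinearMap.compLeft (right (u * v)) Y f =
            LinearMap.compLeft (right u) Y (LinearMap.compLeft (right v) Y f) := by
          rw [map_mul]
          rfl
        exact congrArg Im.mkQ this }
  let e : Y → (Y → F →₀ k) := fun y => Pi.single y (Finsupp.single 1 1)
  have hρe : ∀ u y, ρW u (Im.mkQ (e y)) = Im.mkQ (Pi.single y (Finsupp.single u⁻¹ 1)) := by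
    intro u y
    change Im.mkQ (LinearMap.compLeft (right u) Y (e y)) = _
    congr 1
    funext y'
    simp only [LinearMap.compLeft_apply, Function.comp_apply, e]
    rcases eq_or_ne y' y with rfl | hy
    · simp [hright]
    · simp [hy]
  have he : ∀ y, e y ∈ Im := by
    by_contra! hne
    obtain ⟨y₀, hy₀⟩ := hne
    obtain ⟨V, hfin, α, hV, hα⟩ := exists_finiteDimensional_representation ρW
      (Set.finite_range fun y => Im.mkQ (e y))
      (S := ⋃ y, (fun x : F × I => x.1⁻¹) '' ((a y).support : Set (F × I)))
      (Set.finite_iUnion fun y => ((a y).support.finite_toSet).image _)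
    let v : Y → V := fun y => ⟨Im.mkQ (e y), hV _ ⟨y, rfl⟩⟩
    have hv₀ : v y₀ ≠ 0 := fun h0 => hy₀ <| by
      have := congrArg Subtype.val h0
      exact (Submodule.Quotient.mk_eq_zero Im).1 this
    obtain ⟨φ, hφ⟩ : ∃ φ : Module.Dual k V, φ (v y₀) ≠ 0 := by
      by_contra! hall
      exact hv₀ ((Module.forall_dual_apply_eq_zero_iff k _).1 hall)
    have : Finite (Module.Dual k V) := Module.finite_of_finite k
    let ρD : F →* Module.End k (Module.Dual k V) :=
      { toFun := fun u => ((α u⁻¹ : V ≃ₗ[k] V) : V →ₗ[k] V).dualMap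
        map_one' := by
          ext f x
          simp
        map_mul' := fun u w => by
          ext f x
          simp }
    obtain ⟨n, hn⟩ := h _ ρD (Pi.single y₀ φ)
    have hext : ∀ i, ∃ N : ((Y → F →₀ k) ⧸ Im) →ₗ[k] k, N.comp V.subtype = n i := fun i =>
      LinearMap.exists_extend (n i)
    choose N hN using hext
    let c : I → (F × I →₀ k) →ₗ[k] (F →₀ k) := fun i =>
      freeMap left (Pi.single i (Finsupp.single 1 1))
    let f : Y → (F × I →₀ k) →ₗ[k] k := fun y =>
      ∑ i, (N i).comp (Im.mkQ.comp ((LinearMap.single k (fun _ : Y => F →₀ k) y).comp (c i)))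
    have hf : ∀ y x r, f y (Finsupp.single x r) =
        r * N x.2 (Im.mkQ (Pi.single y (Finsupp.single x.1 1))) := by
      rintro y ⟨u, j⟩ r
      simp only [f, LinearMap.sum_apply, LinearMap.comp_apply, c, freeMap_single]
      rw [Finset.sum_eq_single j]
      · rw [Pi.single_eq_same, hleft, map_smul, map_smul, map_smul, smul_eq_mul, mul_one]
        rfl
      · intro i _ hij
        simp [hij.symm]
      · simp
    have h1 : ∀ y, f y (a y) = (freeMap ρD n (a y)) (v y) := by
      intro y
      conv_lhs => rw [← Finsupp.sum_single (a y)]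
      rw [freeMap, Finsupp.linearCombination_apply, Finsupp.sum, Finsupp.sum, map_sum,
        LinearMap.sum_apply]
      refine Finset.sum_congr rfl fun x hx => ?_
      rw [hf, LinearMap.smul_apply, smul_eq_mul]
      congr 1
      have := hα _ ⟨y, rfl⟩ x.1⁻¹ (Set.mem_iUnion.2 ⟨y, x, hx, rfl⟩)
      rw [hρe, inv_inv] at this
      rw [← this]
      change (N x.2).comp V.subtype _ = _
      rw [hN]
      rfl
    have h2 : ∑ y, f y (a y) = 0 := by
      simp only [f, LinearMap.sum_apply, LinearMap.comp_apply]
      rw [Finset.sum_comm]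
      refine Finset.sum_eq_zero fun i _ => ?_
      rw [← map_sum, ← map_sum]
      have : ∑ y, (LinearMap.single k (fun _ : Y => F →₀ k) y) (c i (a y)) =
          Λ (Pi.single i (Finsupp.single 1 1)) :=
        Finset.univ_sum_single _
      have hz : Im.mkQ (Λ (Pi.single i (Finsupp.single 1 1))) = 0 :=
        (Submodule.Quotient.mk_eq_zero Im).2 ⟨_, rfl⟩
      rw [this, hz, map_zero]
    rw [Finset.sum_congr rfl fun y _ => (h1 y).trans (by rw [hn y]), Finset.sum_eq_single y₀] at h2
    · exact hφ (by simpa using h2)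
    · intro y _ hy
      simp [hy]
    · simp
  choose n hn' using he
  have hn : ∀ y y', freeMap left (n y) (a y') = e y y' := fun y => congrFun (hn' y)
  let ev : M → (F →₀ k) →ₗ[k] M := fun x => Finsupp.linearCombination k fun u => ρ u x
  have hev : ∀ x u f, ev x (left u f) = ρ u (ev x f) := fun x u f => by
    induction f using Finsupp.induction_linear with
    | zero => simp
    | add f f' hf hf' => simp [hf, hf']
    | single w c => simp [hleft, ev]
  refine ⟨fun i => ∑ y, ev (m y) (n y i), fun y => ?_⟩
  rw [freeMap_sum, Finset.sum_eq_single y]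
  · rw [freeMap_comp left ρ _ (hev _), hn]
    simp [e, ev]
  · intro y' _ hy
    rw [freeMap_comp left ρ _ (hev _), hn]
    simp [e, hy.symm]
  · simp

end Solve

/-! ### Derivations on free groups -/

section FreeDerivations

variable {k F M : Type*} [Field k] [Group F] [AddCommGroup M] [Module k M]

/-- The additive endomorphism underlying a linear endomorphism. -/
def linearToAddEnd (k M : Type*) [Field k] [AddCommGroup M] [Module k M] :
    Module.End k M →* AddMonoid.End M where
  toFun f := f.toAddMonoidHom
  map_one' := rfl
  map_mul' _ _ := rfl

@[simp] theorem linearToAddEnd_apply (f : Module.End k M) (x : M) :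
    linearToAddEnd k M f x = f x := rfl

theorem FreeGroupBasis.exists_derivation {ι : Type*} (b : FreeGroupBasis ι F)
    (ρ : F →* Module.End k M) (n : ι → M) :
    ∃ D : F → M, (∀ u v, D (u * v) = D u + ρ u (D v)) ∧ ∀ i, D (b i) = n i := by
  let act := (linearToAddEnd k M).comp ρ
  let φ : F →* SplitExtension act := b.lift fun i => ⟨n i, b i⟩
  have hφ : ∀ i, φ (b i) = ⟨n i, b i⟩ := fun i =>
    congrFun (b.lift.symm_apply_apply fun i => (⟨n i, b i⟩ : SplitExtension act)) i
  have he : (SplitExtension.proj act).comp φ = MonoidHom.id F := b.ext_hom _ _ fun i => by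
    simp [hφ]
  have he' : ∀ u, (φ u).elt = u := DFunLike.congr_fun he
  exact ⟨fun u => (φ u).vec, fun u v => by simp [he', act], fun i => by simp [hφ]⟩

theorem FreeGroupBasis.derivation_ext {ι : Type*} (b : FreeGroupBasis ι F)
    (ρ : F →* Module.End k M) {D D' : F → M} (hD : ∀ u v, D (u * v) = D u + ρ u (D v))
    (hD' : ∀ u v, D' (u * v) = D' u + ρ u (D' v)) (h : ∀ i, D (b i) = D' (b i)) (u : F) :
    D u = D' u := by
  let act := (linearToAddEnd k M).comp ρ
  have := b.ext_hom (SplitExtension.ofDerivation (act := act) (MonoidHom.id F) D hD)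
    (SplitExtension.ofDerivation (act := act) (MonoidHom.id F) D' hD') fun i => by
      ext
      · exact h i
      · rfl
  exact congrArg SplitExtension.vec (DFunLike.congr_fun this u)

theorem IsFreeGroup.finite_generators (F : Type*) [Group F] [IsFreeGroup F] (h : Group.FG F) :
    Finite (IsFreeGroup.Generators F) := by
  classical
  have := finite_monoidHom (P := Multiplicative (ZMod 2)) h
  have : Finite (IsFreeGroup.Generators F → Multiplicative (ZMod 2)) :=
    Finite.of_equiv _ (IsFreeGroup.basis F).lift.symm
  refine Finite.of_injective (fun i : IsFreeGroup.Generators F =>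
    (fun j => if j = i then Multiplicative.ofAdd (1 : ZMod 2) else 1)) fun i j hij => ?_
  by_contra hne
  have := congrFun hij i
  simp only [if_true, hne, if_false] at this
  exact absurd this (by decide)

/-- The free module on `I` over the group algebra of `F`. -/
noncomputable def freeRep (k F I : Type*) [Field k] [Group F] : F →* Module.End k (F × I →₀ k) :=
  permRep k
    { toFun := fun u x => (u * x.1, x.2)
      map_one' := by
        funext x
        exact Prod.ext (one_mul x.1) rfl
      map_mul' := fun u v => by
        funext x
        exact Prod.ext (mul_assoc u v x.1) rfl }

@[simp] theorem freeRep_single {I : Type*} (u v : F) (i : I) (c : k) :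
    freeRep k F I u (Finsupp.single (v, i) c) = Finsupp.single (u * v, i) c :=
  permRep_single _ _ _ _

theorem freeRep_apply {I : Type*} (u v : F) (i : I) (b : F × I →₀ k) :
    freeRep k F I u b (v, i) = b (u⁻¹ * v, i) := by
  induction b using Finsupp.induction_linear with
  | zero => simp
  | add b b' h h' => simp [h, h']
  | single x c =>
    obtain ⟨w, j⟩ := x
    classical
    simp only [freeRep_single, Finsupp.single_apply, Prod.mk.injEq, eq_inv_mul_iff_mul_eq]

theorem freeMap_freeRep {I : Type*} (ρ : F →* Module.End k M) (n : I → M) (u : F)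
    (b : F × I →₀ k) : freeMap ρ n (freeRep k F I u b) = ρ u (freeMap ρ n b) := by
  induction b using Finsupp.induction_linear with
  | zero => simp
  | add b b' h h' => simp [h, h']
  | single x c =>
    obtain ⟨w, j⟩ := x
    simp

/-- The permutation representation on the free module on an `F`-set. -/
noncomputable abbrev setRep (k F V : Type*) [Field k] [Group F] [MulAction F V] :
    F →* Module.End k (V →₀ k) :=
  permRep k MulAction.toEndHom

@[simp] theorem setRep_single {V : Type*} [MulAction F V] (u : F) (p : V) (c : k) :
    setRep k F V u (Finsupp.single p c) = Finsupp.single (u • p) c :=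
  permRep_single _ _ _ _

theorem setRep_apply {V : Type*} [MulAction F V] (u : F) (p : V) (f : V →₀ k) :
    setRep k F V u f p = f (u⁻¹ • p) := by
  induction f using Finsupp.induction_linear with
  | zero => simp
  | add b b' h h' => simp [h, h']
  | single x c =>
    classical
    simp only [setRep_single, Finsupp.single_apply, eq_inv_smul_iff]

end FreeDerivations

/-- An embedding of an `F`-set in a free module over the group algebra that is equivariant up to
translations and compatible with the standard map to the relative augmentation module. -/
structure TranslationEmbedding (k F I : Type*) {V : Type*} [Field k] [Group F] [MulAction F V]
    (p₁ : V) where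
  toFun : V → (F × I →₀ k)
  shift : F → (F × I →₀ k)
  retract : (F × I →₀ k) →ₗ[k] (V →₀ k)
  map_smul : ∀ (u : F) p, toFun (u • p) = shift u + freeRep k F I u (toFun p)
  shift_mul : ∀ u u', shift (u * u') = shift u + freeRep k F I u (shift u')
  retract_freeRep : ∀ u b, retract (freeRep k F I u b) = setRep k F V u (retract b)
  sum_retract : ∀ b, Finsupp.linearCombination k (fun _ : V => (1 : k)) (retract b) = 0
  retract_toFun : ∀ p, retract (toFun p) = Finsupp.single p 1 - Finsupp.single p₁ 1

section Resolution

variable {k : Type} [Field k] [Finite k] {X V : Type} [MulAction (FreeGroup X) V]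

/-- If a finite system of linear equations is solvable in all finite modules, then its
coefficients are fixed by some endomorphism with values in a given submodule containing them. -/
theorem exists_equivariant_projection {I Y : Type} [Finite I] [Finite Y]
    (a : Y → (FreeGroup X × I →₀ k))
    (h : ∀ (M : Type) [AddCommGroup M] [Module k M] [Finite M]
      (ρ : FreeGroup X →* Module.End k M) (m : Y → M), ∃ n : I → M, ∀ y, freeMap ρ n (a y) = m y)
    (N : Submodule k (FreeGroup X × I →₀ k))
    (hN : ∀ u, ∀ b ∈ N, freeRep k (FreeGroup X) I u b ∈ N) (ha : ∀ y, a y ∈ N) :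
    ∃ Φ : (FreeGroup X × I →₀ k) →ₗ[k] (FreeGroup X × I →₀ k),
      (∀ u b, Φ (freeRep k (FreeGroup X) I u b) = freeRep k (FreeGroup X) I u (Φ b)) ∧
      (∀ b, Φ b ∈ N) ∧ ∀ y, Φ (a y) = a y := by
  let ρ : FreeGroup X →* Module.End k N :=
    { toFun := fun u => (freeRep k (FreeGroup X) I u).restrict (hN u)
      map_one' := LinearMap.ext fun b => Subtype.ext <| by
        change freeRep k (FreeGroup X) I 1 b = b
        rw [map_one]
        rfl
      map_mul' := fun u v => LinearMap.ext fun b => Subtype.ext <| by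
        change freeRep k (FreeGroup X) I (u * v) b = _
        rw [map_mul]
        rfl }
  obtain ⟨n, hn⟩ := exists_freeMap_eq (M := N) a h ρ fun y => ⟨a y, ha y⟩
  have hρ : ∀ u m, N.subtype (ρ u m) = freeRep k (FreeGroup X) I u (N.subtype m) := fun _ _ => rfl
  clear_value ρ
  have hΦs := freeMap_comp (M := N) ρ (freeRep k (FreeGroup X) I) N.subtype hρ n
  refine ⟨freeMap (freeRep k (FreeGroup X) I) fun i => N.subtype (n i),
    freeMap_freeRep _ _, fun b => ?_, fun y => ?_⟩
  · rw [hΦs]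
    exact (freeMap ρ n b).2
  · rw [hΦs, hn]
    rfl

/-- If derivations on the point stabilizers with values in finite modules extend, then the points
embed equivariantly, up to translations, in a free module. -/
theorem exists_translation_embedding [Finite X] (r : V → V)
    (hr : ∀ (u : FreeGroup X) p, r (u • p) = r p)
    (hr' : ∀ p, ∃ u : FreeGroup X, u • r p = p) (hfin : {p | r p = p}.Finite)
    (hfg : ∀ p : V, Group.FG (MulAction.stabilizer (FreeGroup X) p)) (p₁ : V)
    (hS : ∀ (M : Type) [AddCommGroup M] [Finite M] (ρ : FreeGroup X →* AddMonoid.End M)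
      (δ : V → FreeGroup X → M),
      (∀ p y y', y • p = p → y' • p = p → δ p (y * y') = δ p y + ρ y (δ p y')) →
      ∃ (D : FreeGroup X → M) (μ : V → M), (∀ u u', D (u * u') = D u + ρ u (D u')) ∧
        ∀ p, r p = p → ∀ y, y • p = p → δ p y = D y + ρ y (μ p) - μ p) :
    ∃ I : Type, Finite I ∧ Nonempty (TranslationEmbedding k (FreeGroup X) I p₁) := by
  classical
  let F := FreeGroup X
  let J := {p : V // r p = p}
  have : Finite J := hfin
  let Y := Σ p : J, IsFreeGroup.Generators (MulAction.stabilizer (FreeGroup X) (p : V))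
  have : ∀ p : J, Finite (IsFreeGroup.Generators (MulAction.stabilizer (FreeGroup X) (p : V))) :=
    fun p => IsFreeGroup.finite_generators _ (hfg p)
  let I := X ⊕ J
  let B := FreeGroup X × I →₀ k
  let L : FreeGroup X →* Module.End k B := freeRep k (FreeGroup X) I
  have hL : ∀ u v i c, L u (Finsupp.single (v, i) c) = Finsupp.single (u * v, i) c :=
    freeRep_single
  have Lmul : ∀ u v b, L (u * v) b = L u (L v b) := fun u v b => by rw [map_mul]; rfl
  let bX := FreeGroupBasis.ofFreeGroup X
  let bS : ∀ p : J, FreeGroupBasis _ (MulAction.stabilizer (FreeGroup X) (p : V)) :=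
    fun p => IsFreeGroup.basis _
  obtain ⟨d, hd, hdX⟩ := bX.exists_derivation L fun x => Finsupp.single (1, Sum.inl x) 1
  let e : J → B := fun p => Finsupp.single (1, Sum.inr p) 1
  let c : J → FreeGroup X → B := fun p u => d u + L u (e p) - e p
  have hc : ∀ p u v, c p (u * v) = c p u + L u (c p v) := fun p u v => by
    simp only [c, hd, Lmul, map_add, map_sub]
    abel
  have hmap : ∀ {M : Type} [AddCommGroup M] [Module k M] (ρ : FreeGroup X →* Module.End k M)
      (D : FreeGroup X → M) (μ : J → M), (∀ u u', D (u * u') = D u + ρ u (D u')) → ∀ u,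
      freeMap ρ (Sum.elim (fun x => D (FreeGroup.of x)) μ) (d u) = D u := by
    intro M _ _ ρ D μ hD u
    refine bX.derivation_ext ρ
      (D := fun u => freeMap ρ (Sum.elim (fun x => D (FreeGroup.of x)) μ) (d u))
      (fun u v => ?_) hD (fun x => ?_) u
    · change freeMap ρ _ (d (u * v)) = freeMap ρ _ (d u) + ρ u (freeMap ρ _ (d v))
      rw [hd, map_add, freeMap_freeRep]
    · change freeMap ρ _ (d (bX x)) = _
      rw [hdX]
      simp [bX]
  let a : Y → B := fun y => c y.1 (bS y.1 y.2 : MulAction.stabilizer (FreeGroup X) (y.1 : V))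
  have hsolve : ∀ (M : Type) [AddCommGroup M] [Module k M] [Finite M]
      (ρ : FreeGroup X →* Module.End k M) (m : Y → M), ∃ n : I → M,
      ∀ y, freeMap ρ n (a y) = m y := by
    intro M _ _ _ ρ m
    have hδ := fun p : J => (bS p).exists_derivation
      (ρ.comp (MulAction.stabilizer (FreeGroup X) (p : V)).subtype) fun y => m ⟨p, y⟩
    choose δ hδ hδm using hδ
    obtain ⟨D, μ, hD, hDμ⟩ := hS M ((linearToAddEnd k M).comp ρ)
      (fun p u => if h : r p = p ∧ u • p = p then δ ⟨p, h.1⟩ ⟨u, h.2⟩ else 0)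
      (fun p y y' hy hy' => by
        have hyy : (y * y') • p = p := by rw [mul_smul, hy', hy]
        by_cases h : r p = p
        · simp only [h, hy, hy', hyy, and_self, dif_pos]
          exact hδ ⟨p, h⟩ ⟨y, hy⟩ ⟨y', hy'⟩
        · simp [h])
    refine ⟨Sum.elim (fun x => D (FreeGroup.of x)) fun p => μ p, fun ⟨p, y⟩ => ?_⟩
    have h1 := hDμ p p.2 (bS p y : MulAction.stabilizer (FreeGroup X) (p : V)) (bS p y).2
    rw [dif_pos ⟨p.2, (bS p y).2⟩] at h1
    refine Eq.trans ?_ (h1.symm.trans (hδm p y))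
    change freeMap ρ _ (d _ + L _ (e p) - e p) = _
    rw [map_sub, map_add, hmap ρ D _ hD, freeMap_freeRep]
    simp [e]
  let P : FreeGroup X →* Module.End k (V →₀ k) := setRep k (FreeGroup X) V
  have Pmul : ∀ u v b, P (u * v) b = P u (P v b) := fun u v b => by rw [map_mul]; rfl
  let D₁ : FreeGroup X → (V →₀ k) := fun u => Finsupp.single (u • p₁) 1 - Finsupp.single p₁ 1
  have hD₁ : ∀ u u', D₁ (u * u') = D₁ u + P u (D₁ u') := fun u u' => by
    simp only [D₁, map_sub, P, setRep_single, mul_smul]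
    abel
  let nT : I → (V →₀ k) := Sum.elim (fun x => D₁ (FreeGroup.of x))
    fun p => Finsupp.single (p : V) 1 - Finsupp.single p₁ 1
  let T : B →ₗ[k] (V →₀ k) := freeMap P nT
  have hT : ∀ u b, T (L u b) = P u (T b) := freeMap_freeRep P nT
  have hTd : ∀ u, T (d u) = D₁ u := hmap P D₁ _ hD₁
  have hTe : ∀ p : J, T (e p) = Finsupp.single (p : V) 1 - Finsupp.single p₁ 1 := fun p => by
    change freeMap P nT (Finsupp.single (1, Sum.inr p) 1) = _
    rw [freeMap_single, map_one, one_smul]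
    rfl
  have hTue : ∀ (u : FreeGroup X) (p : J), T (d u + L u (e p)) =
      Finsupp.single (u • (p : V)) 1 - Finsupp.single p₁ 1 := fun u p => by
    rw [map_add, hT, hTe, hTd, map_sub]
    simp only [P, setRep_single, D₁]
    abel
  have hTa : ∀ y, T (a y) = 0 := fun y => by
    change T (d _ + L _ (e y.1) - e y.1) = 0
    rw [map_sub, hTue, hTe, (bS y.1 y.2).2, sub_self]
  have hLker : ∀ u, ∀ b ∈ LinearMap.ker T, L u b ∈ LinearMap.ker T := fun u b hb => by
    rw [LinearMap.mem_ker] at hb ⊢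
    rw [hT, hb, map_zero]
  obtain ⟨Φ, hΦ, hTΦ', hΦa⟩ := exists_equivariant_projection a hsolve (LinearMap.ker T) hLker hTa
  have hTΦ : ∀ b, T (Φ b) = 0 := hTΦ'
  have hfix : ∀ (p : J) (u : FreeGroup X), u • (p : V) = p → Φ (c p u) = c p u := fun p u hu =>
    (bS p).derivation_ext (L.comp (MulAction.stabilizer (FreeGroup X) (p : V)).subtype)
      (D := fun u => Φ (c p u)) (D' := fun u => c p u)
      (fun u v => by
        change Φ (c p (u * v)) = _
        rw [hc, map_add, hΦ]
        rfl)
      (fun u v => hc p u v) (fun y => hΦa ⟨p, y⟩) ⟨u, hu⟩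
  let Ψ : B →ₗ[k] B := LinearMap.id - Φ
  have hΨ : ∀ u b, Ψ (L u b) = L u (Ψ b) := fun u b => by
    change L u b - Φ (L u b) = L u (b - Φ b)
    rw [map_sub]
    exact congrArg _ (hΦ u b)
  have hrr : ∀ p, r (r p) = r p := fun p => by
    obtain ⟨u, hu⟩ := hr' p
    conv_rhs => rw [← hu, hr]
  let j : V → J := fun p => ⟨r p, hrr p⟩
  choose w hw using hr'
  let σ : V → B := fun p => Ψ (d (w p) + L (w p) (e (j p)))
  have hσ : ∀ p (u : FreeGroup X), u • r p = p → Ψ (d u + L u (e (j p))) = σ p := by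
    intro p u hu
    set f := (w p)⁻¹ * u with hf
    have hfs : f • ((j p : J) : V) = j p := by
      change f • r p = r p
      rw [hf, mul_smul, hu, inv_smul_eq_iff, hw]
    have hu' : u = w p * f := by rw [hf, mul_inv_cancel_left]
    have : d u + L u (e (j p)) = d (w p) + L (w p) (e (j p)) + L (w p) (c (j p) f) := by
      rw [hu', hd, Lmul]
      simp only [c, map_add, map_sub]
      abel
    have h0 : Ψ (c (j p) f) = 0 := by simp [Ψ, hfix (j p) f hfs]
    rw [this, map_add Ψ, hΨ, h0, map_zero, add_zero]
  refine ⟨I, inferInstance, ⟨⟨σ, fun u => Ψ (d u), T, fun u p => ?_, fun u v => ?_, hT, fun b => ?_,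
    fun p => ?_⟩⟩⟩
  · have hj : j (u • p) = j p := Subtype.ext (hr u p)
    rw [← hσ (u • p) (u * w p) (by rw [hr, mul_smul, hw]), hj, hd, Lmul, add_assoc, map_add Ψ,
      ← map_add (L u), hΨ]
  · change Ψ (d (u * v)) = Ψ (d u) + L u (Ψ (d v))
    rw [hd, map_add, hΨ]
  · induction b using Finsupp.induction_linear with
    | zero => simp
    | add b b' h h' => simp [h, h']
    | single x c =>
      obtain ⟨u, x | p⟩ := x <;>
        simp [T, nT, D₁, P]
  · change T (d _ + L _ (e (j p)) - Φ _) = _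
    rw [map_sub, hTΦ, sub_zero, hTue]
    change Finsupp.single (w p • r p) 1 - _ = _
    rw [hw]

end Resolution

namespace TranslationEmbedding

variable {k F I V : Type*} [Field k] [Group F] [MulAction F V] {p₁ : V}
  (S : TranslationEmbedding k F I p₁)

theorem injective : Function.Injective S.toFun := fun p q h => by
  have := S.retract_toFun p
  rw [h, S.retract_toFun q, sub_left_inj] at this
  exact (Finsupp.single_left_injective one_ne_zero this).symm

theorem toFun_smul_apply (u v : F) (i : I) (p : V) :
    S.toFun (u • p) (v, i) = S.shift u (v, i) + S.toFun p (u⁻¹ * v, i) := by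
  rw [S.map_smul, Finsupp.add_apply, freeRep_apply]

theorem finite_cut (i : I) (p q : V) :
    {u : F | S.toFun (u • p) (1, i) ≠ S.toFun (u • q) (1, i)}.Finite := by
  refine (((S.toFun p - S.toFun q).support.finite_toSet).preimage
    (f := fun u : F => (u⁻¹, i)) ?_).subset fun u hu => ?_
  · intro u _ v _ h
    simpa using h
  · simp only [Set.mem_ofPred_eq, toFun_smul_apply, mul_one, ne_eq, add_right_inj] at hu
    simpa [sub_eq_zero] using hu

theorem exists_separating {p q : V} (h : p ≠ q) :
    ∃ (u : F) (i : I), S.toFun (u • p) (1, i) ≠ S.toFun (u • q) (1, i) := by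
  by_contra! hall
  refine h (S.injective (Finsupp.ext fun ⟨w, i⟩ => ?_))
  have := hall w⁻¹ i
  simpa [toFun_smul_apply] using this

theorem eventually_const {α : Type*} (s : ℕ → α) (h : {n | s (n + 1) ≠ s n}.Finite) :
    ∃ (a : α) (N : ℕ), ∀ n ≥ N, s n = a := by
  obtain ⟨N, hN⟩ := h.bddAbove
  refine ⟨s (N + 1), N + 1, fun n hn => ?_⟩
  induction n, hn using Nat.le_induction with
  | base => rfl
  | succ n hn ih =>
    by_contra hne
    have := hN (show s (n + 1) ≠ s n by rwa [ih])
    omega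

theorem toFun_pow_succ_sub (ζ : F) (n : ℕ) (p : V) (w : F) (i : I) :
    S.toFun (ζ ^ (n + 1) • p) (w, i) - S.toFun (ζ ^ n • p) (w, i) =
      (S.toFun (ζ • p) - S.toFun p) ((ζ ^ n)⁻¹ * w, i) := by
  rw [pow_succ, mul_smul, S.toFun_smul_apply _ w i (ζ • p), S.toFun_smul_apply _ w i p,
    Finsupp.sub_apply]
  abel

theorem eventually_const_pow {ζ : F} (hζ : ¬IsOfFinOrder ζ) (p : V) (x : F × I) :
    ∃ (a : k) (N : ℕ), ∀ n ≥ N, S.toFun (ζ ^ n • p) x = a := by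
  obtain ⟨w, i⟩ := x
  refine eventually_const _ ((((S.toFun (ζ • p) - S.toFun p).support.finite_toSet).preimage
    (f := fun n : ℕ => ((ζ ^ n)⁻¹ * w, i)) ?_).subset fun n hn => ?_)
  · intro n _ m _ h
    simp only [Prod.mk.injEq, mul_left_inj, inv_inj, and_true] at h
    exact injective_pow_iff_not_isOfFinOrder.2 hζ h
  · have := sub_ne_zero.2 hn
    rw [toFun_pow_succ_sub] at this
    simpa using this

theorem finite_between {ζ : F} (hζ : ¬IsOfFinOrder ζ) {C : Set F} (hC : C.Finite) :
    {w : F | (∃ n : ℕ, (ζ ^ n)⁻¹ * w ∈ C) ∧ ∃ m : ℕ, ζ ^ m * w ∈ C}.Finite := by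
  have hN : ∀ v v' : F, {N : ℕ | ζ ^ N * v = v'}.Finite := fun v v' =>
    Set.Subsingleton.finite fun N hN M hM =>
      injective_pow_iff_not_isOfFinOrder.2 hζ (mul_right_cancel (hN.trans hM.symm))
  refine (hC.biUnion fun v _ => hC.biUnion fun v' _ => (hN v v').biUnion fun N _ =>
    (Set.finite_Iic N).image fun n => ζ ^ n * v).subset ?_
  rintro w ⟨⟨n, hn⟩, m, hm⟩
  refine Set.mem_biUnion hn (Set.mem_biUnion hm (Set.mem_biUnion (x := m + n) ?_
    ⟨n, Nat.le_add_left n m, ?_⟩))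
  · simp [pow_add, mul_assoc]
  · simp

/-- An element without periodic points moves points from one side of some cut to the other. -/
theorem exists_ends {ζ : F} (hζ : ∀ n : ℕ, 0 < n → ∀ p : V, ζ ^ n • p ≠ p) :
    ∃ (u : F) (i : I) (p : V) (a a' : k), a ≠ a' ∧
      (∃ N, ∀ n ≥ N, S.toFun ((u * ζ ^ n) • p) (1, i) = a) ∧
      ∃ N, ∀ n ≥ N, S.toFun ((u * ζ⁻¹ ^ n) • p) (1, i) = a' := by
  have hord : ¬IsOfFinOrder ζ := fun h => by
    obtain ⟨n, hn, h1⟩ := isOfFinOrder_iff_pow_eq_one.1 h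
    exact hζ n hn p₁ (by rw [h1, one_smul])
  choose a N ha using S.eventually_const_pow hord p₁
  choose a' N' ha' using S.eventually_const_pow (fun h => hord (isOfFinOrder_inv_iff.1 h)) p₁
  by_cases hne : ∃ x, a x ≠ a' x
  · obtain ⟨⟨w, i⟩, hx⟩ := hne
    refine ⟨w⁻¹, i, p₁, S.shift w⁻¹ (1, i) + a (w, i), S.shift w⁻¹ (1, i) + a' (w, i),
      fun h => hx (add_left_cancel h), ⟨N (w, i), fun n hn => ?_⟩, N' (w, i), fun n hn => ?_⟩
    · rw [mul_smul, toFun_smul_apply, inv_inv, mul_one, ha _ _ hn]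
    · rw [mul_smul, toFun_smul_apply, inv_inv, mul_one, ha' _ _ hn]
  · push Not at hne
    exfalso
    let c : F → F × I →₀ k := fun ξ => S.toFun (ξ • p₁) - S.toFun p₁
    have hconst : ∀ (s : ℕ → k) (N : ℕ), s N ≠ s 0 → ∃ n, s (n + 1) ≠ s n := fun s N h => by
      by_contra! hall
      refine h ?_
      clear h
      induction N with
      | zero => rfl
      | succ N ih => rw [hall, ih]
    have hfin : {x | a x ≠ S.toFun p₁ x}.Finite := by
      have hC := fun ξ => (c ξ).support.finite_toSet.image Prod.fst
      have hI := (c ζ).support.finite_toSet.image Prod.snd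
      refine ((finite_between hord ((hC ζ).union (hC ζ⁻¹))).prod hI).subset ?_
      rintro ⟨w, i⟩ hx
      have hmem : ∀ (ξ : F) (n : ℕ),
          S.toFun (ξ ^ (n + 1) • p₁) (w, i) ≠ S.toFun (ξ ^ n • p₁) (w, i) →
          ((ξ ^ n)⁻¹ * w, i) ∈ (c ξ).support := fun ξ n h => by
        rw [Finsupp.mem_support_iff, ← toFun_pow_succ_sub]
        exact sub_ne_zero.2 h
      obtain ⟨n, hn⟩ := hconst (fun n => S.toFun (ζ ^ n • p₁) (w, i)) (N (w, i)) (by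
        rw [ha _ _ le_rfl, pow_zero, one_smul]
        exact hx)
      obtain ⟨m, hm⟩ := hconst (fun n => S.toFun (ζ⁻¹ ^ n • p₁) (w, i)) (N' (w, i)) (by
        rw [ha' _ _ le_rfl, pow_zero, one_smul, ← hne]
        exact hx)
      refine ⟨⟨⟨n, Or.inl ⟨_, hmem ζ n hn, rfl⟩⟩, m, Or.inr ⟨_, hmem ζ⁻¹ m hm, ?_⟩⟩,
        _, hmem ζ n hn, rfl⟩
      simp
    let b : F × I →₀ k := Finsupp.ofSupportFinite (fun x => a x - S.toFun p₁ x)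
      (hfin.subset fun x hx => sub_ne_zero.1 hx)
    have hb : ∀ x, b x = a x - S.toFun p₁ x := fun _ => rfl
    have hinv : freeRep k F I ζ b + S.toFun (ζ • p₁) = b + S.toFun p₁ := by
      ext ⟨w, i⟩
      rw [Finsupp.add_apply, Finsupp.add_apply, freeRep_apply, hb, hb, sub_add_cancel,
        toFun_smul_apply]
      have h1 : a (w, i) = S.shift ζ (w, i) + a (ζ⁻¹ * w, i) := by
        set n := max (N (w, i)) (N (ζ⁻¹ * w, i))
        rw [← ha (w, i) (n + 1) (by omega), ← ha (ζ⁻¹ * w, i) n (by omega), pow_succ', mul_smul,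
          toFun_smul_apply]
      rw [h1]
      abel
    let f : V →₀ k := S.retract b + Finsupp.single p₁ 1
    have hf : setRep k F V ζ f = f := by
      have := congrArg S.retract hinv
      rw [map_add, map_add, S.retract_freeRep, S.retract_toFun, S.retract_toFun] at this
      simp only [f, map_add, setRep_single]
      rw [← sub_left_inj (a := Finsupp.single p₁ (1 : k)), add_sub_assoc, this]
      abel
    have hf0 : f ≠ 0 := fun h => by
      have := congrArg (Finsupp.linearCombination k (fun _ : V => (1 : k))) h
      simp [f, S.sum_retract] at this
    obtain ⟨q, hq⟩ := Finsupp.support_nonempty_iff.2 hf0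
    have hpow : ∀ n : ℕ, ζ ^ n • q ∈ f.support := fun n => by
      induction n with
      | zero => simpa using hq
      | succ n ih =>
        rw [Finsupp.mem_support_iff, ← hf, setRep_apply, pow_succ', mul_smul, inv_smul_smul]
        exact Finsupp.mem_support_iff.1 ih
    obtain ⟨n, m, hnm, he⟩ := Finite.exists_ne_map_eq_of_infinite
      (fun n : ℕ => (⟨ζ ^ n • q, hpow n⟩ : f.support))
    have he' : ζ ^ n • q = ζ ^ m • q := congrArg Subtype.val he
    wlog hlt : n < m generalizing n m
    · exact this m n hnm.symm he.symm he'.symm (by omega)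
    refine hζ (m - n) (by omega) (ζ ^ n • q) ?_
    rw [← mul_smul, ← pow_add, Nat.sub_add_cancel hlt.le, he']

theorem mapDomain_freeRep {Q : Type*} [Group Q] (α : F →* Q) (u : F) (b : F × I →₀ k) :
    (freeRep k F I u b).mapDomain (Prod.map α id) =
      freeRep k Q I (α u) (b.mapDomain (Prod.map α id)) := by
  induction b using Finsupp.induction_linear with
  | zero => simp
  | add b b' h h' => simp [Finsupp.mapDomain_add, h, h']
  | single x c =>
    obtain ⟨w, i⟩ := x
    simp [Finsupp.mapDomain_single]

theorem exists_finite_quotient_ne {Q : Type*} [Group Q] [Finite Q] [Finite k] [Finite I]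
    (α : F →* Q) {p q : V} (h : p ≠ q)
    (hα : Set.InjOn α (Prod.fst '' ((S.toFun p - S.toFun q).support : Set (F × I)))) :
    ∃ N : Subgroup F, N.FiniteIndex ∧ ∀ u ∈ N, u • p ≠ q := by
  let act : Q →* AddMonoid.End (Q × I →₀ k) := (linearToAddEnd k _).comp (freeRep k Q I)
  have : Finite (Q × I →₀ k) := Finite.of_injective _ DFunLike.coe_injective
  let χ : F →* SplitExtension act := SplitExtension.ofDerivation α
    (fun u => (S.shift u).mapDomain (Prod.map α id)) fun u v => by
      rw [S.shift_mul, Finsupp.mapDomain_add, mapDomain_freeRep]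
      rfl
  refine ⟨χ.ker, Subgroup.finiteIndex_ker χ, fun u hu hup => ?_⟩
  have h1 : (S.shift u).mapDomain (Prod.map α id) = 0 :=
    congrArg SplitExtension.vec (MonoidHom.mem_ker.1 hu)
  have h2 : α u = 1 := congrArg SplitExtension.elt (MonoidHom.mem_ker.1 hu)
  have h3 : (S.toFun q).mapDomain (Prod.map α id) = (S.toFun p).mapDomain (Prod.map α id) := by
    rw [← hup, S.map_smul, Finsupp.mapDomain_add, h1, mapDomain_freeRep, h2, map_one, zero_add]
    rfl
  have h4 : (S.toFun p - S.toFun q).mapDomain (Prod.map α id) = 0 := by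
    have := map_sub (Finsupp.mapDomain.addMonoidHom (M := k) (Prod.map α (id : I → I)))
      (S.toFun p) (S.toFun q)
    simp only [Finsupp.mapDomain.addMonoidHom_apply] at this
    rw [this, h3, sub_self]
  have hinj : Set.InjOn (Prod.map α (id : I → I)) ((S.toFun p - S.toFun q).support : Set (F × I)) :=
    fun x hx y hy hxy => Prod.ext
      (hα ⟨x, hx, rfl⟩ ⟨y, hy, rfl⟩ (congrArg Prod.fst hxy)) (congrArg Prod.snd hxy :)
  have h5 := Finsupp.mapDomain_injOn _ hinj (x₁ := S.toFun p - S.toFun q) (x₂ := 0)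
    (Set.Subset.refl _) (by simp) (by rw [h4, Finsupp.mapDomain_zero])
  exact h (S.injective (sub_eq_zero.1 h5))

end TranslationEmbedding

/-- Free groups are residually finite. -/
theorem exists_finite_quotient_injOn {X : Type} {C : Set (FreeGroup X)} (hC : C.Finite) :
    ∃ (Q : Type) (_ : Group Q) (_ : Finite Q) (α : FreeGroup X →* Q), Set.InjOn α C := by
  obtain ⟨W, _, α, hW, hα⟩ := exists_finiteDimensional_representation (k := ZMod 2)
    (permRep (ZMod 2) (MulAction.toEndHom (α := FreeGroup X)))
    (Set.finite_singleton (Finsupp.single (1 : FreeGroup X) (1 : ZMod 2))) hC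
  have : Finite W := Module.finite_of_finite (ZMod 2)
  refine ⟨W ≃ₗ[ZMod 2] W, inferInstance, Finite.of_injective _ DFunLike.coe_injective, α,
    fun u hu v hv huv => ?_⟩
  have h1 := (hα _ rfl u hu).symm.trans
    ((congrArg (fun f : W ≃ₗ[ZMod 2] W => (f _ : FreeGroup X →₀ ZMod 2)) huv).trans (hα _ rfl v hv))
  rw [permRep_single, permRep_single] at h1
  have h2 : u * 1 = v * 1 := Finsupp.single_left_injective one_ne_zero h1
  simpa using h2

/-! ### Cuts in a graph with a free action on the edges -/

section FreeEdges

variable {G V ε : Type*} [Group G] [MulAction G V] [MulAction G ε] {a b : ε → V}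

theorem finite_setOf_separates (hc : ConnectedBy a b Set.univ)
    (ha : ∀ (g : G) e, a (g • e) = g • a e)
    (hb : ∀ (g : G) e, b (g • e) = g • b e) (hfree : ∀ (g : G) (e : ε), g • e = e → g = 1)
    {A : Set V} (hA : (bdry a b A).Finite) (p q : V) :
    {g : G | ¬(g • p ∈ A ↔ g • q ∈ A)}.Finite := by
  let C : Set V := {q | {g : G | ¬(g • p ∈ A ↔ g • q ∈ A)}.Finite}
  have hedge : ∀ e, {g : G | ¬(g • a e ∈ A ↔ g • b e ∈ A)}.Finite := fun e => by
    refine (hA.preimage (f := fun g : G => g • e) fun g _ h _ hgh => ?_).subset fun g hg => ?_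
    · have : h⁻¹ * g = 1 := hfree _ e (by rw [mul_smul, inv_smul_eq_iff]; exact hgh)
      exact (inv_mul_eq_one.1 this).symm
    · change ¬(a (g • e) ∈ A ↔ b (g • e) ∈ A)
      rwa [ha, hb]
  have hC : bdry a b C = ∅ := by
    ext e
    simp only [bdry, Set.mem_ofPred_eq, Set.mem_empty_iff_false, iff_false, not_not]
    have htrans : ∀ q q' : V, {g : G | ¬(g • q ∈ A ↔ g • q' ∈ A)}.Finite → q ∈ C → q' ∈ C :=
      fun q q' h hq => (hq.union h).subset fun g hg => by
        simp only [Set.mem_union, Set.mem_ofPred_eq] at hg ⊢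
        tauto
    refine ⟨htrans _ _ (hedge e), htrans _ _ ((hedge e).subset fun g hg => ?_)⟩
    simp only [Set.mem_ofPred_eq] at hg ⊢
    tauto
  have hp : p ∈ C := by simp [C]
  rcases hc C (by rw [hC, Set.empty_inter]) with h | h
  · rw [h] at hp
    exact hp.elim
  · have : q ∈ C := h ▸ Set.mem_univ q
    exact this

theorem finite_stabilizer_of_bdry (ha : ∀ (g : G) e, a (g • e) = g • a e)
    (hb : ∀ (g : G) e, b (g • e) = g • b e) (hfree : ∀ (g : G) (e : ε), g • e = e → g = 1)
    {A : Set V} (hA : (bdry a b A).Finite) (hne : (bdry a b A).Nonempty) :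
    Finite (MulAction.stabilizer G A) := by
  obtain ⟨e, he⟩ := hne
  have := hA.to_subtype
  refine Finite.of_injective
    (fun g : MulAction.stabilizer G A => (⟨(g : G) • e, ?_⟩ : bdry a b A)) fun g h hgh => ?_
  · have h1 : (g : G) • bdry a b A = bdry a b A := by rw [← bdry_smul ha hb, g.2]
    exact h1 ▸ Set.smul_mem_smul_set he
  · have h1 : (g : G) • e = (h : G) • e := congrArg Subtype.val hgh
    have : (h : G)⁻¹ * g = 1 := hfree _ e (by rw [mul_smul, inv_smul_eq_iff, h1])
    exact Subtype.ext (inv_mul_eq_one.1 this).symm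

end FreeEdges

/-! ### Coset graphs -/

section CosetGraph

variable {G : Type*} [Group G]

/-- The edges of the graph on the cosets of a subgroup given by right multiplication with the
elements of `S`. -/
@[ext]
structure CosetEdge (S : Set G) where
  base : G
  dir : S

namespace CosetEdge

variable {S : Set G}

instance : MulAction G (CosetEdge S) where
  smul g e := ⟨g * e.base, e.dir⟩
  one_smul e := CosetEdge.ext (one_mul e.base) rfl
  mul_smul g h e := CosetEdge.ext (mul_assoc g h e.base) rfl

theorem eq_one_of_smul_eq (g : G) (e : CosetEdge S) (h : g • e = e) : g = 1 :=
  mul_eq_right.1 (congrArg base h)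

variable (H : Subgroup G)

/-- The first end point of an edge. -/
def source (e : CosetEdge S) : G ⧸ H := e.base

/-- The second end point of an edge. -/
def target (e : CosetEdge S) : G ⧸ H := (e.base * e.dir : G)

theorem source_smul (g : G) (e : CosetEdge S) : (g • e).source H = g • e.source H := rfl

theorem target_smul (g : G) (e : CosetEdge S) : (g • e).target H = g • e.target H :=
  congrArg QuotientGroup.mk (mul_assoc g e.base e.dir)

theorem connectedBy (hS : Subgroup.closure S = ⊤) :
    ConnectedBy (source (S := S) H) (target H) Set.univ := by
  intro A hA
  rw [Set.inter_univ] at hA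
  have hstep : ∀ s ∈ S, ∀ x : G, ((x : G) : G ⧸ H) ∈ A ↔ ((x * s : G) : G ⧸ H) ∈ A := by
    intro s hs x
    by_contra h
    have : (⟨x, s, hs⟩ : CosetEdge S) ∈ bdry (source H) (target H) A := h
    rw [hA] at this
    exact this
  have hall : ∀ g x : G, ((x : G) : G ⧸ H) ∈ A ↔ ((x * g : G) : G ⧸ H) ∈ A := by
    intro g
    have hg : g ∈ Subgroup.closure S := hS ▸ Subgroup.mem_top g
    induction hg using Subgroup.closure_induction with
    | mem s hs => exact hstep s hs
    | one => simp
    | mul g g' _ _ h h' =>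
      intro x
      rw [h x, h' (x * g), mul_assoc]
    | inv g _ h =>
      intro x
      rw [h (x * g⁻¹), inv_mul_cancel_right]
  rcases A.eq_empty_or_nonempty with h | ⟨p, hp⟩
  · exact Or.inl h
  · refine Or.inr (Set.eq_univ_of_forall fun q => ?_)
    obtain ⟨x, rfl⟩ := QuotientGroup.mk_surjective p
    obtain ⟨y, rfl⟩ := QuotientGroup.mk_surjective q
    rw [hall (x⁻¹ * y), mul_inv_cancel_left] at hp
    exact hp

theorem finite_bdry (hS : S.Finite) {A : Set (G ⧸ H)}
    (hA : ∀ p q : G ⧸ H, {g : G | ¬(g • p ∈ A ↔ g • q ∈ A)}.Finite) :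
    (bdry (source (S := S) H) (target H) A).Finite := by
  have := hS.to_subtype
  refine (Set.finite_iUnion fun s : S => (hA ((1 : G) : G ⧸ H) ((s : G) : G ⧸ H)).image
    fun g => (⟨g, s⟩ : CosetEdge S)).subset fun e he => ?_
  refine Set.mem_iUnion.2 ⟨e.dir, e.base, ?_, rfl⟩
  change ¬(((e.base * 1 : G) : G ⧸ H) ∈ A ↔ ((e.base * e.dir : G) : G ⧸ H) ∈ A)
  rw [mul_one]
  exact he

end CosetEdge

end CosetGraph

/-! ### Free subgroups of finite index -/

section VirtuallyFree

variable {G : Type} [Group G]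

theorem IsVirtuallyFree.exists_injective (hG : Group.FG G) (h : IsVirtuallyFree G) :
    ∃ (X : Type) (_ : Finite X) (i : FreeGroup X →* G),
      Function.Injective i ∧ i.range.FiniteIndex := by
  obtain ⟨F, hF, hfree⟩ := h
  refine ⟨IsFreeGroup.Generators F,
    IsFreeGroup.finite_generators F (Subgroup.fg_of_index_ne_zero F),
    F.subtype.comp (IsFreeGroup.toFreeGroup F).symm.toMonoidHom,
    F.subtype_injective.comp (IsFreeGroup.toFreeGroup F).symm.injective, ?_⟩
  have : (F.subtype.comp (IsFreeGroup.toFreeGroup F).symm.toMonoidHom).range = F := by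
    ext g
    constructor
    · rintro ⟨u, rfl⟩
      exact SetLike.coe_mem _
    · intro hg
      exact ⟨IsFreeGroup.toFreeGroup F ⟨g, hg⟩,
        congrArg Subtype.val ((IsFreeGroup.toFreeGroup F).symm_apply_apply ⟨g, hg⟩)⟩
  rwa [this]

theorem exists_finite_rightTransversal {F : Type*} [Group F] (i : F →* G) [i.range.FiniteIndex] :
    ∃ T : Set G, T.Finite ∧ ∀ g : G, ∃ (u : F), ∃ t ∈ T, g = i u * t := by
  refine ⟨Set.range fun q : G ⧸ i.range => q.out⁻¹, Set.finite_range _, fun g => ?_⟩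
  obtain ⟨⟨_, u, rfl⟩, hu⟩ := QuotientGroup.mk_out_eq_mul i.range g⁻¹
  refine ⟨u, _, ⟨(g⁻¹ : G), rfl⟩, ?_⟩
  beta_reduce
  rw [hu]
  simp

theorem not_isOfFinOrder_of_free {X : Type*} {i : FreeGroup X →* G} (hi : Function.Injective i)
    {u : FreeGroup X} (h : i u ≠ 1) : ¬IsOfFinOrder (i u) := fun hu => h <| by
  rw [hi.isOfFinOrder_iff, isOfFinOrder_iff_eq_one] at hu
  rw [hu, map_one]

theorem fg_stabilizer {H : Subgroup G} (hH : H.FG) {F : Type*} [Group F] [MulAction F (G ⧸ H)]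
    {i : F →* G} (hi : Function.Injective i) [i.range.FiniteIndex]
    (hact : ∀ u (p : G ⧸ H), u • p = i u • p) (p : G ⧸ H) :
    Group.FG (MulAction.stabilizer F p) := by
  let K := MulAction.stabilizer G p
  have hK : Group.FG K := by
    obtain ⟨g, rfl⟩ := QuotientGroup.mk_surjective p
    have h1 : K = H.map (MulAut.conj g).toMonoidHom := by
      conv_rhs => rw [← MulAction.stabilizer_quotient H]
      rw [← MulAction.stabilizer_smul_eq_stabilizer_map_conj]
      exact congrArg (MulAction.stabilizer G) (congrArg QuotientGroup.mk (mul_one g).symm)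
    rw [Group.fg_iff_subgroup_fg, h1, Subgroup.fg_iff_submonoid_fg]
    exact ((Subgroup.fg_iff_submonoid_fg H).1 hH).map (MulAut.conj g).toMonoidHom
  have : Group.FG (i.range.subgroupOf K) := Subgroup.fg_of_index_ne_zero _
  let e := MonoidHom.ofInjective hi
  have he : ∀ x : i.range, i (e.symm x) = x := fun x => congrArg Subtype.val (e.apply_symm_apply x)
  let φ : i.range.subgroupOf K →* MulAction.stabilizer F p := MonoidHom.mk'
    (fun x => ⟨e.symm ⟨x, x.2⟩, by
      change _ • p = p
      rw [hact, he]
      exact (x : K).2⟩) fun x y => Subtype.ext (map_mul e.symm ⟨x, x.2⟩ ⟨y, y.2⟩)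
  refine Group.fg_of_surjective (f := φ) fun u => ?_
  have hu : i u • p = p := (hact _ _).symm.trans u.2
  refine ⟨⟨⟨i u, hu⟩, ⟨u, rfl⟩⟩, Subtype.ext ?_⟩
  exact e.symm_apply_apply u

end VirtuallyFree

/-! ### Subgroups with constant extension counts -/

section Converse

variable {G : Type} [Group G] {H : Subgroup G}

theorem ExtensionCountsAgree.exists_translationEmbedding (hH : ExtensionCountsAgree H)
    (hG : Group.FG G) (hHfg : H.FG) {X : Type} [Finite X] [MulAction (FreeGroup X) (G ⧸ H)]
    {i : FreeGroup X →* G} (hi : Function.Injective i) [i.range.FiniteIndex]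
    (hact : ∀ u (p : G ⧸ H), u • p = i u • p) :
    ∃ I : Type, Finite I ∧
      Nonempty (TranslationEmbedding (ZMod 2) (FreeGroup X) I ((1 : G) : G ⧸ H)) := by
  obtain ⟨R⟩ := hH.exists_splittingOperator hG
  let r : G ⧸ H → G ⧸ H := fun p => (Quotient.mk (MulAction.orbitRel (FreeGroup X) (G ⧸ H)) p).out
  have hr : ∀ (u : FreeGroup X) p, r (u • p) = r p := fun u p => congrArg Quotient.out
    (Quotient.sound (s := MulAction.orbitRel (FreeGroup X) (G ⧸ H)) ⟨u, rfl⟩)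
  have hr' : ∀ p, ∃ u : FreeGroup X, u • r p = p := fun p => by
    have : MulAction.orbitRel (FreeGroup X) (G ⧸ H) (r p) p :=
      Quotient.mk_out (s := MulAction.orbitRel (FreeGroup X) (G ⧸ H)) p
    obtain ⟨k, hk⟩ := MulAction.orbitRel_apply.1
      ((MulAction.orbitRel (FreeGroup X) (G ⧸ H)).symm this)
    exact ⟨k, hk⟩
  refine exists_translation_embedding r hr hr' ?_ (fg_stabilizer hHfg hi hact) _ ?_
  · obtain ⟨T, hT, hTG⟩ := exists_finite_rightTransversal i
    refine (hT.image fun t : G => r ((t : G) : G ⧸ H)).subset fun p hp => ?_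
    obtain ⟨g, rfl⟩ := QuotientGroup.mk_surjective p
    obtain ⟨u, t, ht, rfl⟩ := hTG g
    refine ⟨t, ht, ?_⟩
    have h1 : ((i u * t : G) : G ⧸ H) = u • (t : G ⧸ H) := (hact u t).symm
    beta_reduce
    rw [← hr u t, ← h1]
    exact hp
  · intro M _ _ ρ δ hδ
    simp only [hact] at hr hr' hδ ⊢
    exact R.exists_derivation_of_stabilizer hH hG i hi r hr hr' ρ δ hδ

/-- A subgroup of a finitely generated virtually free group with constant extension counts is
closed in the profinite topology. -/
theorem exists_finiteIndexNormalSubgroup_of_notMem {X I : Type} [Finite I]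
    [MulAction (FreeGroup X) (G ⧸ H)] {i : FreeGroup X →* G} (hi : Function.Injective i)
    [i.range.FiniteIndex] (hact : ∀ u (p : G ⧸ H), u • p = i u • p)
    (S : TranslationEmbedding (ZMod 2) (FreeGroup X) I ((1 : G) : G ⧸ H)) {g : G} (hg : g ∉ H) :
    ∃ U : FiniteIndexNormalSubgroup G, ∀ h ∈ H, g⁻¹ * h ∉ U := by
  have hne : ((1 : G) : G ⧸ H) ≠ (g : G ⧸ H) := fun h => hg <| by
    simpa using QuotientGroup.eq.1 h
  obtain ⟨Q, _, _, α, hα⟩ := exists_finite_quotient_injOn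
    ((S.toFun ((1 : G) : G ⧸ H) - S.toFun (g : G ⧸ H)).support.finite_toSet.image Prod.fst)
  obtain ⟨N, hN, hNu⟩ := S.exists_finite_quotient_ne α hne hα
  have : (N.map i).FiniteIndex := ⟨by
    rw [Subgroup.index_map_of_injective N hi]
    exact mul_ne_zero hN.index_ne_zero Subgroup.FiniteIndex.index_ne_zero⟩
  refine ⟨FiniteIndexNormalSubgroup.ofSubgroup (N.map i).normalCore, fun h hh hU => ?_⟩
  have hU' : g⁻¹ * h ∈ (N.map i).normalCore := hU
  have h1 := (N.map i).normalCore_le ((N.map i).normalCore_normal.conj_mem _ hU' g)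
  obtain ⟨u, hu, hug⟩ := h1
  refine hNu u⁻¹ (inv_mem hu) ?_
  rw [hact, map_inv, hug]
  change (((g * (g⁻¹ * h) * g⁻¹)⁻¹ * 1 : G) : G ⧸ H) = g
  refine QuotientGroup.eq.2 ?_
  simpa [mul_assoc] using hh

theorem zmod_two_ne_iff (x y : ZMod 2) : x ≠ y ↔ ¬(x ≠ 0 ↔ y ≠ 0) := by
  revert x y
  decide

theorem ExtensionCountsAgree.isFreeFactor (hH : ExtensionCountsAgree H) (hG : Group.FG G)
    (hGvf : IsVirtuallyFree G) (hHfg : H.FG) : H.IsFreeFactor := by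
  obtain ⟨X, _, i, hi, _⟩ := hGvf.exists_injective hG
  obtain ⟨R⟩ := hH.exists_splittingOperator hG
  let _ : MulAction (FreeGroup X) (G ⧸ H) := MulAction.compHom _ i
  have hact : ∀ u (p : G ⧸ H), u • p = i u • p := fun _ _ => rfl
  obtain ⟨I, _, ⟨S⟩⟩ := hH.exists_translationEmbedding hG hHfg hi hact
  have hres : ∀ z : G, z ≠ 1 → IsOfFinOrder z → ∃ U : FiniteIndexNormalSubgroup G, z ∉ U := by
    intro z hz hfin
    refine ⟨FiniteIndexNormalSubgroup.ofSubgroup i.range.normalCore, fun hU => ?_⟩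
    obtain ⟨u, rfl⟩ := i.range.normalCore_le hU
    exact not_isOfFinOrder_of_free hi hz hfin
  have hclosed : ∀ g ∉ H, ∃ U : FiniteIndexNormalSubgroup G, ∀ h ∈ H, g⁻¹ * h ∉ U := fun g hg =>
    exists_finiteIndexNormalSubgroup_of_notMem hi hact S hg
  obtain ⟨D, hD, hDfin⟩ := (Subgroup.fg_iff ⊤).1 (Group.fg_def.1 hG)
  let a : CosetEdge D → G ⧸ H := CosetEdge.source H
  let b : CosetEdge D → G ⧸ H := CosetEdge.target H
  have ha : ∀ (g : G) e, a (g • e) = g • a e := CosetEdge.source_smul H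
  have hb : ∀ (g : G) e, b (g • e) = g • b e := CosetEdge.target_smul H
  have hc : ConnectedBy a b Set.univ := CosetEdge.connectedBy H hD
  have hfree : ∀ (g : G) (e : CosetEdge D), g • e = e → g = 1 := CosetEdge.eq_one_of_smul_eq
  let f : I → Set (G ⧸ H) := fun j => {p | S.toFun p (1, j) ≠ 0}
  have hf : ∀ j p q, ¬(p ∈ f j ↔ q ∈ f j) ↔ S.toFun p (1, j) ≠ S.toFun q (1, j) := fun j p q =>
    (zmod_two_ne_iff _ _).symm
  have hcut : ∀ j (p q : G ⧸ H), {g : G | ¬(g • p ∈ f j ↔ g • q ∈ f j)}.Finite := by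
    intro j p q
    obtain ⟨T, hT, hTG⟩ := exists_finite_rightTransversal i
    refine (hT.biUnion fun t _ => (S.finite_cut j (t • p) (t • q)).image fun u => i u * t).subset
      fun g hg => ?_
    obtain ⟨u, t, ht, rfl⟩ := hTG g
    refine Set.mem_biUnion ht ⟨u, ?_, rfl⟩
    have := (hf j _ _).1 hg
    rwa [mul_smul, mul_smul] at this
  have hbdry : ∀ j, (bdry a b (f j)).Finite := fun j => CosetEdge.finite_bdry H hDfin (hcut j)
  obtain ⟨n, hn⟩ := (Set.finite_range fun j => (bdry a b (f j)).ncard).bddAbove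
  obtain ⟨E, hE, hEfin, hEne, hEcut⟩ := exists_nestedFamily (G := G) hc ha hb n
  have hcut' : ∀ (s t : Ultrafilter (G ⧸ H)) j, ¬(f j ∈ s ↔ f j ∈ t) → ∃ B ∈ E, B ∈ s ∧ B ∉ t := by
    intro s t j hst
    by_cases h : f j ∈ s
    · exact hEcut s t _ (hbdry j) (hn ⟨j, rfl⟩) h fun h' => hst ⟨fun _ => h', fun _ => h⟩
    · refine hEcut s t (f j)ᶜ ?_ ?_ (Ultrafilter.compl_mem_iff_notMem.2 h) fun h' => ?_
      · rw [bdry_compl]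
        exact hbdry j
      · rw [bdry_compl]
        exact hn ⟨j, rfl⟩
      · rw [Ultrafilter.compl_mem_iff_notMem] at h'
        exact hst ⟨fun h'' => (h h'').elim, fun h'' => (h' h'').elim⟩
  have hsep : SeparatingSystem G E :=
    { hE with
      sep := ?_
      stab := fun A hA => finite_stabilizer_of_bdry ha hb hfree (hEfin A hA) (hEne A hA)
      fixed := fun K _ k hk hk1 p hp k' hk' =>
        R.fixed_of_finite hH hG hres hclosed K hk hk1 p hp hk'
      unique := fun z hz hfin p q => R.unique_of_isOfFinOrder hH hG hres hclosed hz hfin p q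
      ends := ?_ }
  · exact hsep.isFreeFactor
  · intro p q hpq
    obtain ⟨u, j, hu⟩ := S.exists_separating hpq
    obtain ⟨B, hB, hs, ht⟩ := hcut' (pure (u • q)) (pure (u • p)) j (by
      simp only [Ultrafilter.mem_pure]
      exact (hf j _ _).2 hu.symm)
    rw [Ultrafilter.mem_pure] at hs ht
    refine ⟨(i u)⁻¹ • B, hE.smul _ B hB, ?_, ?_⟩
    · rwa [Set.mem_inv_smul_set_iff]
    · rwa [Set.mem_inv_smul_set_iff]
  · intro K hK
    obtain ⟨ζ, hζK, hζ1⟩ : ∃ ζ, i ζ ∈ K ∧ i ζ ≠ 1 := by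
      by_contra! hall
      have hbot : i.range.subgroupOf K = ⊥ := by
        rw [eq_bot_iff]
        rintro ⟨_, hk⟩ ⟨ζ, rfl⟩
        exact Subtype.ext (hall ζ hk)
      have : (⊥ : Subgroup K).FiniteIndex := hbot ▸ inferInstance
      exact not_finite_iff_infinite.2 hK (Nat.finite_of_card_ne_zero
        (Subgroup.index_bot (G := K) ▸ this.index_ne_zero))
    have hord : ¬IsOfFinOrder (i ζ) := not_isOfFinOrder_of_free hi hζ1
    refine ⟨i ζ, hζK, hord, ?_⟩
    by_cases hper : ∃ n : ℕ, 0 < n ∧ ∃ p : G ⧸ H, i ζ ^ n • p = p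
    · exact Or.inl hper
    right
    push Not at hper
    obtain ⟨u, j, p, x, y, hxy, ⟨N, hN⟩, N', hN'⟩ := S.exists_ends (ζ := ζ) fun n hn p => by
      rw [hact, map_pow]
      exact hper n hn p
    let s : Ultrafilter (G ⧸ H) := (Ultrafilter.of Filter.atTop).map fun n : ℕ => (u * ζ ^ n) • p
    let t : Ultrafilter (G ⧸ H) := (Ultrafilter.of Filter.atTop).map fun n : ℕ => (u * ζ⁻¹ ^ n) • p
    have hlim : ∀ {v : ℕ → G ⧸ H} {A : Set (G ⧸ H)}, (∃ N, ∀ n ≥ N, v n ∈ A) →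
        A ∈ (Ultrafilter.of Filter.atTop).map v := fun hv =>
      Ultrafilter.of_le _ (Filter.eventually_atTop.2 hv)
    have hlim' : ∀ {v : ℕ → G ⧸ H} {A : Set (G ⧸ H)}, (∃ N, ∀ n ≥ N, v n ∉ A) →
        A ∉ (Ultrafilter.of Filter.atTop).map v := fun hv =>
      Ultrafilter.compl_mem_iff_notMem.1 (hlim hv)
    have hmem : ∀ {v : ℕ → G ⧸ H} {x : ZMod 2} {N : ℕ}, (∀ n ≥ N, S.toFun (v n) (1, j) = x) →
        (f j ∈ (Ultrafilter.of Filter.atTop).map v ↔ x ≠ 0) := by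
      intro v x N h
      by_cases hx : x = 0
      · exact iff_of_false (hlim' ⟨N, fun n hn h' => h' ((h n hn).trans hx)⟩) fun h' => h' hx
      · exact iff_of_true (hlim ⟨N, fun n hn h' => hx ((h n hn).symm.trans h')⟩) hx
    obtain ⟨B, hB, hBs, hBt⟩ := hcut' s t j (by
      rw [hmem hN, hmem hN', ← zmod_two_ne_iff]
      exact hxy)
    have hconst : ∀ {w : G}, ¬IsOfFinOrder w → ∃ (P : Prop) (N : ℕ), ∀ n ≥ N,
        ((i u * w ^ n) • p ∈ B) = P := fun {w} hw => by
      refine TranslationEmbedding.eventually_const _ ?_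
      refine ((finite_setOf_separates hc ha hb hfree (hEfin B hB) (w • p) p).preimage
        (f := fun n : ℕ => i u * w ^ n) fun n _ m _ h => ?_).subset fun n hn => ?_
      · exact injective_pow_iff_not_isOfFinOrder.2 hw (mul_left_cancel h)
      · simp only [Set.mem_preimage, Set.mem_ofPred_eq, ← mul_smul, mul_assoc, ← pow_succ]
        exact fun h => hn (propext (by simpa only [mul_smul] using h))
    refine ⟨(i u)⁻¹ • B, hE.smul _ B hB, p, ?_, ?_⟩
    · obtain ⟨P, M, hM⟩ := hconst hord
      have hP : P := by
        by_contra hP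
        exact hlim' ⟨M, fun n hn h => hP ((hM n hn) ▸ (by simpa [hact] using h))⟩ hBs
      refine ⟨M, fun n hn => ?_⟩
      rw [Set.mem_inv_smul_set_iff, ← mul_smul, hM n hn]
      exact hP
    · obtain ⟨P, M, hM⟩ := hconst fun h => hord (isOfFinOrder_inv_iff.1 h)
      have hP : ¬P := fun hP =>
        hBt (hlim ⟨M, fun n hn => by
          have := (hM n hn).symm ▸ hP
          simpa [hact] using this⟩)
      refine ⟨M, fun n hn => ?_⟩
      rw [Set.mem_inv_smul_set_iff, ← mul_smul, hM n hn]
      exact hP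

end Converse

/-! ### Transport along isomorphisms -/

section Transport

variable {G G' : Type*} [Group G] [Group G'] {H : Subgroup G}

theorem IsVirtuallyFree.of_mulEquiv (e : G ≃* G') (hG : IsVirtuallyFree G) :
    IsVirtuallyFree G' := by
  obtain ⟨F, hF, hfree⟩ := hG
  refine ⟨F.map (e : G →* G'), ⟨?_⟩, IsFreeGroup.ofMulEquiv (e.subgroupMap F)⟩
  rw [Subgroup.index_map_equiv]
  exact hF.index_ne_zero

theorem ExtensionCountsAgree.map_mulEquiv (e : G ≃* G') (hH : ExtensionCountsAgree H) :
    ExtensionCountsAgree (H.map (e : G →* G')) := by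
  intro P _ _ γ₁ γ₂
  have key : ∀ γ : H.map (e : G →* G') →* P,
      Nat.card {f : G' →* P // f.comp (H.map (e : G →* G')).subtype = γ} =
        Nat.card {f : G →* P // f.comp H.subtype =
          γ.comp (e.subgroupMap H : H →* H.map (e : G →* G'))} := fun γ => by
    refine Nat.card_congr ((e.symm.monoidHomCongrLeftEquiv).subtypeEquiv fun f => ?_)
    constructor
    · rintro rfl
      rfl
    · intro h
      ext ⟨_, x, hx, rfl⟩
      exact DFunLike.congr_fun h ⟨x, hx⟩
  rw [key, key]
  exact hH P _ _

theorem Subgroup.IsFreeFactor.of_map_mulEquiv (e : G ≃* G')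
    (hH : (H.map (e : G →* G')).IsFreeFactor) : H.IsFreeFactor := by
  obtain ⟨L, hL⟩ := hH
  refine ⟨L.map (e.symm : G' →* G), ?_⟩
  have h : Monoid.Coprod.lift H.subtype (L.map (e.symm : G' →* G)).subtype =
      (e.symm : G' →* G).comp ((Monoid.Coprod.lift (H.map (e : G →* G')).subtype L.subtype).comp
        ((e.subgroupMap H).coprodCongr (e.symm.subgroupMap L).symm : _ →* _)) := by
    ext x
    · exact (e.symm_apply_apply x).symm
    · obtain ⟨y, rfl⟩ := (e.symm.subgroupMap L).surjective x
      simp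
  rw [h]
  exact e.symm.bijective.comp (hL.comp (MulEquiv.bijective _))

end Transport

/-- Let `G` be a finitely generated virtually free group and `H` a finitely
generated subgroup of `G`.  Then `H` is a free factor of `G` if and only if for every finite
group `P`, the number `h(G,H,γ,P)` of homomorphisms `G → P` extending `γ` is the same for all
homomorphisms `γ : H → P`. -/
theorem statement1 (G : Type*) [Group G] (hGfg : Group.FG G) (hGvf : IsVirtuallyFree G)
    (H : Subgroup G) (hHfg : H.FG) :
    H.IsFreeFactor ↔
      ∀ (P : Type) [Group P] [Finite P] (γ₁ γ₂ : H →* P),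
        Nat.card {f : G →* P // f.comp H.subtype = γ₁} =
          Nat.card {f : G →* P // f.comp H.subtype = γ₂} := by
  refine ⟨fun h => h.extensionCountsAgree, fun hH => ?_⟩
  obtain ⟨α, _, φ, hφ⟩ := Group.fg_iff_exists_freeGroup_hom_surjective_finite.1 hGfg
  have : Countable α := Finite.to_countable
  have : Countable G := hφ.countable
  let e : G ≃* Shrink.{0} G := Shrink.mulEquiv.symm
  exact .of_map_mulEquiv e (ExtensionCountsAgree.isFreeFactor (.map_mulEquiv e hH)
    (Group.fg_of_surjective (f := (e : G →* Shrink.{0} G)) e.surjective) (.of_mulEquiv e hGvf)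
    ((Subgroup.fg_iff_submonoid_fg _).2
      (((Subgroup.fg_iff_submonoid_fg H).1 hHfg).map (e : G →* Shrink.{0} G))))
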